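/- arXiv:1405.0771 — 2 statements merged into one kernel-verified Lean document; each statement's English description precedes it below -/
import Mathlib

section
/- For every real number C > 0 there exist an integer N ≥ 2 and a fully irreducible outer automorphism φ ∈ Out(F_N) of the free group F_N of rank N such that both stretch factors λ(φ) and λ(φ⁻¹) are strictly greater than 1 and log(λ(φ)) > C · log(λ(φ⁻¹)). -/
/-- The free group of rank `N`. -/
abbrev FreeGroupN (N : ℕ) := FreeGroup (Fin N)

/-- The subgroup of inner automorphisms of a group `G`. -/
def Inn (G : Type*) [Group G] : Subgroup (MulAut G) :=
  (MulAut.conj : G →* MulAut G).range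

instance Inn.normal (G : Type*) [Group G] : (Inn G).Normal := by
  constructor
  rintro _ ⟨g, rfl⟩ f
  refine ⟨f g, ?_⟩
  ext x
  simp [MulAut.conj, mul_assoc]

/-- The outer automorphism group `Out(G) = Aut(G)/Inn(G)`. -/
def Out (G : Type*) [Group G] := MulAut G ⧸ Inn G

instance (G : Type*) [Group G] : Group (Out G) :=
  inferInstanceAs (Group (MulAut G ⧸ Inn G))

/-- A subgroup `A ≤ G` is a free factor if there is a subgroup `B ≤ G` such that
`G` is the internal free product `A * B`, i.e. the natural map from the (external)
free product `A ∗ B` to `G` is an isomorphism. -/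
def IsFreeFactor {G : Type*} [Group G] (A : Subgroup G) : Prop :=
  ∃ B : Subgroup G, Function.Bijective (Monoid.Coprod.lift A.subtype B.subtype)

/-- An outer automorphism is fully irreducible if no positive power preserves the
conjugacy class of a proper nontrivial free factor. -/
def FullyIrreducible {N : ℕ} (φ : Out (FreeGroupN N)) : Prop :=
  ∀ k : ℕ, 0 < k →
    ∀ f : MulAut (FreeGroupN N), (QuotientGroup.mk f : Out (FreeGroupN N)) = φ ^ k →
      ∀ A : Subgroup (FreeGroupN N), IsFreeFactor A → A ≠ ⊥ → A ≠ ⊤ →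
        ∀ g : FreeGroupN N,
          A.map (f : FreeGroupN N →* FreeGroupN N) ≠
            A.map ((MulAut.conj g : MulAut (FreeGroupN N)) : FreeGroupN N →* FreeGroupN N)

/-- The cyclically reduced length of a conjugacy class `α` with respect to a
free basis of `F_N` (encoded as a group isomorphism `β` with the standard free
group of rank `N`): the minimal word length among representatives of `α`. -/
noncomputable def cycLength {N : ℕ} (β : FreeGroupN N ≃* FreeGroup (Fin N))
    (α : ConjClasses (FreeGroupN N)) : ℕ :=
  sInf ((fun g => (β g).norm) '' {g : FreeGroupN N | ConjClasses.mk g = α})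

/-- A conjugacy class `α` is periodic for an automorphism `f` if some positive power
of `f` fixes `α`. -/
def IsPeriodicClass {N : ℕ} (f : MulAut (FreeGroupN N)) (α : ConjClasses (FreeGroupN N)) : Prop :=
  ∃ k : ℕ, 0 < k ∧ ConjClasses.map ((f ^ k : MulAut (FreeGroupN N)) : FreeGroupN N →* FreeGroupN N) α = α

/-- `lam` is the stretch factor of the outer automorphism `φ`: for every automorphism `f`
representing `φ`, every free basis of `F_N` and every non-`φ`-periodic conjugacy class `α`,
the sequence `n ↦ ‖φ^n(α)‖_X^(1/n)` converges to `lam`. -/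
def HasStretchFactor {N : ℕ} (φ : Out (FreeGroupN N)) (lam : ℝ) : Prop :=
  ∀ f : MulAut (FreeGroupN N), (QuotientGroup.mk f : Out (FreeGroupN N)) = φ →
    ∀ β : FreeGroupN N ≃* FreeGroup (Fin N),
      ∀ α : ConjClasses (FreeGroupN N), ¬ IsPeriodicClass f α →
        Filter.Tendsto
          (fun n : ℕ =>
            ((cycLength β (ConjClasses.map ((f ^ n : MulAut (FreeGroupN N)) : FreeGroupN N →* FreeGroupN N) α) : ℝ)) ^ (1 / (n : ℝ)))
          Filter.atTop (nhds lam)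

namespace FreeGroup

variable {ι : Type*} [DecidableEq ι]

theorem exists_cancellation_of_isReduced {L₁ L₂ : List (ι × Bool)} (h₁ : IsReduced L₁)
    (h₂ : IsReduced L₂) :
    ∃ u t w, L₁ = u ++ t ∧ L₂ = invRev t ++ w ∧ IsReduced (u ++ w) := by
  induction L₁ using List.reverseRecOn generalizing L₂ with
  | nil => exact ⟨[], [], L₂, by simp, by simp, by simpa⟩
  | append_singleton l x ih =>
    cases L₂ with
    | nil => exact ⟨l ++ [x], [], [], by simp, by simp, by simpa⟩
    | cons y r =>
      by_cases hxy : x.1 = y.1 → x.2 = y.2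
      · refine ⟨l ++ [x], [], y :: r, by simp, by simp, ?_⟩
        refine List.isChain_append.2 ⟨h₁, h₂, ?_⟩
        simpa using hxy
      · push Not at hxy
        obtain ⟨u, t, w, rfl, rfl, h⟩ := ih (L₂ := r) (h₁.infix ⟨[], [x], by simp⟩)
          (h₂.infix ⟨[y], [], by simp⟩)
        refine ⟨u, t ++ [x], w, by simp, ?_, h⟩
        have : y = (x.1, !x.2) := by
          ext
          · exact hxy.1.symm
          · have := hxy.2
            revert this
            cases x.2 <;> cases y.2 <;> simp
        simp [invRev, this]

/-- The product `a * b` is reduced as written. -/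
def ReducedMul (a b : FreeGroup ι) : Prop := (a * b).toWord = a.toWord ++ b.toWord

theorem reducedMul_mk {u w : List (ι × Bool)} (h : IsReduced (u ++ w)) :
    ReducedMul (mk u) (mk w) := by
  have hu : IsReduced u := h.infix ⟨[], w, by simp⟩
  have hw : IsReduced w := h.infix ⟨u, [], by simp⟩
  simp [ReducedMul, mul_mk, toWord_mk, h.reduce_eq, hu.reduce_eq, hw.reduce_eq]

theorem exists_cancellation (g h : FreeGroup ι) :
    ∃ a c b, g = a * c ∧ h = c⁻¹ * b ∧ ReducedMul a c ∧ ReducedMul c⁻¹ b ∧ ReducedMul a b := by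
  obtain ⟨u, t, w, h₁, h₂, h₃⟩ := exists_cancellation_of_isReduced
    (isReduced_toWord (x := g)) (isReduced_toWord (x := h))
  refine ⟨mk u, mk t, mk w, ?_, ?_, reducedMul_mk ?_, ?_, reducedMul_mk h₃⟩
  · rw [mul_mk, ← h₁, mk_toWord]
  · rw [inv_mk, mul_mk, ← h₂, mk_toWord]
  · rw [← h₁]; exact isReduced_toWord
  · rw [inv_mk]; apply reducedMul_mk; rw [← h₂]; exact isReduced_toWord

theorem ReducedMul.norm {a b : FreeGroup ι} (h : ReducedMul a b) :
    (a * b).norm = a.norm + b.norm := by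
  simp [FreeGroup.norm, show (a * b).toWord = _ from h]

/-- `p` is a prefix of `g`. -/
def IsPrefix (p g : FreeGroup ι) : Prop := p.toWord <+: g.toWord

theorem isPrefix_iff {p g : FreeGroup ι} : IsPrefix p g ↔ ∃ s, g = p * s ∧ ReducedMul p s := by
  constructor
  · rintro ⟨s, hs⟩
    have hs' : IsReduced (p.toWord ++ s) := hs ▸ isReduced_toWord
    refine ⟨mk s, ?_, ?_⟩
    · conv_lhs => rw [← mk_toWord (x := g), ← hs, ← mul_mk, mk_toWord]
    · have := reducedMul_mk hs'
      rwa [mk_toWord] at this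
  · rintro ⟨s, rfl, h⟩
    exact ⟨s.toWord, h.symm⟩

theorem ReducedMul.isPrefix {a b : FreeGroup ι} (h : ReducedMul a b) : IsPrefix a (a * b) :=
  ⟨b.toWord, h.symm⟩

theorem prefix_append_cases {α : Type*} {l l₁ l₂ : List α} (h : l <+: l₁ ++ l₂) :
    l <+: l₁ ∨ ∃ q, l = l₁ ++ q ∧ q <+: l₂ := by
  rcases List.prefix_or_prefix_of_prefix h (List.prefix_append l₁ l₂) with h1 | ⟨q, rfl⟩
  · exact Or.inl h1
  · exact Or.inr ⟨q, rfl, (List.prefix_append_right_inj l₁).1 h⟩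

theorem IsPrefix.mul_cases {p a b : FreeGroup ι} (h : ReducedMul a b) (hp : IsPrefix p (a * b)) :
    IsPrefix p a ∨ ∃ q, IsPrefix q b ∧ p = a * q ∧ ReducedMul a q := by
  unfold IsPrefix at hp
  rw [h] at hp
  rcases prefix_append_cases hp with h1 | ⟨q, hq, hq'⟩
  · exact Or.inl h1
  · have hr : IsReduced (a.toWord ++ q) := hq ▸ isReduced_toWord
    have hqr : IsReduced q := hr.infix ⟨a.toWord, [], by simp⟩
    right
    refine ⟨mk q, ?_, ?_, ?_⟩
    · simpa [IsPrefix, hqr.reduce_eq] using hq'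
    · conv_lhs => rw [← mk_toWord (x := p), hq, ← mul_mk, mk_toWord]
    · have := reducedMul_mk hr
      rwa [mk_toWord] at this

theorem IsPrefix.norm_le {p a : FreeGroup ι} (h : IsPrefix p a) : p.norm ≤ a.norm :=
  h.length_le

theorem IsPrefix.trans {p q r : FreeGroup ι} (h : IsPrefix p q) (h' : IsPrefix q r) :
    IsPrefix p r := List.IsPrefix.trans h h'

theorem exists_lipschitz {κ : Type*} [DecidableEq κ] [Finite ι] (f : FreeGroup ι →* FreeGroup κ) :
    ∃ L : ℕ, 0 < L ∧ ∀ g, (f g).norm ≤ L * g.norm := by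
  have := Fintype.ofFinite ι
  refine ⟨1 + ∑ i, (f (of i)).norm, by omega, fun g => ?_⟩
  have key : ∀ l : List (ι × Bool), (f (mk l)).norm ≤ (1 + ∑ i, (f (of i)).norm) * l.length := by
    intro l
    induction l with
    | nil => simp [← one_eq_mk]
    | cons a l ih =>
      have h1 : (mk (a :: l) : FreeGroup ι) = mk [a] * mk l := by rw [mul_mk]; rfl
      have h2 : (f (mk [a])).norm ≤ 1 + ∑ i, (f (of i)).norm := by
        have h3 : (f (of a.1)).norm ≤ ∑ i, (f (of i)).norm :=
          Finset.single_le_sum (f := fun i => (f (of i)).norm) (by simp) (Finset.mem_univ a.1)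
        obtain ⟨i, b⟩ := a
        cases b
        · have h4 : (mk [(i, false)] : FreeGroup ι) = (of i)⁻¹ := by simp [of, inv_mk, invRev]
          rw [h4, _root_.map_inv, norm_inv_eq]
          simp at h3; omega
        · have h4 : (mk [(i, true)] : FreeGroup ι) = (of i) := rfl
          rw [h4]; simp at h3; omega
      rw [h1, _root_.map_mul, List.length_cons]
      have := norm_mul_le (f (mk [a])) (f (mk l))
      nlinarith
  have := key g.toWord
  rwa [mk_toWord] at this

theorem IsPrefix.eq_one {p : FreeGroup ι} (h : IsPrefix p 1) : p = 1 := by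
  have := h.norm_le
  simpa using this

theorem exists_prefix_near {κ : Type*} [DecidableEq κ] (f : FreeGroup ι →* FreeGroup κ) {L : ℕ}
    (hL : ∀ g, (f g).norm ≤ L * g.norm) {a : FreeGroup ι} {p : FreeGroup κ}
    (hp : IsPrefix p (f a)) :
    ∃ a' a'', a = a' * a'' ∧ ReducedMul a' a'' ∧ (p⁻¹ * f a').norm ≤ L := by
  have key : ∀ l : List (ι × Bool), IsPrefix p (f (mk l)) →
      ∃ u w, l = u ++ w ∧ (p⁻¹ * f (mk u)).norm ≤ L := by
    intro l
    induction l using List.reverseRecOn with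
    | nil =>
      intro h
      rw [← one_eq_mk, _root_.map_one] at h
      exact ⟨[], [], rfl, by simp [h.eq_one, ← one_eq_mk]⟩
    | append_singleton l x ih =>
      intro h
      by_cases hl : IsPrefix p (f (mk l))
      · obtain ⟨u, w, rfl, h'⟩ := ih hl
        exact ⟨u, w ++ [x], by simp, h'⟩
      refine ⟨l ++ [x], [], by simp, ?_⟩
      rw [← mul_mk, _root_.map_mul] at h ⊢
      have he : (f (mk [x])).norm ≤ L := by
        refine (hL _).trans ?_
        have : (mk [x]).norm ≤ 1 := norm_mk_le
        nlinarith
      obtain ⟨A, C, B, h1, h2, h3, h4, h5⟩ := exists_cancellation (f (mk l)) (f (mk [x]))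
      have h6 : f (mk l) * f (mk [x]) = A * B := by rw [h1, h2]; group
      rw [h6] at h ⊢
      rcases h.mul_cases h5 with h7 | ⟨q, hq, rfl, -⟩
      · exact absurd (h7.trans (h1 ▸ h3.isPrefix)) hl
      · obtain ⟨s, rfl, hs⟩ := isPrefix_iff.1 hq
        have h8 : (A * q)⁻¹ * (A * (q * s)) = s := by group
        rw [h8]
        rw [h2, h4.norm, hs.norm] at he
        omega
  obtain ⟨u, w, h1, h2⟩ := key a.toWord (by rwa [mk_toWord])
  refine ⟨mk u, mk w, ?_, reducedMul_mk (h1 ▸ isReduced_toWord), h2⟩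
  rw [mul_mk, ← h1, mk_toWord]

theorem ReducedMul.assoc_of {a b c d : FreeGroup ι} (h : ReducedMul (a * b) (c * d))
    (hab : ReducedMul a b) (hcd : ReducedMul c d) : ReducedMul b c := by
  have h1 : IsReduced ((a * b).toWord ++ (c * d).toWord) := by
    rw [← show (a * b * (c * d)).toWord = _ from h]; exact isReduced_toWord
  rw [hab, hcd] at h1
  have h2 := reducedMul_mk (u := b.toWord) (w := c.toWord)
    (h1.infix ⟨a.toWord, d.toWord, by simp⟩)
  rwa [mk_toWord, mk_toWord] at h2

/-- Bounded cancellation for isomorphisms between free groups. -/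
theorem bounded_cancellation [Finite ι] (f : FreeGroup ι ≃* FreeGroup ι) :
    ∃ B : ℕ, ∀ a b p c q : FreeGroup ι, ReducedMul a b → f a = p * c → f b = c⁻¹ * q →
      ReducedMul p c → ReducedMul c⁻¹ q → c.norm ≤ B := by
  obtain ⟨L, hL0, hL⟩ := exists_lipschitz f.toMonoidHom
  obtain ⟨K, hK0, hK⟩ := exists_lipschitz f.symm.toMonoidHom
  refine ⟨L + L * (K * (L + L)), fun a b p c q hab hfa hfb hpc hcq => ?_⟩
  obtain ⟨a', a'', rfl, ha, ha'⟩ := exists_prefix_near f.toMonoidHom hL (a := a) (p := p)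
    (by rw [show f.toMonoidHom a = _ from hfa]; exact hpc.isPrefix)
  obtain ⟨b', b'', rfl, hb, hb'⟩ := exists_prefix_near f.toMonoidHom hL (a := b) (p := c⁻¹)
    (by rw [show f.toMonoidHom b = _ from hfb]; exact hcq.isPrefix)
  simp only [MulEquiv.toMonoidHom_eq_coe, MonoidHom.coe_coe, inv_inv] at ha' hb' hL hK
  have h1 : ReducedMul a'' b' := hab.assoc_of ha hb
  rw [_root_.map_mul] at hfa
  have h2 : f (a'' * b') = (p⁻¹ * f a')⁻¹ * (c * f b') := by
    have : f a'' = (f a')⁻¹ * (p * c) := by rw [← hfa]; group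
    rw [_root_.map_mul, this]; group
  have h3 : (f (a'' * b')).norm ≤ L + L := by
    rw [h2]
    refine (norm_mul_le _ _).trans ?_
    rw [norm_inv_eq]
    omega
  have h4 : (a'' * b').norm ≤ K * (L + L) := by
    have := hK (f (a'' * b'))
    rw [MulEquiv.symm_apply_apply] at this
    exact this.trans (Nat.mul_le_mul_left _ h3)
  rw [h1.norm] at h4
  have h5 : c = (p⁻¹ * f a') * f a'' := by rw [mul_assoc, hfa]; group
  rw [h5]
  refine (norm_mul_le _ _).trans (add_le_add ha' ((hL _).trans (Nat.mul_le_mul_left _ (by omega))))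

variable (v : ι → ℝ)

/-- The homomorphism to the additive reals sending each generator `i` to `v i`. -/
def height (g : FreeGroup ι) : ℝ :=
  Multiplicative.toAdd (lift (fun i => Multiplicative.ofAdd (v i)) g)

/-- The length of the reduced word of `g`, where the letter `i` contributes `|v i|`. -/
def weight (g : FreeGroup ι) : ℝ := (g.toWord.map fun x => |v x.1|).sum

omit [DecidableEq ι] in
@[simp] theorem height_one : height v 1 = 0 := by simp [height]

omit [DecidableEq ι] in
@[simp] theorem height_of (i : ι) : height v (of i) = v i := by simp [height]

omit [DecidableEq ι] in
theorem height_mul (g h : FreeGroup ι) : height v (g * h) = height v g + height v h := by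
  simp [height]

omit [DecidableEq ι] in
theorem height_inv (g : FreeGroup ι) : height v g⁻¹ = -height v g := by
  simp [height]

@[simp] theorem weight_one : weight v 1 = 0 := by simp [weight]

@[simp] theorem weight_of (i : ι) : weight v (of i) = |v i| := by simp [weight]

theorem weight_nonneg (g : FreeGroup ι) : 0 ≤ weight v g :=
  List.sum_nonneg (by simp only [List.mem_map]; rintro _ ⟨x, -, rfl⟩; positivity)

theorem weight_inv (g : FreeGroup ι) : weight v g⁻¹ = weight v g := by
  simp [weight, toWord_inv, invRev, Function.comp_def]

variable {v} in
theorem ReducedMul.weight {a b : FreeGroup ι} (h : ReducedMul a b) :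
    weight v (a * b) = weight v a + weight v b := by
  simp [FreeGroup.weight, show (a * b).toWord = _ from h]

theorem weight_mul_le (g h : FreeGroup ι) : weight v (g * h) ≤ weight v g + weight v h := by
  obtain ⟨a, c, b, rfl, rfl, h1, h2, h3⟩ := exists_cancellation g h
  have h4 : a * c * (c⁻¹ * b) = a * b := by group
  rw [h4, h1.weight, h2.weight, h3.weight, weight_inv]
  linarith [weight_nonneg v c]

/-- Every element is a product of letters. -/
theorem exists_list_letters (g : FreeGroup ι) :
    ∃ l : List (FreeGroup ι), l.prod = g ∧ weight v g = (l.map (weight v)).sum ∧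
      ∀ x ∈ l, ∃ i, x = of i ∨ x = (of i)⁻¹ := by
  have h0 : ∀ x : ι × Bool, mk [x] = of x.1 ∨ mk [x] = (of x.1)⁻¹ := by
    rintro ⟨i, b⟩
    cases b
    · right; simp [of, inv_mk, invRev]
    · left; rfl
  refine ⟨g.toWord.map fun x => mk [x], ?_, ?_, ?_⟩
  · conv_rhs => rw [← mk_toWord (x := g)]
    induction g.toWord with
    | nil => simp [← one_eq_mk]
    | cons a l ih => rw [List.map_cons, List.prod_cons, ih, mul_mk]; rfl
  · simp [weight, Function.comp_def]
  · simp only [List.mem_map]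
    rintro _ ⟨x, -, rfl⟩
    exact ⟨x.1, h0 x⟩

theorem weight_prod_le (l : List (FreeGroup ι)) : weight v l.prod ≤ (l.map (weight v)).sum := by
  induction l with
  | nil => simp
  | cons a l ih =>
    simp only [List.prod_cons, List.map_cons, List.sum_cons]
    linarith [weight_mul_le v a l.prod]

theorem abs_height_le (g : FreeGroup ι) : |height v g| ≤ weight v g := by
  obtain ⟨l, rfl, h, hl⟩ := exists_list_letters v g
  rw [h]
  clear h
  induction l with
  | nil => simp
  | cons a l ih =>
    simp only [List.prod_cons, List.map_cons, List.sum_cons, height_mul]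
    have h1 := ih fun x hx => hl x (by simp [hx])
    obtain ⟨i, rfl | rfl⟩ := hl a (by simp)
    · rw [height_of, weight_of]; exact (abs_add_le _ _).trans (by linarith)
    · rw [height_inv, height_of, weight_inv, weight_of]
      refine (abs_add_le _ _).trans ?_
      rw [abs_neg]; linarith

theorem exists_weight_le_norm [Finite ι] :
    ∃ M : ℝ, 0 < M ∧ ∀ g : FreeGroup ι, weight v g ≤ M * g.norm := by
  have := Fintype.ofFinite ι
  refine ⟨1 + ∑ i, |v i|, by positivity, fun g => ?_⟩
  unfold weight norm
  induction g.toWord with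
  | nil => simp
  | cons a l ih =>
    simp only [List.map_cons, List.sum_cons, List.length_cons]
    have h3 : |v a.1| ≤ ∑ i, |v i| :=
      Finset.single_le_sum (f := fun i => |v i|) (by simp) (Finset.mem_univ a.1)
    push_cast
    linarith

variable {v}

theorem exists_norm_le_weight [Finite ι] (hv : ∀ i, v i ≠ 0) :
    ∃ M : ℝ, 0 < M ∧ ∀ g : FreeGroup ι, g.norm ≤ M * weight v g := by
  have := Fintype.ofFinite ι
  refine ⟨1 + ∑ i, |v i|⁻¹, by positivity, fun g => ?_⟩
  unfold weight norm
  induction g.toWord with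
  | nil => simp
  | cons a l ih =>
    simp only [List.map_cons, List.sum_cons, List.length_cons]
    have h3 : |v a.1|⁻¹ ≤ ∑ i, |v i|⁻¹ :=
      Finset.single_le_sum (f := fun i => |v i|⁻¹) (fun i _ => by positivity) (Finset.mem_univ a.1)
    have h4 : 0 < |v a.1| := abs_pos.2 (hv _)
    have h5 : 1 ≤ (1 + ∑ i, |v i|⁻¹) * |v a.1| := by
      have : |v a.1|⁻¹ * |v a.1| = 1 := inv_mul_cancel₀ h4.ne'
      nlinarith
    push_cast
    rw [mul_add]
    linarith

variable (v) in
/-- An element is monotone if all the letters of its reduced word have heights of the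
same sign. -/
def IsMonotone (g : FreeGroup ι) : Prop := weight v g = |height v g|

theorem IsMonotone.of_reducedMul_right {a b : FreeGroup ι} (h : ReducedMul a b)
    (hm : IsMonotone v (a * b)) : IsMonotone v b := by
  unfold IsMonotone at *
  rw [h.weight, height_mul] at hm
  linarith [abs_add_le (height v a) (height v b), abs_height_le v a, abs_height_le v b]

theorem IsMonotone.of_reducedMul_left {a b : FreeGroup ι} (h : ReducedMul a b)
    (hm : IsMonotone v (a * b)) : IsMonotone v a := by
  unfold IsMonotone at *
  rw [h.weight, height_mul] at hm
  linarith [abs_add_le (height v a) (height v b), abs_height_le v a, abs_height_le v b]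

variable (v) in
/-- An endomorphism is directed, with multiplier `θ`, if it scales heights by `θ` and
sends generators to monotone elements. -/
structure IsDirected (f : FreeGroup ι →* FreeGroup ι) (θ : ℝ) : Prop where
  height_map : ∀ g, height v (f g) = θ * height v g
  monotone_map_of : ∀ i, IsMonotone v (f (of i))

omit [DecidableEq ι] in
theorem height_map_of_forall {f : FreeGroup ι →* FreeGroup ι} {θ : ℝ}
    (h : ∀ i, height v (f (of i)) = θ * v i) (g : FreeGroup ι) :
    height v (f g) = θ * height v g := by
  induction g using FreeGroup.induction_on with
  | C1 => simp
  | of i => simpa using h i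
  | inv_of i hi => rw [_root_.map_inv, height_inv, height_inv, hi]; ring
  | mul x y hx hy => rw [_root_.map_mul, height_mul, height_mul, hx, hy]; ring

namespace IsDirected

variable {f : FreeGroup ι →* FreeGroup ι} {θ : ℝ} (hf : IsDirected v f θ)
include hf

theorem weight_map_le (g : FreeGroup ι) : weight v (f g) ≤ |θ| * weight v g := by
  obtain ⟨l, hl, h, hl'⟩ := exists_list_letters v g
  rw [h, ← hl, map_list_prod]
  refine (weight_prod_le v _).trans (le_of_eq ?_)
  have h1 : ∀ i, weight v (f (of i)) = |θ| * weight v (of i) := fun i => by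
    rw [hf.monotone_map_of i, hf.height_map, abs_mul, height_of, weight_of]
  rw [List.map_map, ← List.sum_map_mul_left]
  congr 1
  refine List.map_congr_left fun x hx => ?_
  obtain ⟨i, rfl | rfl⟩ := hl' x hx
  · exact h1 i
  · simp only [Function.comp_apply]
    rw [_root_.map_inv, weight_inv, weight_inv, h1]

theorem weight_map_eq {g : FreeGroup ι} (hg : IsMonotone v g) :
    weight v (f g) = |θ| * weight v g := by
  refine (hf.weight_map_le g).antisymm ?_
  rw [hg, ← abs_mul, ← hf.height_map]
  exact abs_height_le v _

theorem monotone_map {g : FreeGroup ι} (hg : IsMonotone v g) : IsMonotone v (f g) := by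
  unfold IsMonotone
  rw [hf.weight_map_eq hg, hf.height_map, abs_mul, hg]

theorem weight_pow_map_le (f' : MulAut (FreeGroup ι)) (hf' : ∀ g, f' g = f g)
    (n : ℕ) (g : FreeGroup ι) :
    weight v ((f' ^ n) g) ≤ |θ| ^ n * weight v g := by
  induction n with
  | zero => simp
  | succ n ih =>
    rw [pow_succ', MulAut.mul_apply, hf']
    refine (hf.weight_map_le _).trans ?_
    rw [pow_succ', mul_assoc]
    exact mul_le_mul_of_nonneg_left ih (abs_nonneg _)

end IsDirected

variable (v) in
/-- `g` is a product of `m` monotone elements. -/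
def IsMonotoneProd (m : ℕ) (g : FreeGroup ι) : Prop :=
  ∃ l : List (FreeGroup ι), l.length = m ∧ (∀ x ∈ l, IsMonotone v x) ∧ l.prod = g

theorem exists_isMonotoneProd (g : FreeGroup ι) : ∃ m, IsMonotoneProd v m g := by
  obtain ⟨l, hl, -, h⟩ := exists_list_letters v g
  refine ⟨_, l, rfl, fun x hx => ?_, hl⟩
  obtain ⟨i, rfl | rfl⟩ := h x hx
  · simp [IsMonotone]
  · simp [IsMonotone, weight_inv, height_inv]

theorem IsMonotoneProd.pow {m : ℕ} {g : FreeGroup ι} (h : IsMonotoneProd v m g) (k : ℕ) :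
    IsMonotoneProd v (k * m) (g ^ k) := by
  obtain ⟨l, rfl, h, rfl⟩ := h
  refine ⟨(List.replicate k l).flatten, by simp, ?_, ?_⟩
  · intro x hx
    simp only [List.mem_flatten, List.mem_replicate] at hx
    obtain ⟨l', ⟨-, rfl⟩, hx⟩ := hx
    exact h x hx
  · simp [List.prod_flatten]

theorem IsMonotoneProd.map {m : ℕ} {g : FreeGroup ι} (h : IsMonotoneProd v m g)
    {f : FreeGroup ι →* FreeGroup ι} {θ : ℝ} (hf : IsDirected v f θ) :
    IsMonotoneProd v m (f g) := by
  obtain ⟨l, rfl, h, rfl⟩ := h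
  refine ⟨l.map f, by simp, ?_, by rw [map_list_prod]⟩
  simp only [List.mem_map]
  rintro _ ⟨x, hx, rfl⟩
  exact hf.monotone_map (h x hx)

theorem exists_weight_cancellation [Finite ι] (f : FreeGroup ι ≃* FreeGroup ι) :
    ∃ B : ℝ, 0 ≤ B ∧ ∀ a b : FreeGroup ι, ReducedMul a b →
      weight v (f a) + weight v (f b) - B ≤ weight v (f (a * b)) := by
  obtain ⟨B, hB⟩ := bounded_cancellation f
  obtain ⟨M, hM, hM'⟩ := exists_weight_le_norm v
  refine ⟨2 * (M * B), by positivity, fun a b hab => ?_⟩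
  obtain ⟨p, c, q, h1, h2, h3, h4, h5⟩ := exists_cancellation (f a) (f b)
  have h6 : (c.norm : ℝ) ≤ B := by exact_mod_cast hB a b p c q hab h1 h2 h3 h4
  have h7 : f (a * b) = p * q := by rw [_root_.map_mul, h1, h2]; group
  rw [h7, h1, h2, h3.weight, h4.weight, h5.weight, weight_inv]
  have := hM' c
  have := mul_le_mul_of_nonneg_left h6 hM.le
  linarith

theorem IsDirected.exists_le_weight_map [Finite ι] {f : FreeGroup ι ≃* FreeGroup ι} {θ : ℝ}
    (hf : IsDirected v f.toMonoidHom θ) :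
    ∃ B : ℝ, 0 ≤ B ∧ ∀ m g, IsMonotoneProd v m g →
      |θ| * weight v g - m * B ≤ weight v (f g) := by
  obtain ⟨B, hB, hB'⟩ := exists_weight_cancellation (v := v) f
  refine ⟨B, hB, ?_⟩
  have key : ∀ l : List (FreeGroup ι), (∀ x ∈ l, IsMonotone v x) → ∀ a, IsPrefix a l.prod →
      |θ| * weight v a - l.length * B ≤ weight v (f a) := by
    intro l
    induction l using List.reverseRecOn with
    | nil =>
      intro _ a ha
      rw [List.prod_nil] at ha
      simp [ha.eq_one]
    | append_singleton l x ih =>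
      intro hl a ha
      have ih' := ih fun y hy => hl y (by simp [hy])
      have hx : IsMonotone v x := hl x (by simp)
      rw [List.prod_append, List.prod_singleton] at ha
      obtain ⟨p, c, b, h1, rfl, h3, h4, h5⟩ := exists_cancellation l.prod x
      have hb := hx.of_reducedMul_right h4
      have h6 : l.prod * (c⁻¹ * b) = p * b := by rw [h1]; group
      rw [h6] at ha
      have hp : IsPrefix p l.prod := h1 ▸ h3.isPrefix
      push_cast [List.length_append, List.length_singleton]
      rcases ha.mul_cases h5 with h7 | ⟨q, hq, rfl, h8⟩
      · have := ih' a (h7.trans hp)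
        linarith
      · obtain ⟨s, rfl, hs⟩ := isPrefix_iff.1 hq
        have hq' := hb.of_reducedMul_left hs
        have h9 := hB' p q h8
        have h10 : weight v (f q) = |θ| * weight v q := hf.weight_map_eq hq'
        have := ih' p hp
        rw [h8.weight, mul_add]
        linarith
  rintro m _ ⟨l, rfl, hl, rfl⟩
  exact key l hl _ List.prefix_rfl

open Filter Topology

variable (v) in
theorem subadditive_weight_pow (g : FreeGroup ι) : Subadditive fun k => weight v (g ^ k) :=
  fun m n => by simpa [pow_add] using weight_mul_le v (g ^ m) (g ^ n)

variable (v) in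
/-- The translation length of `g` with respect to `weight v`. -/
noncomputable def translationLength (g : FreeGroup ι) : ℝ := (subadditive_weight_pow v g).lim

variable (v) in
theorem bddBelow_weight_pow (g : FreeGroup ι) :
    BddBelow (Set.range fun k : ℕ => weight v (g ^ k) / k) :=
  ⟨0, by rintro _ ⟨k, rfl⟩; exact div_nonneg (weight_nonneg v _) (Nat.cast_nonneg k)⟩

variable (v) in
theorem tendsto_translationLength (g : FreeGroup ι) :
    Tendsto (fun k : ℕ => weight v (g ^ k) / k) atTop (𝓝 (translationLength v g)) :=
  (subadditive_weight_pow v g).tendsto_lim (bddBelow_weight_pow v g)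

variable (v) in
theorem translationLength_le (g : FreeGroup ι) : translationLength v g ≤ weight v g := by
  simpa [translationLength] using
    (subadditive_weight_pow v g).lim_le_div (bddBelow_weight_pow v g) one_ne_zero

theorem translationLength_le_of_isConj {g h : FreeGroup ι} (hgh : IsConj g h) :
    translationLength v h ≤ translationLength v g := by
  obtain ⟨c, rfl⟩ := isConj_iff.1 hgh
  have h1 : Tendsto (fun k : ℕ => weight v (g ^ k) / k + 2 * weight v c / k) atTop
      (𝓝 (translationLength v g + 0)) :=
    (tendsto_translationLength v g).add (tendsto_const_div_atTop_nhds_zero_nat _)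
  rw [add_zero] at h1
  refine le_of_tendsto_of_tendsto' (tendsto_translationLength v _) h1 fun k => ?_
  rw [← add_div]
  gcongr
  rw [conj_pow]
  have h2 := weight_mul_le v (c * g ^ k) c⁻¹
  have h3 := weight_mul_le v c (g ^ k)
  rw [weight_inv] at h2
  linarith

theorem translationLength_le_weight_of_isConj {g h : FreeGroup ι} (hgh : IsConj g h) :
    translationLength v g ≤ weight v h :=
  (translationLength_le_of_isConj hgh.symm).trans (translationLength_le v h)

variable (v) in
theorem exists_isConj_weight_le (g : FreeGroup ι) :
    ∃ h, IsConj g h ∧ weight v h ≤ translationLength v g := by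
  have hr := isReduced_toWord (x := g)
  set c := reduceCyclically g.toWord with hc
  have hcr : IsCyclicallyReduced c := reduceCyclically.isCyclicallyReduced hr
  have hconj : IsConj g (mk c) := by
    refine IsConj.symm (isConj_iff.2 ⟨mk (reduceCyclically.conjugator g.toWord), ?_⟩)
    rw [inv_mk, mul_mk, mul_mk, hc, reduceCyclically.conj_conjugator_reduceCyclically, mk_toWord]
  refine ⟨mk c, hconj, le_trans (le_of_eq ?_) (translationLength_le_of_isConj hconj)⟩
  refine tendsto_nhds_unique ?_ (tendsto_translationLength v (mk c))
  refine tendsto_const_nhds.congr' ?_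
  filter_upwards [eventually_gt_atTop 0] with k hk
  have h1 : (mk c).toWord = c := hcr.isReduced.reduce_eq
  have h2 : ((mk c) ^ k).toWord = (List.replicate k c).flatten := by
    rw [toWord_pow, h1, (hcr.flatten_replicate k).isReduced.reduce_eq]
  have h3 : weight v (mk c ^ k) = k * weight v (mk c) := by
    unfold weight
    rw [h1, h2, List.map_flatten, List.sum_flatten]
    simp
  rw [h3]
  field_simp

namespace IsDirected

variable [Finite ι] {f : MulAut (FreeGroup ι)} {θ : ℝ}

theorem exists_le_translationLength_map (hf : IsDirected v f.toMonoidHom θ) :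
    ∃ B : ℝ, 0 ≤ B ∧ ∀ m g, IsMonotoneProd v m g →
      |θ| * translationLength v g - m * B ≤ translationLength v (f g) := by
  obtain ⟨B, hB, hB'⟩ := hf.exists_le_weight_map
  refine ⟨B, hB, fun m g hg => ?_⟩
  refine le_of_tendsto_of_tendsto
    (((tendsto_translationLength v g).const_mul |θ|).sub_const (m * B))
    (tendsto_translationLength v (f g)) ?_
  filter_upwards [eventually_gt_atTop 0] with k hk
  have h1 := hB' _ _ (hg.pow k)
  have hk' : (0 : ℝ) < k := by exact_mod_cast hk
  rw [_root_.map_pow] at h1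
  rw [le_div_iff₀ hk']
  push_cast at h1
  have h2 : (|θ| * (weight v (g ^ k) / k) - m * B) * k = |θ| * weight v (g ^ k) - k * m * B := by
    field_simp
  rwa [h2]

/-- Either the conjugacy class of `g` is periodic or it grows exponentially at rate `|θ|`. -/
theorem periodic_or_exponential_growth (hf : IsDirected v f.toMonoidHom θ) (hv : ∀ i, v i ≠ 0)
    (hθ : 1 < |θ|) (g : FreeGroup ι) :
    (∃ k, 0 < k ∧ IsConj ((f ^ k) g) g) ∨
      ∃ c : ℝ, 0 < c ∧ ∃ n₀, ∀ n ≥ n₀, c * |θ| ^ n ≤ translationLength v ((f ^ n) g) := by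
  obtain ⟨B, hB, hB'⟩ := hf.exists_le_translationLength_map
  obtain ⟨m, hm⟩ := exists_isMonotoneProd (v := v) g
  have hmn : ∀ n : ℕ, IsMonotoneProd v m ((f ^ n) g) := by
    intro n
    induction n with
    | zero => simpa
    | succ n ih => rw [pow_succ', MulAut.mul_apply]; exact ih.map hf
  set D := m * B / (|θ| - 1) with hD
  have hD' : D * (|θ| - 1) = m * B := div_mul_cancel₀ _ (by linarith)
  have step : ∀ n : ℕ, |θ| * (translationLength v ((f ^ n) g) - D) ≤
      translationLength v ((f ^ (n + 1)) g) - D := by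
    intro n
    have := hB' m _ (hmn n)
    rw [pow_succ', MulAut.mul_apply]
    linarith
  by_cases h : ∃ n : ℕ, D < translationLength v ((f ^ n) g)
  · right
    obtain ⟨n₀, hn₀⟩ := h
    have hpos : 0 < |θ| := by linarith
    set e := translationLength v ((f ^ n₀) g) - D with he
    have key : ∀ j : ℕ, |θ| ^ j * e ≤ translationLength v ((f ^ (n₀ + j)) g) - D := by
      intro j
      induction j with
      | zero => simp [he]
      | succ j ih =>
        refine le_trans ?_ (step (n₀ + j))
        rw [pow_succ', mul_assoc]
        exact mul_le_mul_of_nonneg_left ih hpos.le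
    have hD0 : 0 ≤ D := div_nonneg (by positivity) (by linarith)
    refine ⟨e / |θ| ^ n₀, div_pos (by linarith) (by positivity), n₀, fun n hn => ?_⟩
    obtain ⟨j, rfl⟩ := Nat.exists_eq_add_of_le hn
    have := key j
    rw [pow_add]
    have h2 : e / |θ| ^ n₀ * (|θ| ^ n₀ * |θ| ^ j) = |θ| ^ j * e := by field_simp
    linarith
  · left
    push Not at h
    choose r hr hr' using fun n : ℕ => exists_isConj_weight_le v ((f ^ n) g)
    obtain ⟨M, hM, hM'⟩ := exists_norm_le_weight hv
    have hfin : Set.Finite {x : FreeGroup ι | x.norm ≤ ⌊M * D⌋₊} := by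
      have := (List.finite_length_le (ι × Bool) ⌊M * D⌋₊).preimage
        (toWord_injective (α := ι)).injOn
      exact this
    have hmem : ∀ n, r n ∈ {x : FreeGroup ι | x.norm ≤ ⌊M * D⌋₊} := fun n =>
      Nat.le_floor ((hM' _).trans (mul_le_mul_of_nonneg_left ((hr' n).trans (h n)) hM.le))
    obtain ⟨a, -, b, -, hab, hrab⟩ := Set.infinite_univ.exists_ne_map_eq_of_mapsTo
      (f := r) (fun n _ => hmem n) hfin
    have main : ∀ a b : ℕ, a < b → r a = r b → ∃ k, 0 < k ∧ IsConj ((f ^ k) g) g := by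
      intro a b hab hrab
      refine ⟨b - a, by omega, ?_⟩
      have h1 : IsConj ((f ^ b) g) ((f ^ a) g) := (hr b).trans (hrab ▸ (hr a).symm)
      have h2 := ((f ^ a)⁻¹ : MulAut (FreeGroup ι)).toMonoidHom.map_isConj h1
      have h3 : f ^ b = f ^ a * f ^ (b - a) := by rw [← pow_add]; congr 1; omega
      have h4 : ((f ^ a)⁻¹ : MulAut (FreeGroup ι)).toMonoidHom ((f ^ b) g) = (f ^ (b - a)) g := by
        change ((f ^ a)⁻¹ * f ^ b) g = _
        rw [h3, inv_mul_cancel_left]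
      have h5 : ((f ^ a)⁻¹ : MulAut (FreeGroup ι)).toMonoidHom ((f ^ a) g) = g := by
        change ((f ^ a)⁻¹ * f ^ a) g = _
        rw [inv_mul_cancel]; rfl
      rwa [h4, h5] at h2
    rcases lt_or_gt_of_ne hab with hlt | hlt
    · exact main a b hlt hrab
    · exact main b a hlt hrab.symm

end IsDirected

end FreeGroup

open Filter Topology in
theorem tendsto_rpow_inv_of_exponential_bounds {a : ℕ → ℝ} {c C t : ℝ} {n₀ : ℕ} (hc : 0 < c)
    (ht : 0 < t) (hl : ∀ n ≥ n₀, c * t ^ n ≤ a n) (hu : ∀ n, a n ≤ C * t ^ n) :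
    Tendsto (fun n : ℕ => a n ^ (1 / (n : ℝ))) atTop (𝓝 t) := by
  have hC : 0 < C := by
    have h1 := (hl n₀ le_rfl).trans (hu n₀)
    exact hc.trans_le (le_of_mul_le_mul_right h1 (by positivity))
  have lim : ∀ d : ℝ, 0 < d →
      Tendsto (fun n : ℕ => (d * t ^ n) ^ (1 / (n : ℝ))) atTop (𝓝 t) := by
    intro d hd
    have h1 : Tendsto (fun n : ℕ => d ^ (1 / (n : ℝ)) * t) atTop (𝓝 (d ^ (0 : ℝ) * t)) :=
      (tendsto_const_nhds.rpow tendsto_one_div_atTop_nhds_zero_nat (Or.inl hd.ne')).mul_const t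
    rw [Real.rpow_zero, one_mul] at h1
    refine h1.congr' ?_
    filter_upwards [eventually_gt_atTop 0] with n hn
    rw [Real.mul_rpow hd.le (by positivity), ← Real.rpow_natCast t n, ← Real.rpow_mul ht.le,
      mul_one_div_cancel (by exact_mod_cast hn.ne'), Real.rpow_one]
  refine tendsto_of_tendsto_of_tendsto_of_le_of_le' (lim c hc) (lim C hC) ?_ ?_
  · filter_upwards [eventually_ge_atTop n₀] with n hn
    exact Real.rpow_le_rpow (by positivity) (hl n hn) (by positivity)
  · filter_upwards [eventually_ge_atTop n₀] with n hn
    have : 0 ≤ a n := le_trans (by positivity) (hl n hn)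
    exact Real.rpow_le_rpow this (hu n) (by positivity)

theorem ConjClasses.map_mulAut_mul_conj {G : Type*} [Group G] (f f' : MulAut G)
    (h : (QuotientGroup.mk f : Out G) = QuotientGroup.mk f') (α : ConjClasses G) :
    ConjClasses.map (f : G →* G) α = ConjClasses.map (f' : G →* G) α := by
  obtain ⟨g, hg⟩ : f⁻¹ * f' ∈ Inn G := QuotientGroup.eq.1 h
  have h1 : f' = f * MulAut.conj g := by rw [hg, mul_inv_cancel_left]
  obtain ⟨x, rfl⟩ := ConjClasses.mk_surjective α
  refine ConjClasses.mk_eq_mk_iff_isConj.2 (isConj_iff.2 ⟨f g, ?_⟩)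
  rw [h1]
  simp [MulAut.conj_apply]

open FreeGroup in
theorem hasStretchFactor_of_isDirected {N : ℕ} {v : Fin N → ℝ} (hv : ∀ i, v i ≠ 0)
    {f : MulAut (FreeGroupN N)} {θ : ℝ} (hf : IsDirected v f.toMonoidHom θ) (hθ : 1 < |θ|) :
    HasStretchFactor (QuotientGroup.mk f : Out (FreeGroupN N)) |θ| := by
  intro f' hf' β α hα
  have hmap : ∀ (n : ℕ) (α : ConjClasses (FreeGroupN N)),
      ConjClasses.map ((f' ^ n : MulAut (FreeGroupN N)) : FreeGroupN N →* FreeGroupN N) α =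
        ConjClasses.map ((f ^ n : MulAut (FreeGroupN N)) : FreeGroupN N →* FreeGroupN N) α := by
    intro n α
    refine ConjClasses.map_mulAut_mul_conj _ _ ?_ α
    exact congrArg (· ^ n) hf'
  simp only [hmap]
  obtain ⟨g, rfl⟩ := ConjClasses.mk_surjective α
  have hmk : ∀ n : ℕ,
      ConjClasses.map ((f ^ n : MulAut (FreeGroupN N)) : FreeGroupN N →* FreeGroupN N)
        (ConjClasses.mk g) = ConjClasses.mk ((f ^ n) g) := fun n => rfl
  simp only [hmk]
  obtain ⟨L, hL, hL'⟩ := exists_lipschitz β.toMonoidHom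
  obtain ⟨K, hK, hK'⟩ := exists_lipschitz β.symm.toMonoidHom
  obtain ⟨M, hM, hM'⟩ := exists_weight_le_norm v
  obtain ⟨R, hR, hR'⟩ := exists_norm_le_weight hv
  rcases hf.periodic_or_exponential_growth hv hθ g with ⟨k, hk, hk'⟩ | ⟨c, hc, n₀, hn₀⟩
  · refine absurd ⟨k, hk, ?_⟩ hα
    rw [hmap, hmk]
    exact ConjClasses.mk_eq_mk_iff_isConj.2 hk'
  refine tendsto_rpow_inv_of_exponential_bounds (c := c / (M * K)) (C := L * (R * weight v g))
    (n₀ := n₀) (by positivity) (by linarith) (fun n hn => ?_) (fun n => ?_)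
  · obtain ⟨h, hh, hh'⟩ := Nat.sInf_mem (s := (fun x => (β x).norm) ''
      {x : FreeGroupN N | ConjClasses.mk x = ConjClasses.mk ((f ^ n) g)})
      ⟨_, (f ^ n) g, rfl, rfl⟩
    rw [show cycLength β (ConjClasses.mk ((f ^ n) g)) = _ from hh'.symm]
    have h1 : IsConj ((f ^ n) g) h := (ConjClasses.mk_eq_mk_iff_isConj.1 hh).symm
    have h2 := translationLength_le_weight_of_isConj (v := v) h1
    have h3 := hn₀ n hn
    have h4 := hM' h
    have h5 : (h.norm : ℝ) ≤ K * (β h).norm := by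
      have := hK' (β h)
      simp only [MulEquiv.toMonoidHom_eq_coe, MonoidHom.coe_coe, MulEquiv.symm_apply_apply] at this
      exact_mod_cast this
    have h6 := mul_le_mul_of_nonneg_left h5 hM.le
    rw [div_mul_eq_mul_div, div_le_iff₀ (by positivity)]
    linarith
  · have h1 : cycLength β (ConjClasses.mk ((f ^ n) g)) ≤ (β ((f ^ n) g)).norm :=
      Nat.sInf_le ⟨_, rfl, rfl⟩
    have h2 : (β ((f ^ n) g)).norm ≤ L * ((f ^ n) g).norm := hL' _
    have h3 : (cycLength β (ConjClasses.mk ((f ^ n) g)) : ℝ) ≤ L * ((f ^ n) g).norm := by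
      exact_mod_cast h1.trans h2
    have h4 := hR' ((f ^ n) g)
    have h5 := hf.weight_pow_map_le f (fun _ => rfl) n g
    have h6 := mul_le_mul_of_nonneg_left (h4.trans (mul_le_mul_of_nonneg_left h5 hR.le))
      (Nat.cast_nonneg (α := ℝ) L)
    linarith

section HomologicalIrreducibility

open FreeGroup

theorem exists_hom_ne_one (G : Type*) [Group G] [IsFreeGroup G] [Nontrivial G] :
    ∃ (h : G →* Multiplicative ℚ) (x : G), h x ≠ 1 := by
  rcases isEmpty_or_nonempty (IsFreeGroup.Generators G) with he | ⟨⟨s⟩⟩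
  · exfalso
    have := (IsFreeGroup.toFreeGroup G).injective.nontrivial
    exact not_subsingleton _ (inferInstance : Subsingleton (FreeGroup (IsFreeGroup.Generators G)))
  · refine ⟨IsFreeGroup.lift fun _ => Multiplicative.ofAdd 1, IsFreeGroup.of s, ?_⟩
    rw [IsFreeGroup.lift_of]
    exact fun h => one_ne_zero (congrArg Multiplicative.toAdd h)

theorem exists_hom_extending {G H : Type*} [Group G] [Group H] {A B : Subgroup G}
    (h : Function.Bijective (Monoid.Coprod.lift A.subtype B.subtype)) (α : A →* H) (β : B →* H) :
    ∃ γ : G →* H, (∀ a : A, γ a = α a) ∧ ∀ b : B, γ b = β b := by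
  let e := MulEquiv.ofBijective _ h
  refine ⟨(Monoid.Coprod.lift α β).comp e.symm.toMonoidHom, fun a => ?_, fun b => ?_⟩
  · have : e.symm a = Monoid.Coprod.inl a := by
      rw [MulEquiv.symm_apply_eq]; simp [e]
    simp [this]
  · have : e.symm b = Monoid.Coprod.inr b := by
      rw [MulEquiv.symm_apply_eq]; simp [e]
    simp [this]

theorem FreeGroup.exists_linearMap_comp_height {ι : Type*} {v : ι → ℝ}
    (hv : LinearIndependent ℚ v) (h : FreeGroup ι →* Multiplicative ℚ) :
    ∃ l : ℝ →ₗ[ℚ] ℚ, ∀ g, Multiplicative.toAdd (h g) = l (height v g) := by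
  obtain ⟨l, hl⟩ := LinearMap.exists_extend
    ((Module.Basis.span hv).constr ℚ fun i => Multiplicative.toAdd (h (of i)))
  have hl' : ∀ i, l (v i) = Multiplicative.toAdd (h (of i)) := fun i => by
    have h1 := LinearMap.congr_fun hl (Module.Basis.span hv i)
    rw [Module.Basis.constr_basis] at h1
    rw [← h1]
    simp [Module.Basis.span_apply]
  refine ⟨l, fun g => ?_⟩
  induction g using FreeGroup.induction_on with
  | C1 => simp
  | of i => rw [height_of, hl']
  | inv_of i hi => rw [_root_.map_inv, toAdd_inv, height_inv, _root_.map_neg, hi]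
  | mul x y hx hy => rw [_root_.map_mul, toAdd_mul, height_mul, _root_.map_add, hx, hy]

theorem FreeGroup.height_mem_span {ι : Type*} (v : ι → ℝ) (g : FreeGroup ι) :
    height v g ∈ Submodule.span ℚ (Set.range v) := by
  induction g using FreeGroup.induction_on with
  | C1 => simp
  | of i => exact Submodule.subset_span ⟨i, by simp⟩
  | inv_of i hi => rw [height_inv]; exact neg_mem hi
  | mul x y hx hy => rw [height_mul]; exact add_mem hx hy

/-- If all powers of the action on homology are irreducible over `ℚ`, the outer automorphism
is fully irreducible. -/
theorem fullyIrreducible_of_height {N : ℕ} {v : Fin N → ℝ} (hv : LinearIndependent ℚ v)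
    {f : MulAut (FreeGroupN N)} {θ : ℝ} (hf : ∀ g, θ * height v (f g) = height v g)
    (hθ : ∀ k, 0 < k → ∀ W : Submodule ℚ ℝ, W ≤ Submodule.span ℚ (Set.range v) →
      (∀ w ∈ W, θ ^ k * w ∈ W) → W = ⊥ ∨ W = Submodule.span ℚ (Set.range v)) :
    FullyIrreducible (QuotientGroup.mk f : Out (FreeGroupN N)) := by
  intro k hk f' hf' A hA hA1 hA2 g hg
  have hpow : ∀ (k : ℕ) (x : FreeGroupN N), θ ^ k * height v ((f ^ k) x) = height v x := by
    intro k
    induction k with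
    | zero => simp
    | succ k ih =>
      intro x
      rw [pow_succ f, MulAut.mul_apply, pow_succ', mul_assoc, ih, hf]
  have hconj : ∀ g x : FreeGroupN N, height v (MulAut.conj g x) = height v x := by
    intro g x
    rw [MulAut.conj_apply, height_mul, height_mul, height_inv]; ring
  have hf'' : ∀ x, θ ^ k * height v (f' x) = height v x := by
    obtain ⟨c, hc⟩ : (f ^ k)⁻¹ * f' ∈ Inn (FreeGroupN N) := QuotientGroup.eq.1 hf'.symm
    have h1 : f' = f ^ k * MulAut.conj c := by rw [hc, mul_inv_cancel_left]
    intro x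
    rw [h1, MulAut.mul_apply, hpow, hconj]
  set W := Submodule.span ℚ (height v '' A) with hW
  have hWA : ∀ a ∈ A, height v a ∈ W := fun a ha => Submodule.subset_span ⟨a, ha, rfl⟩
  have hWv : W ≤ Submodule.span ℚ (Set.range v) := by
    rw [hW, Submodule.span_le]
    rintro _ ⟨a, -, rfl⟩
    exact height_mem_span v a
  have hWθ : ∀ w ∈ W, θ ^ k * w ∈ W := by
    intro w hw
    induction hw using Submodule.span_induction with
    | mem x hx =>
      obtain ⟨a, ha, rfl⟩ := hx
      have h1 : MulAut.conj g a ∈ A.map (f' : FreeGroupN N →* FreeGroupN N) := by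
        rw [hg]; exact ⟨a, ha, rfl⟩
      obtain ⟨a', ha', h2⟩ := h1
      have h3 : f' a' = MulAut.conj g a := h2
      rw [← hconj g a, ← h3, hf'']
      exact hWA a' ha'
    | zero => simp
    | add x y _ _ hx hy => rw [mul_add]; exact add_mem hx hy
    | smul q x _ hx => rw [mul_smul_comm]; exact W.smul_mem q hx
  obtain ⟨B, hAB⟩ := hA
  rcases hθ k hk W hWv hWθ with h | h
  · have : Nontrivial A := (Subgroup.nontrivial_iff_ne_bot A).2 hA1
    obtain ⟨η, a, ha⟩ := exists_hom_ne_one A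
    obtain ⟨γ, hγ, -⟩ := exists_hom_extending hAB η 1
    obtain ⟨l, hl⟩ := exists_linearMap_comp_height hv γ
    have h1 := hWA a a.2
    rw [h, Submodule.mem_bot] at h1
    have h2 := hl a
    rw [h1, _root_.map_zero, hγ] at h2
    exact ha h2
  · have hB : B ≠ ⊥ := by
      rintro rfl
      refine hA2 (eq_top_iff.2 fun x _ => ?_)
      obtain ⟨y, rfl⟩ := hAB.2 x
      have h1 : (Monoid.Coprod.lift A.subtype (⊥ : Subgroup (FreeGroupN N)).subtype).range ≤ A := by
        rw [Monoid.Coprod.range_lift]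
        simp
      exact h1 ⟨y, rfl⟩
    have : Nontrivial B := (Subgroup.nontrivial_iff_ne_bot B).2 hB
    obtain ⟨η, b, hb⟩ := exists_hom_ne_one B
    obtain ⟨γ, hγ, hγ'⟩ := exists_hom_extending hAB 1 η
    obtain ⟨l, hl⟩ := exists_linearMap_comp_height hv γ
    have h1 : W ≤ LinearMap.ker l := by
      rw [hW, Submodule.span_le]
      rintro _ ⟨a, ha, rfl⟩
      have h2 := hl a
      rw [hγ ⟨a, ha⟩] at h2
      exact h2.symm
    have h2 : height v b ∈ W := h ▸ height_mem_span v b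
    have h3 := hl b
    rw [show l (height v b) = 0 from h1 h2, hγ'] at h3
    exact hb h3

end HomologicalIrreducibility

section SelmerField

open Polynomial

theorem Complex.eq_ofReal_of_norm_add_one {z : ℂ} {t : ℝ} (h : ‖z‖ = t) (h' : ‖z + 1‖ = t + 1) :
    z = t := by
  have h1 : z.re * z.re + z.im * z.im = t ^ 2 := by
    rw [← h, ← Complex.normSq_apply, Complex.normSq_eq_norm_sq]
  have h2 : (z.re + 1) * (z.re + 1) + z.im * z.im = (t + 1) ^ 2 := by
    rw [← h', ← Complex.normSq_eq_norm_sq, Complex.normSq_apply]; simp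
  have h3 : z.re = t := by linarith
  have h4 : z.im = 0 := by
    rw [h3] at h1
    have : z.im * z.im = 0 := by linarith
    simpa using this
  exact Complex.ext (by simpa using h3) (by simpa using h4)

variable {t : ℝ} {N : ℕ}

theorem minpoly_eq_selmer (hN : 2 ≤ N) (ht : t ^ N = t + 1) :
    minpoly ℚ t = X ^ N - X - 1 := by
  refine (minpoly.eq_of_irreducible_of_monic
    (X_pow_sub_X_sub_one_irreducible_rat (by omega)) ?_ ?_).symm
  · simp [ht]
  · rw [sub_sub]
    refine monic_X_pow_sub ?_
    rw [show (X + 1 : ℚ[X]) = X + C 1 by simp, degree_X_add_C]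
    exact_mod_cast hN

theorem isIntegral_of_selmer (hN : 2 ≤ N) (ht : t ^ N = t + 1) : IsIntegral ℚ t := by
  by_contra h
  have h1 := minpoly.eq_zero h
  rw [minpoly_eq_selmer hN ht] at h1
  exact (X_pow_sub_X_sub_one_irreducible_rat (by omega)).ne_zero h1

theorem natDegree_minpoly_selmer (hN : 2 ≤ N) (ht : t ^ N = t + 1) :
    (minpoly ℚ t).natDegree = N := by
  rw [minpoly_eq_selmer hN ht, sub_sub, show (X + 1 : ℚ[X]) = X + C 1 by simp]
  rw [natDegree_sub_eq_left_of_natDegree_lt, natDegree_X_pow]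
  rw [natDegree_X_add_C, natDegree_X_pow]; omega

theorem linearIndependent_neg_pow_selmer (hN : 2 ≤ N) (ht : t ^ N = t + 1) :
    LinearIndependent ℚ fun i : Fin N => (-t) ^ (i : ℕ) := by
  have h1 := (linearIndependent_pow (K := ℚ) t).comp
    (Fin.cast (natDegree_minpoly_selmer hN ht).symm) (Fin.cast_injective _)
  have h2 := h1.units_smul fun i : Fin N => ((-1 : ℚˣ) ^ (i : ℕ))
  have h3 : (fun i : Fin N => (-t) ^ (i : ℕ)) =
      (fun i : Fin N => ((-1 : ℚˣ) ^ (i : ℕ))) •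
        ((fun i : Fin (minpoly ℚ t).natDegree => t ^ (i : ℕ)) ∘
          Fin.cast (natDegree_minpoly_selmer hN ht).symm) := by
    ext i
    rw [neg_pow]
    simp [Units.smul_def, Algebra.smul_def]
  rw [h3]
  exact h2

theorem mem_adjoin_pow_selmer (ht0 : 0 < t) (ht : t ^ N = t + 1) (hN : 2 ≤ N) {m : ℕ}
    (hm : 0 < m) : t ∈ IntermediateField.adjoin ℚ {t ^ m} := by
  set E := IntermediateField.adjoin ℚ {t ^ m} with hE
  have hint : IsIntegral E t := (isIntegral_of_selmer hN ht).tower_top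
  set p := minpoly E t with hp
  let s : E := ⟨t ^ m, IntermediateField.mem_adjoin_simple_self ℚ _⟩
  have h1 : p ∣ X ^ N - X - 1 := minpoly.dvd _ _ (by simp [ht])
  have h2 : p ∣ X ^ m - C s := minpoly.dvd _ _ (by simp [s, IntermediateField.algebraMap_apply])
  let σ : E →+* ℂ := (algebraMap ℝ ℂ).comp (algebraMap E ℝ)
  have hroot : ∀ z ∈ (p.map σ).roots, z = (t : ℂ) := by
    intro z hz
    have hz0 : eval₂ σ z p = 0 := by
      rw [← eval_map]; exact (mem_roots'.1 hz).2
    have h3 : z ^ N = z + 1 := by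
      have := eval₂_eq_zero_of_dvd_of_eval₂_eq_zero σ z h1 hz0
      simp only [eval₂_sub, eval₂_X_pow, eval₂_X, eval₂_one] at this
      linear_combination this
    have h4 : z ^ m = (t : ℂ) ^ m := by
      have := eval₂_eq_zero_of_dvd_of_eval₂_eq_zero σ z h2 hz0
      simp only [eval₂_sub, eval₂_X_pow, eval₂_C] at this
      have h5 : σ s = (t : ℂ) ^ m := by
        simp [σ, s, IntermediateField.algebraMap_apply]
      rw [h5] at this
      linear_combination this
    have h5 : ‖z‖ = t := by
      have := congrArg norm h4
      rw [norm_pow, norm_pow, Complex.norm_real, Real.norm_of_nonneg ht0.le] at this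
      exact (pow_left_inj₀ (norm_nonneg _) ht0.le hm.ne').1 this
    refine Complex.eq_ofReal_of_norm_add_one h5 ?_
    rw [← h3, norm_pow, h5, ht]
  have hsep : (p.map σ).Separable := (minpoly.irreducible hint).separable.map
  have hdeg : p.natDegree = Multiset.card (p.map σ).roots := by
    rw [← natDegree_map σ]
    exact (IsAlgClosed.splits _).natDegree_eq_card_roots
  have hcard : Multiset.card (p.map σ).roots ≤ 1 := by
    have h3 := Multiset.eq_replicate_card.2 hroot
    have h4 := nodup_roots hsep
    rw [h3, Multiset.nodup_iff_count_le_one] at h4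
    simpa using h4 t
  have h5 : p.natDegree = 1 := le_antisymm (hdeg ▸ hcard) (minpoly.natDegree_pos hint)
  obtain ⟨x, hx⟩ := minpoly.natDegree_eq_one_iff.1 h5
  rw [← hx]
  exact x.2

/-- The elements of an algebra that stabilise a subspace under multiplication. -/
def multiplierSubalgebra (W : Submodule ℚ ℝ) : Subalgebra ℚ ℝ where
  carrier := {x | ∀ w ∈ W, x * w ∈ W}
  mul_mem' hx hy w hw := by rw [mul_assoc]; exact hx _ (hy _ hw)
  add_mem' hx hy w hw := by rw [add_mul]; exact add_mem (hx _ hw) (hy _ hw)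
  algebraMap_mem' q w hw := by rw [← Algebra.smul_def]; exact W.smul_mem q hw

theorem eq_bot_or_eq_span_of_selmer (ht0 : 0 < t) (ht : t ^ N = t + 1) (hN : 2 ≤ N) {k : ℕ}
    (hk : 0 < k) {W : Submodule ℚ ℝ}
    (hW : W ≤ Submodule.span ℚ (Set.range fun i : Fin N => (-t) ^ (i : ℕ)))
    (hWt : ∀ w ∈ W, (-t) ^ k * w ∈ W) :
    W = ⊥ ∨ W = Submodule.span ℚ (Set.range fun i : Fin N => (-t) ^ (i : ℕ)) := by
  have hint := isIntegral_of_selmer hN ht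
  have h1 : t ^ (2 * k) ∈ multiplierSubalgebra W := by
    have h2 : (-t) ^ k ∈ multiplierSubalgebra W := hWt
    have h3 := pow_mem h2 2
    rwa [← pow_mul, mul_comm k 2, pow_mul, neg_sq, ← pow_mul] at h3
  have h2 : t ∈ multiplierSubalgebra W := by
    have h3 := mem_adjoin_pow_selmer ht0 ht hN (m := 2 * k) (by omega)
    rw [← IntermediateField.mem_toSubalgebra,
      IntermediateField.adjoin_simple_toSubalgebra_of_isAlgebraic
        (hint.pow (2 * k)).isAlgebraic] at h3
    exact Algebra.adjoin_le (by simpa using h1) h3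
  have h3 : ∀ x ∈ IntermediateField.adjoin ℚ {t}, x ∈ multiplierSubalgebra W := by
    intro x hx
    rw [← IntermediateField.mem_toSubalgebra,
      IntermediateField.adjoin_simple_toSubalgebra_of_isAlgebraic hint.isAlgebraic] at hx
    exact Algebra.adjoin_le (by simpa using h2) hx
  have h4 : ∀ i : ℕ, (-t) ^ i ∈ IntermediateField.adjoin ℚ {t} := fun i =>
    pow_mem (neg_mem (IntermediateField.mem_adjoin_simple_self ℚ t)) i
  have h5 : ∀ w ∈ W, w ∈ IntermediateField.adjoin ℚ {t} := by
    intro w hw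
    have h6 : Submodule.span ℚ (Set.range fun i : Fin N => (-t) ^ (i : ℕ)) ≤
        Subalgebra.toSubmodule (IntermediateField.adjoin ℚ {t}).toSubalgebra := by
      rw [Submodule.span_le]
      rintro _ ⟨i, rfl⟩
      exact h4 i
    exact h6 (hW hw)
  by_cases hbot : W = ⊥
  · exact Or.inl hbot
  obtain ⟨w, hw, hw0⟩ := Submodule.exists_mem_ne_zero_of_ne_bot hbot
  refine Or.inr (hW.antisymm ?_)
  rw [Submodule.span_le]
  rintro _ ⟨i, rfl⟩
  have h6 := h3 _ (mul_mem (h4 i) (inv_mem (h5 w hw))) w hw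
  rwa [mul_assoc, inv_mul_cancel₀ hw0, mul_one] at h6

end SelmerField

section Estimates

theorem exists_selmer_root (n : ℕ) : ∃ t : ℝ, 1 < t ∧ t ≤ 2 ∧ t ^ (n + 2) = t + 1 := by
  have hc : ContinuousOn (fun t : ℝ => t ^ (n + 2) - t - 1) (Set.Icc 1 2) := by fun_prop
  have h4 : (4 : ℝ) ≤ 2 ^ (n + 2) := by
    have := one_le_pow₀ (n := n) (one_le_two : (1 : ℝ) ≤ 2)
    rw [pow_add]; linarith
  obtain ⟨t, ⟨h1, h2⟩, ht⟩ := intermediate_value_Icc (by norm_num) hc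
    (show (0 : ℝ) ∈ _ from ⟨by norm_num, by linarith⟩)
  have ht' : t ^ (n + 2) = t + 1 := by simp only at ht; linarith
  refine ⟨t, lt_of_le_of_ne h1 ?_, h2, ht'⟩
  rintro rfl
  norm_num at ht'

theorem exists_reciprocal_selmer_root (n : ℕ) :
    ∃ t : ℝ, 1 < t ∧ t ^ (n + 2) = t ^ (n + 1) + 1 := by
  have hc : ContinuousOn (fun t : ℝ => t ^ (n + 2) - t ^ (n + 1) - 1) (Set.Icc 1 2) := by fun_prop
  have h4 : (1 : ℝ) ≤ 2 ^ (n + 1) := one_le_pow₀ one_le_two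
  obtain ⟨t, ⟨h1, h2⟩, ht⟩ := intermediate_value_Icc (by norm_num) hc
    (show (0 : ℝ) ∈ _ from ⟨by norm_num, by rw [pow_succ _ (n + 1)]; linarith⟩)
  have ht' : t ^ (n + 2) = t ^ (n + 1) + 1 := by simp only at ht; linarith
  refine ⟨t, lt_of_le_of_ne h1 ?_, ht'⟩
  rintro rfl
  norm_num at ht'

theorem eventually_div_lt_log_reciprocal_selmer (c : ℝ) :
    ∀ᶠ n : ℕ in Filter.atTop, ∀ t : ℝ, 1 < t → t ^ (n + 2) = t ^ (n + 1) + 1 →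
      c / ((n + 2 : ℕ) : ℝ) < Real.log t := by
  have h1 : Filter.Tendsto (fun n : ℕ => Real.exp c * (Real.exp (c / ((n + 2 : ℕ) : ℝ)) - 1))
      Filter.atTop (nhds (Real.exp c * (Real.exp 0 - 1))) := by
    have h2 : Filter.Tendsto (fun n : ℕ => c / ((n + 2 : ℕ) : ℝ)) Filter.atTop (nhds 0) :=
      (tendsto_const_div_atTop_nhds_zero_nat c).comp (Filter.tendsto_add_atTop_nat 2)
    exact (((Real.continuous_exp.tendsto 0).comp h2).sub_const 1).const_mul _
  rw [Real.exp_zero, sub_self, mul_zero] at h1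
  filter_upwards [h1.eventually_lt_const one_pos] with n hn t ht1 ht
  by_contra! hle
  have ht0 : 0 < t := one_pos.trans ht1
  have hN : (0 : ℝ) < ((n + 2 : ℕ) : ℝ) := by positivity
  have h3 : t ≤ Real.exp (c / ((n + 2 : ℕ) : ℝ)) := (Real.log_le_iff_le_exp ht0).1 hle
  have h4 : t ^ (n + 2) ≤ Real.exp c := by
    rw [← Real.log_le_iff_le_exp (by positivity), Real.log_pow]
    rwa [le_div_iff₀ hN, mul_comm] at hle
  have h5 : t ^ (n + 1) ≤ Real.exp c := (pow_le_pow_right₀ ht1.le (by omega)).trans h4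
  have h6 : t ^ (n + 1) * (t - 1) = 1 := by
    rw [mul_sub, ← pow_succ, ht]; ring
  have h7 : t ^ (n + 1) * (t - 1) ≤ Real.exp c * (Real.exp (c / ((n + 2 : ℕ) : ℝ)) - 1) :=
    mul_le_mul h5 (by linarith) (by linarith) (Real.exp_pos c).le
  linarith

theorem log_selmer_le {n : ℕ} {t : ℝ} (ht1 : 1 < t) (ht2 : t ≤ 2) (ht : t ^ (n + 2) = t + 1) :
    Real.log t ≤ Real.log 3 / ((n + 2 : ℕ) : ℝ) := by
  rw [le_div_iff₀ (by positivity), mul_comm, ← Real.log_pow, ht]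
  exact Real.log_le_log (by linarith) (by linarith)

end Estimates

section RotationAutomorphism

open FreeGroup

/-- The endomorphism `x₀ ↦ xₙ₊₁x₀`, `xᵢ₊₁ ↦ xᵢ`. -/
def twistedRotationHom (n : ℕ) : FreeGroupN (n + 2) →* FreeGroupN (n + 2) :=
  FreeGroup.lift (Fin.cases (of (Fin.last (n + 1)) * of 0) fun i => of i.castSucc)

/-- The endomorphism `xᵢ ↦ xᵢ₊₁`, `xₙ₊₁ ↦ x₀x₁⁻¹`. -/
def twistedRotationInvHom (n : ℕ) : FreeGroupN (n + 2) →* FreeGroupN (n + 2) :=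
  FreeGroup.lift (Fin.lastCases (of 0 * (of 1)⁻¹) fun i => of i.succ)

theorem twistedRotationHom_of_zero (n : ℕ) :
    twistedRotationHom n (of 0) = of (Fin.last (n + 1)) * of 0 := by
  simp [twistedRotationHom]

theorem twistedRotationHom_of_succ (n : ℕ) (i : Fin (n + 1)) :
    twistedRotationHom n (of i.succ) = of i.castSucc := by
  simp [twistedRotationHom]

theorem twistedRotationInvHom_of_last (n : ℕ) :
    twistedRotationInvHom n (of (Fin.last (n + 1))) = of 0 * (of 1)⁻¹ := by
  simp [twistedRotationInvHom]

theorem twistedRotationInvHom_of_castSucc (n : ℕ) (i : Fin (n + 1)) :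
    twistedRotationInvHom n (of i.castSucc) = of i.succ := by
  simp [twistedRotationInvHom]

theorem twistedRotationInvHom_comp (n : ℕ) :
    (twistedRotationInvHom n).comp (twistedRotationHom n) = MonoidHom.id _ := by
  refine FreeGroup.ext_hom _ _ fun i => ?_
  cases i using Fin.cases with
  | zero =>
    rw [MonoidHom.comp_apply, twistedRotationHom_of_zero, _root_.map_mul,
      twistedRotationInvHom_of_last, ← Fin.castSucc_zero, twistedRotationInvHom_of_castSucc]
    simp
  | succ i =>
    rw [MonoidHom.comp_apply, twistedRotationHom_of_succ, twistedRotationInvHom_of_castSucc]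
    rfl

theorem twistedRotationHom_comp (n : ℕ) :
    (twistedRotationHom n).comp (twistedRotationInvHom n) = MonoidHom.id _ := by
  refine FreeGroup.ext_hom _ _ fun i => ?_
  cases i using Fin.lastCases with
  | last =>
    rw [MonoidHom.comp_apply, twistedRotationInvHom_of_last, _root_.map_mul, _root_.map_inv,
      twistedRotationHom_of_zero, ← Fin.succ_zero_eq_one, twistedRotationHom_of_succ]
    simp
  | cast i =>
    rw [MonoidHom.comp_apply, twistedRotationInvHom_of_castSucc, twistedRotationHom_of_succ]
    rfl

/-- The automorphism `x₀ ↦ xₙ₊₁x₀`, `xᵢ₊₁ ↦ xᵢ` of the free group of rank `n + 2`. -/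
def twistedRotation (n : ℕ) : MulAut (FreeGroupN (n + 2)) :=
  (twistedRotationHom n).toMulEquiv (twistedRotationInvHom n) (twistedRotationInvHom_comp n)
    (twistedRotationHom_comp n)

theorem isDirected_twistedRotation {n : ℕ} {t : ℝ} (ht1 : 1 < t)
    (ht : t ^ (n + 2) = t ^ (n + 1) + 1) :
    IsDirected (fun i : Fin (n + 2) => (t⁻¹) ^ (i : ℕ)) (twistedRotationHom n) t := by
  have ht0 : t ≠ 0 := by positivity
  have key : (t⁻¹) ^ (n + 1) + 1 = t := by
    rw [inv_pow]
    field_simp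
    rw [← pow_succ, ht]; ring
  refine ⟨?_, ?_⟩
  · refine height_map_of_forall fun i => ?_
    cases i using Fin.cases with
    | zero =>
      rw [twistedRotationHom_of_zero, height_mul, height_of, height_of]
      simpa using key
    | succ i =>
      simp only [twistedRotationHom_of_succ, height_of, Fin.val_succ, Fin.val_castSucc]
      rw [pow_succ]; field_simp
  · intro i
    refine le_antisymm ?_ (abs_height_le _ _)
    cases i using Fin.cases with
    | zero =>
      rw [twistedRotationHom_of_zero]
      refine (weight_mul_le _ _ _).trans ?_
      rw [height_mul, weight_of, weight_of, height_of, height_of,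
        abs_of_nonneg, abs_of_nonneg, abs_of_nonneg] <;> positivity
    | succ i => rw [twistedRotationHom_of_succ, weight_of, height_of]

theorem isDirected_twistedRotationInv {n : ℕ} (hn : Even n) {t : ℝ} (ht1 : 1 < t)
    (ht : t ^ (n + 2) = t + 1) :
    IsDirected (fun i : Fin (n + 2) => (-t) ^ (i : ℕ)) (twistedRotationInvHom n) (-t) := by
  have key : (-t) * (-t) ^ (n + 1) = 1 + t := by
    rw [← pow_succ', Even.neg_pow (by simpa [Nat.even_add] using hn), ht, add_comm]
  refine ⟨?_, ?_⟩
  · refine height_map_of_forall fun i => ?_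
    cases i using Fin.lastCases with
    | last =>
      rw [Fin.val_last, key]
      simp [twistedRotationInvHom_of_last, height_mul, height_of, height_inv]
    | cast i =>
      simp only [twistedRotationInvHom_of_castSucc, height_of, Fin.val_succ, Fin.val_castSucc]
      rw [pow_succ']
  · intro i
    refine le_antisymm ?_ (abs_height_le _ _)
    cases i using Fin.lastCases with
    | last =>
      rw [twistedRotationInvHom_of_last]
      refine (weight_mul_le _ _ _).trans ?_
      have h : |1 + t| = 1 + t := abs_of_pos (by linarith)
      have h' : |t| = t := abs_of_pos (by linarith)
      simp [height_mul, weight_of, height_of, weight_inv, height_inv, h, h']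
    | cast i => rw [twistedRotationInvHom_of_castSucc, weight_of, height_of]

theorem fullyIrreducible_twistedRotation {n : ℕ} (hn : Even n) {t : ℝ} (ht1 : 1 < t)
    (ht : t ^ (n + 2) = t + 1) :
    FullyIrreducible (QuotientGroup.mk (twistedRotation n) : Out (FreeGroupN (n + 2))) := by
  refine fullyIrreducible_of_height (θ := -t)
    (linearIndependent_neg_pow_selmer (by omega) ht) (fun g => ?_)
    fun k hk W hW hWt => eq_bot_or_eq_span_of_selmer (by linarith) ht (by omega) hk hW hWt
  rw [← (isDirected_twistedRotationInv hn ht1 ht).height_map]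
  exact congrArg _ ((twistedRotation n).symm_apply_apply g)

end RotationAutomorphism

/-- For every real `C > 0` there exist `N ≥ 2` and a fully irreducible
`φ ∈ Out(F_N)` with stretch factors `λ(φ), λ(φ⁻¹) > 1` and
`log λ(φ) > C · log λ(φ⁻¹)`. -/
theorem unbounded_asymmetry_of_stretch_factors :
    ∀ C : ℝ, 0 < C →
      ∃ N : ℕ, 2 ≤ N ∧
        ∃ φ : Out (FreeGroupN N), FullyIrreducible φ ∧
          ∃ l li : ℝ, HasStretchFactor φ l ∧ HasStretchFactor φ⁻¹ li ∧
            1 < l ∧ 1 < li ∧ Real.log l > C * Real.log li := by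
  intro C hC
  obtain ⟨m, hm⟩ := Filter.eventually_atTop.1
    (eventually_div_lt_log_reciprocal_selmer (C * Real.log 3))
  set n := 2 * m with hn
  have hev : Even n := ⟨m, two_mul m⟩
  obtain ⟨t, ht1, ht2, ht⟩ := exists_selmer_root n
  obtain ⟨s, hs1, hs⟩ := exists_reciprocal_selmer_root n
  refine ⟨n + 2, by omega, QuotientGroup.mk (twistedRotation n),
    fullyIrreducible_twistedRotation hev ht1 ht, s, t, ?_, ?_, hs1, ht1, ?_⟩
  · have h := hasStretchFactor_of_isDirected (f := twistedRotation n)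
      (fun i => pow_ne_zero _ (inv_ne_zero (by positivity)))
      (isDirected_twistedRotation hs1 hs) (by rwa [abs_of_pos (by linarith)])
    rwa [abs_of_pos (by linarith)] at h
  · have h := hasStretchFactor_of_isDirected (f := (twistedRotation n)⁻¹)
      (fun i => pow_ne_zero _ (neg_ne_zero.2 (by positivity)))
      (isDirected_twistedRotationInv hev ht1 ht) (by rwa [abs_neg, abs_of_pos (by linarith)])
    rwa [abs_neg, abs_of_pos (by linarith)] at h
  · have h1 := hm n (by omega) s hs1 hs
    have h2 := mul_le_mul_of_nonneg_left (log_selmer_le ht1 ht2 ht) hC.le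
    rw [← mul_div_assoc] at h2
    exact h2.trans_lt h1
end

section
/- Define, for each integer N ≥ 2, C_N = sup_φ log(λ(φ))/log(λ(φ⁻¹)), where φ ranges over all fully irreducible elements of Out(F_N). Then limsup_{N→∞} C_N = ∞; that is, the sequence (C_N)_{N≥2} is not bounded above by any real constant. -/
/-- The set of ratios `log λ(φ) / log λ(φ⁻¹)` over fully irreducible `φ ∈ Out(F_N)`. -/
def stretchRatioSet (N : ℕ) : Set ℝ :=
  {r : ℝ | ∃ φ : Out (FreeGroupN N), FullyIrreducible φ ∧
    ∃ l li : ℝ, HasStretchFactor φ l ∧ HasStretchFactor φ⁻¹ li ∧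
      r = Real.log l / Real.log li}

/-- `C_N = sup_φ log λ(φ) / log λ(φ⁻¹)` over fully irreducible `φ ∈ Out(F_N)`. -/
noncomputable def CN (N : ℕ) : ℝ := sSup (stretchRatioSet N)

namespace FreeGroup

variable {α : Type*} [DecidableEq α]

theorem IsReduced.of_isInfix {β : Type*} {L₁ L₂ : List (β × Bool)} (h : IsReduced L₂)
    (hL : L₁ <:+: L₂) : IsReduced L₁ := by
  obtain ⟨a, b, rfl⟩ := hL
  exact h.left_of_append.right_of_append

theorem IsReduced.exists_cancel {L₁ : List (α × Bool)} :
    ∀ {L₂ : List (α × Bool)}, IsReduced L₁ → IsReduced L₂ →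
      ∃ p c q, L₁ = p ++ c ∧ L₂ = invRev c ++ q ∧ IsReduced (p ++ q) := by
  induction L₁ using List.reverseRecOn with
  | nil => intro L₂ _ h; exact ⟨[], [], L₂, by simp, by simp, by simpa using h⟩
  | append_singleton L x ih =>
    intro L₂ h₁ h₂
    rcases L₂ with _ | ⟨y, L₂⟩
    · exact ⟨L ++ [x], [], [], by simp, by simp, by simpa using h₁⟩
    · by_cases hxy : x.1 = y.1 → x.2 = y.2
      · refine ⟨L ++ [x], [], y :: L₂, by simp, by simp, ?_⟩
        refine IsReduced.append_overlap h₁ ?_ (by simp)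
        simpa using ⟨hxy, h₂⟩
      · obtain ⟨p, c, q, rfl, rfl, h⟩ :=
          ih (L₂ := L₂) (h₁.of_isInfix ⟨[], [x], by simp⟩) (h₂.of_isInfix ⟨[y], [], by simp⟩)
        refine ⟨p, c ++ [x], q, by simp, ?_, h⟩
        rcases x with ⟨x, b⟩
        rcases y with ⟨y, b'⟩
        simp only [Classical.not_imp] at hxy
        obtain ⟨rfl, hb⟩ := hxy
        simp [invRev]
        cases b <;> cases b' <;> simp_all

theorem exists_toWord_mul (a b : FreeGroup α) :
    ∃ p c q, a.toWord = p ++ c ∧ b.toWord = invRev c ++ q ∧ (a * b).toWord = p ++ q := by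
  obtain ⟨p, c, q, h₁, h₂, h⟩ :=
    IsReduced.exists_cancel (isReduced_toWord (x := a)) (isReduced_toWord (x := b))
  refine ⟨p, c, q, h₁, h₂, ?_⟩
  have : a * b = mk (p ++ q) := by
    rw [← mk_toWord (x := a), ← mk_toWord (x := b), h₁, h₂]
    simp only [← mul_mk, ← inv_mk]
    group
  rw [this, toWord_mk, h.reduce_eq]

theorem getLast?_append_invRev_cons {β : Type*} (L : List (β × Bool)) (a : β × Bool)
    (p : List (β × Bool)) :
    (L ++ invRev (a :: p)).getLast? = some (a.1, !a.2) := by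
  rw [invRev_cons, ← List.append_assoc]
  simp [invRev]

theorem norm_pow_of_isCyclicallyReduced {g : FreeGroup α} (hg : IsCyclicallyReduced g.toWord)
    (n : ℕ) : (g ^ n).norm = n * g.norm := by
  rw [norm, toWord_pow, (hg.flatten_replicate n).isReduced.reduce_eq]
  simp [norm]

theorem norm_pow_le (g : FreeGroup α) (n : ℕ) : (g ^ n).norm ≤ n * g.norm := by
  induction n with
  | zero => simp
  | succ n ih => rw [pow_succ, add_mul, one_mul]; exact (norm_mul_le _ _).trans (by omega)

theorem norm_le_norm_conj {g : FreeGroup α} (hg : IsCyclicallyReduced g.toWord)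
    (h : FreeGroup α) : g.norm ≤ (h * g * h⁻¹).norm := by
  by_contra! hlt
  have h1 := norm_pow_of_isCyclicallyReduced hg (2 * h.norm + 1)
  have h2 : g ^ (2 * h.norm + 1) = h⁻¹ * (h * g * h⁻¹) ^ (2 * h.norm + 1) * h := by
    rw [conj_pow]; group
  have h3 : (g ^ (2 * h.norm + 1)).norm ≤
      h.norm + (2 * h.norm + 1) * (h * g * h⁻¹).norm + h.norm := by
    rw [h2]
    refine (norm_mul_le _ _).trans (Nat.add_le_add_right ((norm_mul_le _ _).trans ?_) _)
    rw [norm_inv_eq]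
    exact Nat.add_le_add_left (norm_pow_le _ _) _
  nlinarith

theorem exists_conj_isCyclicallyReduced (g : FreeGroup α) :
    ∃ p r : List (α × Bool), g.toWord = p ++ r ++ invRev p ∧ IsCyclicallyReduced r ∧
      g = mk p * mk r * (mk p)⁻¹ := by
  refine ⟨reduceCyclically.conjugator g.toWord, reduceCyclically g.toWord,
    (reduceCyclically.conj_conjugator_reduceCyclically _).symm,
    reduceCyclically.isCyclicallyReduced isReduced_toWord, ?_⟩
  rw [inv_mk, mul_mk, mul_mk, reduceCyclically.conj_conjugator_reduceCyclically, mk_toWord]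

theorem toWord_mk_of_isReduced {L : List (α × Bool)} (h : IsReduced L) : (mk L).toWord = L := by
  rw [toWord_mk, h.reduce_eq]


theorem cycLength_le {N : ℕ} (β : FreeGroupN N ≃* FreeGroup (Fin N)) (g : FreeGroupN N) :
    cycLength β (ConjClasses.mk g) ≤ (β g).norm :=
  Nat.sInf_le ⟨g, rfl, rfl⟩

theorem exists_cycLength_eq {N : ℕ} (β : FreeGroupN N ≃* FreeGroup (Fin N))
    (a : ConjClasses (FreeGroupN N)) :
    ∃ g : FreeGroupN N, ConjClasses.mk g = a ∧ (β g).norm = cycLength β a := by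
  obtain ⟨g, hg⟩ := ConjClasses.exists_rep a
  exact Nat.sInf_mem (s := (fun g => (β g).norm) '' {g : FreeGroupN N | ConjClasses.mk g = a})
    ⟨_, g, hg, rfl⟩

/-- The cyclically reduced length with respect to the standard basis. -/
noncomputable abbrev stdCycLength {N : ℕ} (a : ConjClasses (FreeGroupN N)) : ℕ :=
  cycLength (MulEquiv.refl _) a

theorem stdCycLength_mk_eq {N : ℕ} {g : FreeGroupN N} (hg : IsCyclicallyReduced g.toWord) :
    stdCycLength (ConjClasses.mk g) = g.norm := by
  refine le_antisymm (cycLength_le _ _) ?_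
  obtain ⟨k, hk, hk'⟩ := exists_cycLength_eq (MulEquiv.refl (FreeGroupN N)) (ConjClasses.mk g)
  obtain ⟨c, hc⟩ := isConj_iff.1 (ConjClasses.mk_eq_mk_iff_isConj.1 hk.symm)
  rw [stdCycLength, ← hk', ← hc]
  exact norm_le_norm_conj hg c

/-- A conjugator minimising the largest word length of a tuple makes that length controlled by the
cyclically reduced lengths of the entries and of their pairwise products. -/
theorem exists_conj_norm_le {N : ℕ} {ι : Type*} [Fintype ι] (g : ι → FreeGroupN N) (B : ℕ)
    (h₁ : ∀ i, stdCycLength (ConjClasses.mk (g i)) ≤ B)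
    (h₂ : ∀ i j, stdCycLength (ConjClasses.mk (g i * g j)) ≤ B) :
    ∃ h : FreeGroupN N, ∀ i, (h * g i * h⁻¹).norm ≤ B + 2 := by
  obtain ⟨h, hmin⟩ : ∃ h : FreeGroupN N, ∀ k : FreeGroupN N,
      (Finset.univ.sup fun i => (h * g i * h⁻¹).norm) ≤
        Finset.univ.sup fun i => (k * g i * k⁻¹).norm := by
    have := Function.argmin_le (fun h : FreeGroupN N =>
      Finset.univ.sup fun i => (h * g i * h⁻¹).norm)
    exact ⟨_, fun k => this k⟩
  refine ⟨h, ?_⟩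
  by_contra! hcon
  obtain ⟨i₀, hi₀⟩ := hcon
  set G : ι → FreeGroupN N := fun i => h * g i * h⁻¹ with hG
  have hGcl : ∀ i, stdCycLength (ConjClasses.mk (G i)) ≤ B := fun i => by
    rw [show ConjClasses.mk (G i) = ConjClasses.mk (g i) from
      ConjClasses.mk_eq_mk_iff_isConj.2 (isConj_iff.2 ⟨h⁻¹, by simp [hG]; group⟩)]
    exact h₁ i
  have hGcl₂ : ∀ i j, stdCycLength (ConjClasses.mk (G i * G j)) ≤ B := fun i j => by
    rw [show ConjClasses.mk (G i * G j) = ConjClasses.mk (g i * g j) from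
      ConjClasses.mk_eq_mk_iff_isConj.2 (isConj_iff.2 ⟨h⁻¹, by simp [hG]; group⟩)]
    exact h₂ i j
  obtain ⟨i, -, hi⟩ := Finset.exists_mem_eq_sup Finset.univ ⟨i₀, Finset.mem_univ _⟩
    fun i => (G i).norm
  set D := (G i).norm with hD
  have hDB : B + 2 < D := hi₀.trans_le (hi ▸ Finset.le_sup (f := fun i => (G i).norm)
    (Finset.mem_univ i₀))
  have key : ∀ j, B < (G j).norm → ∃ a p r, (G j).toWord = a :: p ++ r ++ invRev (a :: p) ∧
      ((mk [a])⁻¹ * G j * mk [a]).norm + 2 ≤ (G j).norm := by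
    intro j hj
    obtain ⟨p, r, hw, hr, hg⟩ := exists_conj_isCyclicallyReduced (G j)
    have hrl : r.length ≤ B := by
      have hc := hGcl j
      rw [show ConjClasses.mk (G j) = ConjClasses.mk (mk r) from
        ConjClasses.mk_eq_mk_iff_isConj.2 (isConj_iff.2 ⟨(mk p)⁻¹, by rw [hg]; group⟩),
        stdCycLength_mk_eq (by rwa [toWord_mk_of_isReduced hr.isReduced]), norm,
        toWord_mk_of_isReduced hr.isReduced] at hc
      exact hc
    rcases p with _ | ⟨a, p⟩
    · exfalso
      rw [norm, hw] at hj
      simp at hj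
      omega
    · refine ⟨a, p, r, hw, ?_⟩
      have : (mk [a])⁻¹ * G j * mk [a] = mk (p ++ r ++ invRev p) := by
        rw [hg, show a :: p = [a] ++ p from rfl]
        simp only [← mul_mk, ← inv_mk]
        group
      rw [this]
      refine (Nat.add_le_add_right norm_mk_le 2).trans ?_
      rw [norm, hw]
      simp
  obtain ⟨a, p, r, hw, ha⟩ := key i (by omega)
  have hk := hmin ((mk [a])⁻¹ * h)
  obtain ⟨j, -, hj⟩ := Finset.exists_mem_eq_sup Finset.univ ⟨i₀, Finset.mem_univ _⟩
    fun i => ((mk [a])⁻¹ * h * g i * ((mk [a])⁻¹ * h)⁻¹).norm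
  rw [hj, hi] at hk
  have hj' : (mk [a])⁻¹ * h * g j * ((mk [a])⁻¹ * h)⁻¹ = (mk [a])⁻¹ * G j * mk [a] := by
    simp only [hG]; group
  simp only [hj'] at hk
  have hjn : D ≤ (G j).norm + 2 := by
    have e1 := norm_mul_le ((mk [a])⁻¹ * G j) (mk [a])
    have e2 := norm_mul_le (mk [a])⁻¹ (G j)
    have e3 : (mk [a]).norm ≤ 1 := norm_mk_le
    rw [norm_inv_eq] at e2
    omega
  obtain ⟨b, p', r', hw', hb⟩ := key j (by omega)
  have hab : a ≠ b := by
    rintro rfl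
    have := Finset.le_sup (f := fun i => (G i).norm) (Finset.mem_univ j)
    rw [hi] at this
    omega
  have hab' : (a.1, !a.2).1 = b.1 → (a.1, !a.2).2 = b.2 := by
    intro h1
    by_contra h2
    apply hab
    refine Prod.ext h1 ?_
    · cases ha2 : a.2 <;> cases hb2 : b.2 <;> simp_all
  have hba' : (b.1, !b.2).1 = a.1 → (b.1, !b.2).2 = a.2 := by
    intro h1
    by_contra h2
    apply hab
    refine Prod.ext h1.symm ?_
    · cases ha2 : a.2 <;> cases hb2 : b.2 <;> simp_all
  have hred : IsReduced ((G i).toWord ++ (G j).toWord) := by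
    rw [IsReduced, List.isChain_append]
    refine ⟨isReduced_toWord, isReduced_toWord, ?_⟩
    rw [hw, hw', getLast?_append_invRev_cons]
    intro x hx y hy
    simp at hx hy
    subst hx hy
    exact hab'
  have hmul : (G i * G j).toWord = (G i).toWord ++ (G j).toWord := by
    rw [toWord_mul, hred.reduce_eq]
  have hcyc : IsCyclicallyReduced (G i * G j).toWord := by
    refine ⟨isReduced_toWord, ?_⟩
    rw [hmul, hw, hw', ← List.append_assoc, getLast?_append_invRev_cons]
    intro x hx y hy
    simp at hx hy
    subst hx hy
    exact hba'
  have := hGcl₂ i j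
  rw [stdCycLength_mk_eq hcyc, norm, hmul, List.length_append] at this
  change (G i).norm + (G j).norm ≤ B at this
  omega

/-- A `2 × 2` matrix attached to a letter: the given one, or its adjugate for an inverse letter. -/
def letterMat {ι R : Type*} [CommRing R] (M : ι → Matrix (Fin 2) (Fin 2) R) (p : ι × Bool) :
    Matrix (Fin 2) (Fin 2) R :=
  if p.2 then M p.1 else (M p.1).adjugate

/-- The product of the letter matrices along a word. -/
def wordMat {ι R : Type*} [CommRing R] (M : ι → Matrix (Fin 2) (Fin 2) R)
    (L : List (ι × Bool)) : Matrix (Fin 2) (Fin 2) R :=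
  (L.map (letterMat M)).prod

/-- The product of the determinants of the inverse letters of a word. -/
def negDet {ι R : Type*} [CommRing R] (M : ι → Matrix (Fin 2) (Fin 2) R)
    (L : List (ι × Bool)) : R :=
  (L.map fun p => if p.2 then 1 else (M p.1).det).prod

theorem letterMat_map {ι R S : Type*} [CommRing R] [CommRing S] (φ : R →+* S)
    (M : ι → Matrix (Fin 2) (Fin 2) R) (p : ι × Bool) :
    φ.mapMatrix (letterMat M p) = letterMat (fun i => φ.mapMatrix (M i)) p := by
  unfold letterMat
  split_ifs
  · rfl
  · rw [RingHom.map_adjugate]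

theorem wordMat_map {ι R S : Type*} [CommRing R] [CommRing S] (φ : R →+* S)
    (M : ι → Matrix (Fin 2) (Fin 2) R) (L : List (ι × Bool)) :
    φ.mapMatrix (wordMat M L) = wordMat (fun i => φ.mapMatrix (M i)) L := by
  simp only [wordMat, map_list_prod, List.map_map]
  congr 2
  funext p
  exact letterMat_map φ M p

theorem negDet_map {ι R S : Type*} [CommRing R] [CommRing S] (φ : R →+* S)
    (M : ι → Matrix (Fin 2) (Fin 2) R) (L : List (ι × Bool)) :
    φ (negDet M L) = negDet (fun i => φ.mapMatrix (M i)) L := by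
  simp only [negDet, map_list_prod, List.map_map]
  congr 2
  funext p
  simp only [Function.comp]
  split_ifs
  · exact RingHom.map_one φ
  · exact RingHom.map_det φ _

theorem letterMat_eq {ι k : Type*} [Field k] (m : ι → GL (Fin 2) k) (p : ι × Bool) :
    letterMat (fun i => (m i : Matrix (Fin 2) (Fin 2) k)) p =
      (if p.2 then 1 else (m p.1 : Matrix (Fin 2) (Fin 2) k).det) •
        ((if p.2 then m p.1 else (m p.1)⁻¹ : GL (Fin 2) k) : Matrix (Fin 2) (Fin 2) k) := by
  unfold letterMat
  split_ifs
  · simp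
  · rw [Matrix.coe_units_inv, Matrix.inv_def, smul_smul, Ring.mul_inverse_cancel, one_smul]
    exact (Matrix.isUnit_iff_isUnit_det _).1 (m p.1).isUnit

theorem wordMat_eq {ι k : Type*} [Field k] (m : ι → GL (Fin 2) k) (L : List (ι × Bool)) :
    wordMat (fun i => (m i : Matrix (Fin 2) (Fin 2) k)) L =
      negDet (fun i => (m i : Matrix (Fin 2) (Fin 2) k)) L •
        (FreeGroup.lift m (mk L) : Matrix (Fin 2) (Fin 2) k) := by
  induction L with
  | nil => simp [wordMat, negDet, ← one_eq_mk]
  | cons p L ih =>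
    have h1 : FreeGroup.lift m (mk (p :: L)) =
        (if p.2 then m p.1 else (m p.1)⁻¹) * FreeGroup.lift m (mk L) := by
      rw [show p :: L = [p] ++ L from rfl, ← mul_mk, MonoidHom.map_mul]
      congr 1
      simp [lift_mk, cond_eq_ite]
    have h2 : wordMat (fun i => (m i : Matrix (Fin 2) (Fin 2) k)) (p :: L) =
        letterMat (fun i => (m i : Matrix (Fin 2) (Fin 2) k)) p *
          wordMat (fun i => (m i : Matrix (Fin 2) (Fin 2) k)) L := by
      simp [wordMat]
    have h3 : negDet (fun i => (m i : Matrix (Fin 2) (Fin 2) k)) (p :: L) =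
        (if p.2 then 1 else (m p.1 : Matrix (Fin 2) (Fin 2) k).det) *
          negDet (fun i => (m i : Matrix (Fin 2) (Fin 2) k)) L := by
      simp [negDet]
    rw [h1, h2, h3, ih, letterMat_eq, Units.val_mul, Matrix.smul_mul, Matrix.mul_smul, smul_smul]

/-- The vector spanning the image of the rank one matrix attached to a letter. -/
def letterVec {N : ℕ} (p : Fin N × Bool) : Fin 2 → ℚ :=
  if p.2 then ![1, (p.1 : ℚ) + 1] else ![(p.1 : ℚ) + 1, -1]

/-- Rank one matrices in general position. -/
def rankOneMat {N : ℕ} (i : Fin N) : Matrix (Fin 2) (Fin 2) ℚ :=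
  Matrix.vecMulVec (letterVec (i, true)) (letterVec (i, true))

theorem letterMat_rankOneMat {N : ℕ} (p : Fin N × Bool) :
    letterMat rankOneMat p = Matrix.vecMulVec (letterVec p) (letterVec p) := by
  rcases p with ⟨i, b⟩
  cases b
  · ext a c
    fin_cases a <;> fin_cases c <;>
      simp [letterMat, rankOneMat, Matrix.adjugate_fin_two, Matrix.vecMulVec, letterVec]
  · simp [letterMat, rankOneMat]

theorem letterVec_dotProduct_ne_zero {N : ℕ} {p q : Fin N × Bool} (h : p.1 = q.1 → p.2 = q.2) :
    letterVec p ⬝ᵥ letterVec q ≠ 0 := by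
  rcases p with ⟨i, b⟩
  rcases q with ⟨j, c⟩
  simp only at h
  have hi : (0 : ℚ) ≤ i := by positivity
  have hj : (0 : ℚ) ≤ j := by positivity
  have hij : (i : ℚ) = j → b = c := fun h' => h (Fin.ext (by exact_mod_cast h'))
  cases b <;> cases c <;> simp only [letterVec, dotProduct, Fin.sum_univ_two, if_true,
    Bool.false_eq_true, if_false, Matrix.cons_val_zero, Matrix.cons_val_one]
  · nlinarith
  · intro h'
    exact Bool.false_ne_true (hij (by linarith))
  · intro h'
    exact Bool.false_ne_true (hij (by linarith)).symm
  · nlinarith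

theorem wordMat_rankOneMat {N : ℕ} (L : List (Fin N × Bool)) :
    ∀ p, IsReduced (p :: L) → ∃ (κ : ℚ) (q : Fin N × Bool), κ ≠ 0 ∧
      wordMat rankOneMat (p :: L) = κ • Matrix.vecMulVec (letterVec p) (letterVec q) := by
  induction L with
  | nil =>
    intro p _
    exact ⟨1, p, one_ne_zero, by simp [wordMat, letterMat_rankOneMat]⟩
  | cons p' L ih =>
    intro p hp
    rw [isReduced_cons_cons] at hp
    obtain ⟨κ, q, hκ, h⟩ := ih p' hp.2
    refine ⟨κ * (letterVec p ⬝ᵥ letterVec p'), q,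
      mul_ne_zero hκ (letterVec_dotProduct_ne_zero hp.1), ?_⟩
    have : wordMat rankOneMat (p :: p' :: L) =
        letterMat rankOneMat p * wordMat rankOneMat (p' :: L) := by simp [wordMat]
    rw [this, h, letterMat_rankOneMat, Matrix.mul_smul, Matrix.vecMulVec_mul_vecMulVec]
    ext a b
    simp [Matrix.vecMulVec]
    ring

theorem wordMat_rankOneMat_ne_zero {N : ℕ} {L : List (Fin N × Bool)} (h : IsReduced L) :
    wordMat rankOneMat L 0 0 ≠ 0 := by
  rcases L with _ | ⟨p, L⟩
  · simp [wordMat]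
  · obtain ⟨κ, q, hκ, hw⟩ := wordMat_rankOneMat L p h
    have key : ∀ p : Fin N × Bool, letterVec p 0 ≠ 0 := by
      rintro ⟨i, b⟩
      have hi : (0 : ℚ) ≤ i := by positivity
      cases b <;> simp [letterVec]
      positivity
    rw [hw]
    simp [Matrix.vecMulVec, hκ, key]

section Line

open Polynomial

/-- The line through `Z` in the direction of the rank one matrices. -/
noncomputable def lineMat {N : ℕ} (Z : Fin N → Matrix (Fin 2) (Fin 2) ℚ) (i : Fin N) :
    Matrix (Fin 2) (Fin 2) ℚ[X] :=
  Matrix.of fun a b => C (Z i a b) + X * C (rankOneMat i a b)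

theorem eval_lineMat {N : ℕ} (Z : Fin N → Matrix (Fin 2) (Fin 2) ℚ) (t : ℚ) (i : Fin N) :
    (evalRingHom t).mapMatrix (lineMat Z i) = Z i + t • rankOneMat i := by
  ext a b
  have h : (C (Z i a b) + X * C (rankOneMat i a b)).eval t = Z i a b + t * rankOneMat i a b := by
    rw [eval_add, eval_mul, eval_C, eval_C, eval_X]
  exact h

theorem natDegree_lineMat_le {N : ℕ} (Z : Fin N → Matrix (Fin 2) (Fin 2) ℚ) (i : Fin N)
    (a b : Fin 2) : (lineMat Z i a b).natDegree ≤ 1 := by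
  simp only [lineMat, Matrix.of_apply]
  compute_degree

theorem coeff_lineMat {N : ℕ} (Z : Fin N → Matrix (Fin 2) (Fin 2) ℚ) (i : Fin N)
    (a b : Fin 2) : (lineMat Z i a b).coeff 1 = rankOneMat i a b := by
  simp [lineMat, coeff_C]

theorem natDegree_det_lineMat_le {N : ℕ} (Z : Fin N → Matrix (Fin 2) (Fin 2) ℚ) (i : Fin N) :
    (lineMat Z i).det.natDegree ≤ 1 := by
  have : (lineMat Z i).det = C (Z i).det +
      X * C (Z i 0 0 * rankOneMat i 1 1 + Z i 1 1 * rankOneMat i 0 0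
        - Z i 0 1 * rankOneMat i 1 0 - Z i 1 0 * rankOneMat i 0 1) := by
    rw [Matrix.det_fin_two, Matrix.det_fin_two]
    simp only [lineMat, Matrix.of_apply, rankOneMat, Matrix.vecMulVec, C_sub, C_add, C_mul]
    ring
  rw [this]
  compute_degree

theorem natDegree_letterMat_lineMat {N : ℕ} (Z : Fin N → Matrix (Fin 2) (Fin 2) ℚ)
    (p : Fin N × Bool) (a b : Fin 2) :
    (letterMat (lineMat Z) p a b).natDegree ≤ 1 ∧
      (letterMat (lineMat Z) p a b).coeff 1 = letterMat rankOneMat p a b := by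
  rcases p with ⟨i, c⟩
  cases c
  · fin_cases a <;> fin_cases b <;>
      simp [letterMat, Matrix.adjugate_fin_two, natDegree_lineMat_le, coeff_lineMat]
  · simp [letterMat, natDegree_lineMat_le, coeff_lineMat]

theorem natDegree_wordMat_lineMat {N : ℕ} (Z : Fin N → Matrix (Fin 2) (Fin 2) ℚ)
    (L : List (Fin N × Bool)) (a b : Fin 2) :
    (wordMat (lineMat Z) L a b).natDegree ≤ L.length ∧
      (wordMat (lineMat Z) L a b).coeff L.length = wordMat rankOneMat L a b := by
  induction L generalizing a with
  | nil => fin_cases a <;> fin_cases b <;> simp [wordMat]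
  | cons p L ih =>
    have h1 : ∀ {R : Type} [CommRing R] (M : Fin N → Matrix (Fin 2) (Fin 2) R),
        wordMat M (p :: L) a b = letterMat M p a 0 * wordMat M L 0 b +
          letterMat M p a 1 * wordMat M L 1 b := by
      intro R _ M
      simp [wordMat, Matrix.mul_apply, Fin.sum_univ_two]
    have hm : ∀ c, (letterMat (lineMat Z) p a c * wordMat (lineMat Z) L c b).natDegree ≤
        L.length + 1 := fun c => (natDegree_mul_le).trans (by
          have := (natDegree_letterMat_lineMat Z p a c).1
          have := (ih c).1
          omega)
    have hc : ∀ c, (letterMat (lineMat Z) p a c * wordMat (lineMat Z) L c b).coeff (L.length + 1) =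
        letterMat rankOneMat p a c * wordMat rankOneMat L c b := fun c => by
      rw [add_comm, coeff_mul_add_eq_of_natDegree_le (natDegree_letterMat_lineMat Z p a c).1 (ih c).1,
        (natDegree_letterMat_lineMat Z p a c).2, (ih c).2]
    rw [h1, h1, List.length_cons, coeff_add, hc, hc]
    exact ⟨(natDegree_add_le _ _).trans (max_le (hm 0) (hm 1)), rfl⟩

theorem natDegree_negDet_lineMat_le {N : ℕ} (Z : Fin N → Matrix (Fin 2) (Fin 2) ℚ)
    (L : List (Fin N × Bool)) :
    (negDet (lineMat Z) L).natDegree + (L.filter fun p => p.2).length ≤ L.length := by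
  induction L with
  | nil => simp [negDet]
  | cons p L ih =>
    rcases p with ⟨i, c⟩
    cases c
    · have h : negDet (lineMat Z) ((i, false) :: L) = (lineMat Z i).det * negDet (lineMat Z) L := by
        simp [negDet]
      rw [h]
      have := natDegree_det_lineMat_le Z i
      have := natDegree_mul_le (p := (lineMat Z i).det) (q := negDet (lineMat Z) L)
      simp
      omega
    · have h : negDet (lineMat Z) ((i, true) :: L) = negDet (lineMat Z) L := by
        simp [negDet]
      rw [h]
      simp
      omega

/-- A sum of terms `c j * a ^ j * b ^ (E - j)` does not vanish when the degree gap between `a` and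
`b` exceeds the degrees of the coefficients. -/
theorem sum_mul_pow_mul_pow_ne_zero {E D : ℕ} {c : ℕ → ℚ[X]} {a b : ℚ[X]} {J : ℕ} (hJ : J ≤ E)
    (hcJ : c J ≠ 0) (hc : ∀ j, J < j → c j = 0) (hD : ∀ j, (c j).natDegree ≤ D) (hb : b ≠ 0)
    (ha : a ≠ 0) (hab : b.natDegree + D < a.natDegree) :
    ∑ j ∈ Finset.range (E + 1), c j * a ^ j * b ^ (E - j) ≠ 0 := by
  intro h
  have hne : c J * a ^ J * b ^ (E - J) ≠ 0 :=
    mul_ne_zero (mul_ne_zero hcJ (pow_ne_zero _ ha)) (pow_ne_zero _ hb)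
  have hdeg : (c J * a ^ J * b ^ (E - J)).natDegree =
      (c J).natDegree + J * a.natDegree + (E - J) * b.natDegree := by
    rw [natDegree_mul (mul_ne_zero hcJ (pow_ne_zero _ ha)) (pow_ne_zero _ hb),
      natDegree_mul hcJ (pow_ne_zero _ ha), natDegree_pow, natDegree_pow]
  have h' := congrArg (fun P => P.coeff (c J * a ^ J * b ^ (E - J)).natDegree) h
  simp only [finsetSum_coeff, coeff_zero] at h'
  rw [Finset.sum_eq_single J] at h'
  · exact hne (leadingCoeff_eq_zero.1 h')
  · intro j hj hjJ
    rcases lt_or_gt_of_ne hjJ with hlt | hgt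
    · apply coeff_eq_zero_of_natDegree_lt
      rw [hdeg]
      refine natDegree_mul_le.trans_lt ?_
      have h1 : (c j * a ^ j).natDegree ≤ D + j * a.natDegree :=
        natDegree_mul_le.trans (Nat.add_le_add (hD j) natDegree_pow_le)
      have h2 : (b ^ (E - j)).natDegree ≤ (E - j) * b.natDegree := natDegree_pow_le
      obtain ⟨d, rfl⟩ : ∃ d, J = j + 1 + d := ⟨J - j - 1, by omega⟩
      obtain ⟨e, rfl⟩ : ∃ e, E = j + 1 + d + e := ⟨E - (j + 1 + d), by omega⟩
      have e1 : j + 1 + d + e - j = 1 + d + e := by omega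
      have e2 : j + 1 + d + e - (j + 1 + d) = e := by omega
      rw [e1] at h2 ⊢
      rw [e2]
      have : d * b.natDegree ≤ d * a.natDegree := Nat.mul_le_mul_left _ (by omega)
      nlinarith
    · simp [hc j hgt]
  · intro hJ'
    simp at hJ'
    omega

end Line

/-- Elements of a polynomial ring satisfy an algebraic relation of controlled degree. -/
theorem exists_relation {σ : Type*} [Fintype σ] [DecidableEq σ] (P Q : σ → MvPolynomial σ ℚ)
    (s₀ : σ) {B d₀ : ℕ} (hP : ∀ s, (P s).totalDegree ≤ B) (hQ : ∀ s, (Q s).totalDegree ≤ B)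
    (hd₀ : d₀ = (Fintype.card σ * B + 2) ^ Fintype.card σ) :
    ∃ c : ℕ → MvPolynomial σ ℚ, (∃ j ≤ d₀, c j ≠ 0) ∧ (∀ j, d₀ < j → c j = 0) ∧
      (∀ j, (c j).totalDegree ≤ Fintype.card σ * d₀) ∧
      ∀ z : σ → ℚ, (∀ s, MvPolynomial.eval z (Q s) ≠ 0) →
        ∑ j ∈ Finset.range (d₀ + 1),
          MvPolynomial.eval (fun s => MvPolynomial.eval z (P s) / MvPolynomial.eval z (Q s)) (c j) *
            z s₀ ^ j = 0 := by
  classical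
  set n := Fintype.card σ with hn
  let X := n * d₀ * B + d₀
  let G : Fin (d₀ + 1) × (σ → Fin d₀) → MvPolynomial σ ℚ := fun je =>
    (∏ s, P s ^ (je.2 s : ℕ) * Q s ^ (d₀ - je.2 s)) * MvPolynomial.X s₀ ^ (je.1 : ℕ)
  have hG : ∀ je, (G je).totalDegree ≤ X := by
    intro je
    refine (MvPolynomial.totalDegree_mul _ _).trans (Nat.add_le_add ?_ ?_)
    · refine (MvPolynomial.totalDegree_finsetProd _ _).trans ?_
      calc _ ≤ ∑ _s : σ, d₀ * B := by
            refine Finset.sum_le_sum fun s _ => ?_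
            refine (MvPolynomial.totalDegree_mul _ _).trans ?_
            have h1 := (MvPolynomial.totalDegree_pow (P s) (je.2 s)).trans
              (Nat.mul_le_mul_left _ (hP s))
            have h2 := (MvPolynomial.totalDegree_pow (Q s) (d₀ - je.2 s)).trans
              (Nat.mul_le_mul_left _ (hQ s))
            refine (Nat.add_le_add h1 h2).trans (le_of_eq ?_)
            rw [← Nat.add_mul]
            have := (je.2 s).2
            congr 1
            omega
        _ = n * d₀ * B := by simp [hn, mul_assoc]
    · refine (MvPolynomial.totalDegree_pow _ _).trans ?_
      rw [MvPolynomial.totalDegree_X]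
      have := je.1.2
      omega
  let M : Matrix (σ → Fin (X + 1)) (Fin (d₀ + 1) × (σ → Fin d₀)) ℚ :=
    Matrix.of fun d je => (G je).coeff (Finsupp.equivFunOnFinite.symm fun s => (d s : ℕ))
  have hker : LinearMap.ker M.mulVecLin ≠ ⊥ := by
    apply LinearMap.ker_ne_bot_of_finrank_lt
    simp only [Module.finrank_fintype_fun_eq_card, Fintype.card_prod, Fintype.card_pi,
      Fintype.card_fin, Finset.prod_const, Finset.card_univ, ← hn]
    have h1 : X + 1 ≤ (n * B + 2) * d₀ := by
      have : 1 ≤ d₀ := by rw [hd₀]; exact Nat.one_le_pow _ _ (by omega)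
      simp only [X]
      nlinarith
    calc (X + 1) ^ n ≤ ((n * B + 2) * d₀) ^ n := Nat.pow_le_pow_left h1 n
      _ = d₀ * d₀ ^ n := by rw [Nat.mul_pow, ← hd₀]
      _ < (d₀ + 1) * d₀ ^ n := by
        have : 0 < d₀ := by rw [hd₀]; positivity
        exact Nat.mul_lt_mul_of_pos_right (by omega) (by positivity)
  obtain ⟨u, hu, hu0⟩ := (Submodule.ne_bot_iff _).1 hker
  have hF : ∑ je, MvPolynomial.C (u je) * G je = 0 := by
    ext d
    rw [MvPolynomial.coeff_sum, MvPolynomial.coeff_zero]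
    simp only [MvPolynomial.coeff_C_mul]
    by_cases hd : ∀ s, d s < X + 1
    · have := congrFun (LinearMap.mem_ker.1 hu) fun s => ⟨d s, hd s⟩
      simp only [Matrix.mulVecLin_apply, Matrix.mulVec, dotProduct, Pi.zero_apply, M,
        Matrix.of_apply] at this
      rw [← this]
      refine Finset.sum_congr rfl fun je _ => ?_
      rw [mul_comm]
      congr 2
      ext s
      simp
    · push Not at hd
      obtain ⟨s, hs⟩ := hd
      refine Finset.sum_eq_zero fun je _ => ?_
      rw [MvPolynomial.coeff_eq_zero_of_totalDegree_lt, mul_zero]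
      refine (hG je).trans_lt (lt_of_lt_of_le hs ?_)
      by_cases h0 : d s = 0
      · omega
      · exact Finset.single_le_sum (f := fun s => d s) (fun _ _ => Nat.zero_le _)
          (Finsupp.mem_support_iff.2 h0)
  let c : ℕ → MvPolynomial σ ℚ := fun j => if hj : j < d₀ + 1 then
    ∑ e : σ → Fin d₀, MvPolynomial.monomial (Finsupp.equivFunOnFinite.symm fun s => (e s : ℕ))
      (u (⟨j, hj⟩, e)) else 0
  refine ⟨c, ?_, ?_, ?_, ?_⟩
  · obtain ⟨⟨j, e⟩, hje⟩ : ∃ je, u je ≠ 0 := by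
      by_contra! h
      exact hu0 (funext h)
    refine ⟨j, by have := j.2; omega, fun h => hje ?_⟩
    have h' := congrArg (MvPolynomial.coeff (Finsupp.equivFunOnFinite.symm fun s => (e s : ℕ))) h
    simp only [c, j.2, dif_pos, MvPolynomial.coeff_sum, MvPolynomial.coeff_monomial,
      MvPolynomial.coeff_zero] at h'
    rw [Finset.sum_eq_single e] at h'
    · simpa using h'
    · intro e' _ he'
      rw [if_neg]
      intro h2
      apply he'
      funext s
      have := congrFun (Finsupp.equivFunOnFinite.symm.injective h2) s
      exact Fin.ext this
    · simp
  · intro j hj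
    simp only [c]
    rw [dif_neg (by omega)]
  · intro j
    simp only [c]
    split_ifs with hj
    · refine MvPolynomial.totalDegree_finsetSum_le fun e _ => ?_
      refine (MvPolynomial.totalDegree_monomial_le _ _).trans ?_
      rw [Finsupp.sum_fintype _ _ (fun _ => rfl)]
      calc _ ≤ ∑ _s : σ, d₀ := Finset.sum_le_sum fun s _ => (e s).2.le
        _ = _ := by simp [hn]
    · simp
  · intro z hz
    have h1 := congrArg (MvPolynomial.eval z) hF
    simp only [map_sum, map_zero, _root_.map_mul, MvPolynomial.eval_C, G, map_prod, map_pow,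
      MvPolynomial.eval_X] at h1
    have hprod : ∏ s, MvPolynomial.eval z (Q s) ^ d₀ ≠ 0 :=
      Finset.prod_ne_zero_iff.2 fun s _ => pow_ne_zero _ (hz s)
    apply mul_left_cancel₀ hprod
    rw [mul_zero, ← h1, Fintype.sum_prod_type, Finset.sum_range, Finset.mul_sum]
    refine Finset.sum_congr rfl fun j _ => ?_
    simp only [c, j.2, dif_pos, map_sum, MvPolynomial.eval_monomial]
    rw [Finset.sum_mul, Finset.mul_sum]
    refine Finset.sum_congr rfl fun e _ => ?_
    rw [Finsupp.prod_fintype _ _ (fun _ => pow_zero _), ← mul_assoc, ← mul_assoc, mul_comm _ (u _),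
      mul_assoc (u _), ← Finset.prod_mul_distrib]
    rw [← mul_assoc]
    refine congrArg₂ _ (congrArg₂ _ rfl (Finset.prod_congr rfl fun s _ => ?_)) rfl
    have he : MvPolynomial.eval z (Q s) ^ d₀ =
        MvPolynomial.eval z (Q s) ^ (d₀ - e s) * MvPolynomial.eval z (Q s) ^ (e s : ℕ) := by
      rw [← pow_add]
      congr 1
      have := (e s).2
      omega
    have hq := pow_ne_zero (e s : ℕ) (hz s)
    rw [he, Finsupp.equivFunOnFinite_symm_apply_apply, div_pow]
    field_simp

/-- The number of positive letters of the reduced word of `f⁻¹ (x i)` is bounded by the degree of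
any algebraic relation between the entries of `f` and those of the tautological representation. -/
theorem length_filter_le_of_relation {N E D : ℕ} (f : MulAut (FreeGroupN N)) (i₀ : Fin N)
    (c : ℕ → MvPolynomial (Fin N × Fin 2 × Fin 2) ℚ) (hcE : ∃ j ≤ E, c j ≠ 0)
    (hc0 : ∀ j, E < j → c j = 0) (hD : ∀ j, (c j).totalDegree ≤ D)
    (h : ∀ m : Fin N → GL (Fin 2) ℚ, ∑ j ∈ Finset.range (E + 1),
      MvPolynomial.eval (fun s => (FreeGroup.lift m (f (of s.1)) : Matrix (Fin 2) (Fin 2) ℚ)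
        s.2.1 s.2.2) (c j) * (m i₀ : Matrix (Fin 2) (Fin 2) ℚ) 0 0 ^ j = 0) :
    ((f⁻¹ (of i₀)).toWord.filter fun p => p.2).length ≤ D := by
  classical
  by_contra! hlt
  set v := f⁻¹ (of i₀) with hv
  -- the relation evaluated along `f⁻¹`
  have h1 : ∀ m : Fin N → GL (Fin 2) ℚ, ∑ j ∈ Finset.range (E + 1),
      MvPolynomial.eval (fun s => (m s.1 : Matrix (Fin 2) (Fin 2) ℚ) s.2.1 s.2.2) (c j) *
        wordMat (fun i => (m i : Matrix (Fin 2) (Fin 2) ℚ)) v.toWord 0 0 ^ j *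
        negDet (fun i => (m i : Matrix (Fin 2) (Fin 2) ℚ)) v.toWord ^ (E - j) = 0 := by
    intro m
    have h2 := h fun i => FreeGroup.lift m (f⁻¹ (of i))
    have h3 : ∀ w, FreeGroup.lift (fun i => FreeGroup.lift m (f⁻¹ (of i))) w =
        FreeGroup.lift m (f⁻¹ w) := by
      intro w
      have : FreeGroup.lift (fun i => FreeGroup.lift m (f⁻¹ (of i))) =
          (FreeGroup.lift m).comp (f⁻¹ : MulAut (FreeGroupN N)).toMonoidHom := by
        ext i : 1
        simp
      rw [this]
      rfl
    simp only [h3, MulAut.inv_apply_self, lift_apply_of] at h2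
    rw [← hv] at h2
    have h4 := wordMat_eq m v.toWord
    rw [mk_toWord] at h4
    rw [h4]
    have := congrArg (fun x => x *
      negDet (fun i => (m i : Matrix (Fin 2) (Fin 2) ℚ)) v.toWord ^ E) h2
    simp only [zero_mul] at this
    rw [← this, Finset.sum_mul]
    refine Finset.sum_congr rfl fun j hj => ?_
    have hjE : E = j + (E - j) := by
      have := Finset.mem_range.1 hj
      omega
    conv_rhs => rw [hjE]
    rw [pow_add, Matrix.smul_apply, smul_eq_mul, mul_pow]
    ring
  -- the largest index of a nonzero coefficient
  obtain ⟨J, hJE, hJ0, hJm⟩ : ∃ J ≤ E, c J ≠ 0 ∧ ∀ j, J < j → c j = 0 := by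
    obtain ⟨j, hj, hcj⟩ := hcE
    refine ⟨Nat.findGreatest (fun j => c j ≠ 0) E, Nat.findGreatest_le _,
      Nat.findGreatest_spec (P := fun j => c j ≠ 0) hj hcj, fun k hk => ?_⟩
    by_cases hkE : k ≤ E
    · exact not_not.1 (Nat.findGreatest_is_greatest hk hkE)
    · exact hc0 k (by omega)
  -- a generic base point
  let gen : Fin N → Matrix (Fin 2) (Fin 2) (MvPolynomial (Fin N × Fin 2 × Fin 2) ℚ) :=
    fun i => Matrix.of fun a b => MvPolynomial.X (i, a, b)
  have hgen : ∀ (z : Fin N × Fin 2 × Fin 2 → ℚ) i, MvPolynomial.eval z (gen i).det =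
      (Matrix.of fun a b => z (i, a, b)).det := by
    intro z i
    simp [gen, Matrix.det_fin_two]
  have hdet : ∀ i, (gen i).det ≠ 0 := by
    intro i h0
    have := hgen (fun s => if s.2.1 = s.2.2 then 1 else 0) i
    rw [h0] at this
    simp [Matrix.det_fin_two] at this
  obtain ⟨z, hz⟩ : ∃ z, MvPolynomial.eval z (c J * ∏ i, (gen i).det) ≠ 0 := by
    by_contra! h0
    have : c J * ∏ i, (gen i).det = 0 := MvPolynomial.funext fun z => by rw [h0 z, map_zero]
    rcases mul_eq_zero.1 this with h' | h'
    · exact hJ0 h'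
    · obtain ⟨i, _, hi⟩ := Finset.prod_eq_zero_iff.1 h'
      exact hdet i hi
  rw [_root_.map_mul, map_prod] at hz
  let Z : Fin N → Matrix (Fin 2) (Fin 2) ℚ := fun i => Matrix.of fun a b => z (i, a, b)
  have hcz : MvPolynomial.eval z (c J) ≠ 0 := left_ne_zero_of_mul hz
  have hZ : ∀ i, (Z i).det ≠ 0 := by
    intro i
    have := Finset.prod_ne_zero_iff.1 (right_ne_zero_of_mul hz) i (Finset.mem_univ _)
    rwa [hgen] at this
  -- restriction to a line
  let C' : ℕ → Polynomial ℚ := fun j =>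
    MvPolynomial.aeval (fun s : Fin N × Fin 2 × Fin 2 => lineMat Z s.1 s.2.1 s.2.2) (c j)
  have hCeval : ∀ j t, (C' j).eval t =
      MvPolynomial.eval (fun s => (Z s.1 + t • rankOneMat s.1) s.2.1 s.2.2) (c j) := by
    intro j t
    simp only [C', MvPolynomial.aeval_def, MvPolynomial.eval₂_eq', Polynomial.eval_finsetSum,
      MvPolynomial.eval_eq', Polynomial.eval_mul, Polynomial.eval_prod, Polynomial.eval_pow]
    refine Finset.sum_congr rfl fun d _ => ?_
    congr 1
    · simp
    · refine Finset.prod_congr rfl fun s _ => ?_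
      rw [← eval_lineMat]
      rfl
  have hdeteval : ∀ i t, ((lineMat Z i).det).eval t = (Z i + t • rankOneMat i).det := by
    intro i t
    rw [← eval_lineMat, ← RingHom.map_det]
    rfl
  have hdet0 : ∀ i, (lineMat Z i).det ≠ 0 := by
    intro i h0
    have := hdeteval i 0
    rw [h0, zero_smul, add_zero, Polynomial.eval_zero] at this
    exact hZ i this.symm
  have hb0 : negDet (lineMat Z) v.toWord ≠ 0 := by
    rw [negDet]
    intro h0
    obtain ⟨p, _, hp⟩ := List.mem_map.1 (List.prod_eq_zero_iff.1 h0)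
    split_ifs at hp
    · exact one_ne_zero hp
    · exact hdet0 _ hp
  have hsum : (∑ j ∈ Finset.range (E + 1), C' j * wordMat (lineMat Z) v.toWord 0 0 ^ j *
      negDet (lineMat Z) v.toWord ^ (E - j)) * ∏ i, (lineMat Z i).det = 0 := by
    apply Polynomial.funext
    intro t
    rw [Polynomial.eval_zero, Polynomial.eval_mul, Polynomial.eval_prod]
    by_cases ht : ∏ i, ((lineMat Z i).det).eval t = 0
    · rw [ht, mul_zero]
    · have hu : ∀ i, (Z i + t • rankOneMat i).det ≠ 0 := by
        intro i
        rw [← hdeteval]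
        exact Finset.prod_ne_zero_iff.1 ht i (Finset.mem_univ _)
      have h5 := h1 fun i => Matrix.GeneralLinearGroup.mkOfDetNeZero _ (hu i)
      have hco : ∀ i, ((Matrix.GeneralLinearGroup.mkOfDetNeZero _ (hu i) : GL (Fin 2) ℚ) :
        Matrix (Fin 2) (Fin 2) ℚ) = Z i + t • rankOneMat i := fun i => rfl
      simp only [hco] at h5
      rw [Polynomial.eval_finsetSum]
      simp only [Polynomial.eval_mul, Polynomial.eval_pow, hCeval]
      have h6 : (wordMat (lineMat Z) v.toWord 0 0).eval t =
          wordMat (fun i => Z i + t • rankOneMat i) v.toWord 0 0 := by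
        have := wordMat_map (Polynomial.evalRingHom t) (lineMat Z) v.toWord
        simp only [eval_lineMat] at this
        rw [← this]
        rfl
      have h7 : (negDet (lineMat Z) v.toWord).eval t =
          negDet (fun i => Z i + t • rankOneMat i) v.toWord := by
        have := negDet_map (Polynomial.evalRingHom t) (lineMat Z) v.toWord
        simp only [eval_lineMat] at this
        rw [← this]
        rfl
      rw [h6, h7, h5, zero_mul]
  have hsum0 := (mul_eq_zero.1 hsum).resolve_right
    (Finset.prod_ne_zero_iff.2 fun i _ => hdet0 i)
  have hw := natDegree_wordMat_lineMat Z v.toWord 0 0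
  have hwne := wordMat_rankOneMat_ne_zero (isReduced_toWord (x := v))
  rw [← hw.2] at hwne
  have hwdeg : (wordMat (lineMat Z) v.toWord 0 0).natDegree = v.toWord.length :=
    le_antisymm hw.1 (Polynomial.le_natDegree_of_ne_zero hwne)
  have hbdeg := natDegree_negDet_lineMat_le Z v.toWord
  refine sum_mul_pow_mul_pow_ne_zero (D := D) hJE ?_ ?_ ?_ hb0 ?_ ?_ hsum0
  · intro h0
    have := hCeval J 0
    rw [h0, Polynomial.eval_zero] at this
    apply hcz
    rw [this]
    congr 2
    funext s
    simp [Z]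
  · intro j hj
    simp [C', hJm j hj]
  · intro j
    refine (MvPolynomial.aeval_natDegree_le _ (hD j) _ (n := 1) ?_).trans (by simp)
    intro s
    exact natDegree_lineMat_le _ _ _ _
  · intro h0
    rw [h0] at hwne
    simp at hwne
  · omega

/-- The matrices of indeterminates. -/
noncomputable def genMat {N : ℕ} (i : Fin N) :
    Matrix (Fin 2) (Fin 2) (MvPolynomial (Fin N × Fin 2 × Fin 2) ℚ) :=
  Matrix.of fun a b => MvPolynomial.X (i, a, b)

theorem eval_genMat {N : ℕ} (z : Fin N × Fin 2 × Fin 2 → ℚ) (i : Fin N) :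
    (MvPolynomial.eval z).mapMatrix (genMat i) = Matrix.of fun a b => z (i, a, b) := by
  ext a b
  simp [genMat]

theorem totalDegree_letterMat_genMat_le {N : ℕ} (p : Fin N × Bool) (a b : Fin 2) :
    (letterMat genMat p a b).totalDegree ≤ 1 := by
  rcases p with ⟨i, c⟩
  cases c
  · fin_cases a <;> fin_cases b <;>
      simp [letterMat, Matrix.adjugate_fin_two, genMat]
  · simp [letterMat, genMat]

theorem totalDegree_wordMat_genMat_le {N : ℕ} (L : List (Fin N × Bool)) (a b : Fin 2) :
    (wordMat genMat L a b).totalDegree ≤ L.length := by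
  induction L generalizing a with
  | nil => fin_cases a <;> fin_cases b <;> simp [wordMat]
  | cons p L ih =>
    have h1 : wordMat genMat (p :: L) a b = letterMat genMat p a 0 * wordMat genMat L 0 b +
          letterMat genMat p a 1 * wordMat genMat L 1 b := by
      simp [wordMat, Matrix.mul_apply, Fin.sum_univ_two]
    have h2 : ∀ c, (letterMat genMat p a c * wordMat genMat L c b).totalDegree ≤ L.length + 1 := by
      intro c
      refine (MvPolynomial.totalDegree_mul _ _).trans ?_
      have := totalDegree_letterMat_genMat_le p a c
      have := ih c
      omega
    rw [h1, List.length_cons]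
    exact (MvPolynomial.totalDegree_add _ _).trans (max_le (h2 0) (h2 1))

theorem totalDegree_negDet_genMat_le {N : ℕ} (L : List (Fin N × Bool)) :
    (negDet genMat L).totalDegree ≤ 2 * L.length := by
  induction L with
  | nil => simp [negDet]
  | cons p L ih =>
    have h1 : negDet genMat (p :: L) =
        (if p.2 then 1 else (genMat p.1).det) * negDet genMat L := by
      simp [negDet]
    have h2 : (if p.2 then 1 else (genMat p.1).det :
        MvPolynomial (Fin N × Fin 2 × Fin 2) ℚ).totalDegree ≤ 2 := by
      split_ifs
      · simp
      · rw [Matrix.det_fin_two]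
        refine (MvPolynomial.totalDegree_sub _ _).trans (max_le ?_ ?_) <;>
          exact (MvPolynomial.totalDegree_mul _ _).trans (by simp [genMat])
    rw [h1, List.length_cons]
    refine (MvPolynomial.totalDegree_mul _ _).trans ?_
    omega

theorem length_filter_inv_apply_le {N L : ℕ} (f : MulAut (FreeGroupN N))
    (h : ∀ i, (f (of i)).norm ≤ L) (i : Fin N) :
    ((f⁻¹ (of i)).toWord.filter fun p => p.2).length ≤
      4 * N * (4 * N * (2 * L) + 2) ^ (4 * N) := by
  have hcard : Fintype.card (Fin N × Fin 2 × Fin 2) = 4 * N := by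
    simp
    omega
  obtain ⟨c, h1, h2, h3, h4⟩ := exists_relation
    (fun s : Fin N × Fin 2 × Fin 2 => wordMat genMat (f (of s.1)).toWord s.2.1 s.2.2)
    (fun s => negDet genMat (f (of s.1)).toWord) (i, 0, 0) (B := 2 * L)
    (fun s => (totalDegree_wordMat_genMat_le _ _ _).trans
      ((h s.1).trans (Nat.le_mul_of_pos_left _ two_pos)))
    (fun s => (totalDegree_negDet_genMat_le _).trans (Nat.mul_le_mul_left _ (h s.1))) rfl
  rw [hcard] at h3
  simp only [hcard] at h1 h2 h3 h4
  refine length_filter_le_of_relation f i c h1 h2 h3 fun m => ?_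
  have hev : ∀ j, (MvPolynomial.eval fun s : Fin N × Fin 2 × Fin 2 =>
      (m s.1 : Matrix (Fin 2) (Fin 2) ℚ) s.2.1 s.2.2).mapMatrix (genMat j) =
        (m j : Matrix (Fin 2) (Fin 2) ℚ) := fun j => eval_genMat _ _
  have hneg : ∀ w, negDet (fun i => (m i : Matrix (Fin 2) (Fin 2) ℚ)) w ≠ 0 := by
    intro w h0
    obtain ⟨p, _, hp⟩ := List.mem_map.1 (List.prod_eq_zero_iff.1 h0)
    split_ifs at hp
    · exact one_ne_zero hp
    · exact ((Matrix.isUnit_iff_isUnit_det _).1 (m p.1).isUnit).ne_zero hp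
  have hQ : ∀ w, MvPolynomial.eval (fun s : Fin N × Fin 2 × Fin 2 =>
      (m s.1 : Matrix (Fin 2) (Fin 2) ℚ) s.2.1 s.2.2) (negDet genMat w) =
        negDet (fun i => (m i : Matrix (Fin 2) (Fin 2) ℚ)) w := by
    intro w
    rw [negDet_map]
    simp only [hev]
  have hP : ∀ w a b, MvPolynomial.eval (fun s : Fin N × Fin 2 × Fin 2 =>
      (m s.1 : Matrix (Fin 2) (Fin 2) ℚ) s.2.1 s.2.2) (wordMat genMat w a b) =
        wordMat (fun i => (m i : Matrix (Fin 2) (Fin 2) ℚ)) w a b := by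
    intro w a b
    have := wordMat_map (MvPolynomial.eval (fun s : Fin N × Fin 2 × Fin 2 =>
      (m s.1 : Matrix (Fin 2) (Fin 2) ℚ) s.2.1 s.2.2)) genMat w
    simp only [hev] at this
    rw [← this]
    rfl
  have h5 := h4 (fun s => (m s.1 : Matrix (Fin 2) (Fin 2) ℚ) s.2.1 s.2.2)
    (fun s => by rw [hQ]; exact hneg _)
  simp only [hQ, hP] at h5
  rw [← h5]
  refine Finset.sum_congr rfl fun j _ => ?_
  congr 3
  funext s
  rw [eq_div_iff (hneg _), wordMat_eq, mk_toWord, Matrix.smul_apply, smul_eq_mul, mul_comm]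

theorem norm_apply_le {N K : ℕ} (f : FreeGroupN N →* FreeGroupN N)
    (h : ∀ i, (f (of i)).norm ≤ K) (w : FreeGroupN N) : (f w).norm ≤ K * w.norm := by
  have key : ∀ L : List (Fin N × Bool), (f (mk L)).norm ≤ K * L.length := by
    intro L
    induction L with
    | nil => simp [← one_eq_mk]
    | cons p L ih =>
      have hp : (f (mk [p])).norm ≤ K := by
        rcases p with ⟨i, b⟩
        cases b
        · have : mk [(i, false)] = (of i)⁻¹ := by simp [of, inv_mk, invRev]
          rw [this, _root_.map_inv, norm_inv_eq]
          exact h i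
        · exact h i
      rw [show p :: L = [p] ++ L from rfl, ← mul_mk, MonoidHom.map_mul]
      refine (norm_mul_le _ _).trans ?_
      simp only [List.length_append, List.length_singleton]
      nlinarith
  have := key w.toWord
  rwa [mk_toWord] at this

/-- The automorphism inverting the generators. -/
def invGens (N : ℕ) : MulAut (FreeGroupN N) :=
  MonoidHom.toMulEquiv (FreeGroup.lift fun i => (of i)⁻¹) (FreeGroup.lift fun i => (of i)⁻¹)
    (by ext i; simp) (by ext i; simp)

theorem invGens_of {N : ℕ} (i : Fin N) : invGens N (of i) = (of i)⁻¹ := by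
  simp [invGens]

theorem length_filter_toWord_inv {N : ℕ} (w : FreeGroupN N) :
    (w⁻¹.toWord.filter fun p => p.2).length = (w.toWord.filter fun p => !p.2).length := by
  rw [toWord_inv, invRev, List.filter_reverse, List.length_reverse, List.filter_map,
    List.length_map]
  rfl

/-- The norms of an inverse automorphism are polynomially bounded in those of the automorphism. -/
theorem norm_inv_apply_of_le {N L : ℕ} (f : MulAut (FreeGroupN N))
    (h : ∀ i, (f (of i)).norm ≤ L) (i : Fin N) :
    (f⁻¹ (of i)).norm ≤ 8 * N * (8 * N * L + 2) ^ (4 * N) := by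
  have h1 := length_filter_inv_apply_le f h i
  have h2 := length_filter_inv_apply_le (f := invGens N * f) (L := L) (fun i => by
    have h3 : (invGens N (f (of i))).norm ≤ 1 * (f (of i)).norm :=
      norm_apply_le (invGens N).toMonoidHom (fun j => by
        change (invGens N (of j)).norm ≤ 1
        rw [invGens_of]; simp) _
    have : (invGens N * f) (of i) = invGens N (f (of i)) := rfl
    rw [this]
    have := h i
    omega) i
  have h4 : (invGens N * f)⁻¹ (of i) = (f⁻¹ (of i))⁻¹ := by
    rw [mul_inv_rev, MulAut.mul_apply]
    have : (invGens N)⁻¹ (of i) = (of i)⁻¹ := by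
      apply (invGens N).injective
      rw [MulAut.apply_inv_self, _root_.map_inv, invGens_of, inv_inv]
    rw [this, _root_.map_inv]
  rw [h4, length_filter_toWord_inv] at h2
  have h5 : (f⁻¹ (of i)).norm = ((f⁻¹ (of i)).toWord.filter fun p => p.2).length +
      ((f⁻¹ (of i)).toWord.filter fun p => !p.2).length :=
    List.length_eq_length_filter_add _
  have e : 4 * N * (2 * L) = 8 * N * L := by ring
  rw [e] at h1 h2
  rw [h5]
  linarith

/-- The subgroup generated by a subset of the basis is a free factor. -/
theorem isFreeFactor_closure {ι : Type*} (s : Set ι) :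
    IsFreeFactor (Subgroup.closure (of '' s)) := by
  classical
  refine ⟨Subgroup.closure (of '' sᶜ), ?_⟩
  set A := Subgroup.closure (of '' s)
  set B := Subgroup.closure (of '' sᶜ)
  let ψ : FreeGroup ι →* Monoid.Coprod A B := FreeGroup.lift fun i =>
    if h : i ∈ s then Monoid.Coprod.inl ⟨of i, Subgroup.subset_closure ⟨i, h, rfl⟩⟩
    else Monoid.Coprod.inr ⟨of i, Subgroup.subset_closure ⟨i, h, rfl⟩⟩
  have h1 : (Monoid.Coprod.lift A.subtype B.subtype).comp ψ = MonoidHom.id _ := by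
    ext i
    simp only [MonoidHom.comp_apply, ψ, lift_apply_of, MonoidHom.id_apply]
    split_ifs <;> simp
  have hA : ∀ a (ha : a ∈ A), ψ a = Monoid.Coprod.inl ⟨a, ha⟩ := by
    intro a ha
    induction ha using Subgroup.closure_induction with
    | mem x hx =>
      obtain ⟨i, hi, rfl⟩ := hx
      simp [ψ, hi]
    | one => exact (ψ.map_one).trans (Monoid.Coprod.inl.map_one).symm
    | mul x y hx hy h h' =>
      rw [ψ.map_mul, h, h', ← MonoidHom.map_mul]
      rfl
    | inv x hx h =>
      rw [ψ.map_inv, h, ← MonoidHom.map_inv]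
      rfl
  have hB : ∀ a (ha : a ∈ B), ψ a = Monoid.Coprod.inr ⟨a, ha⟩ := by
    intro a ha
    induction ha using Subgroup.closure_induction with
    | mem x hx =>
      obtain ⟨i, hi, rfl⟩ := hx
      simp only [ψ, lift_apply_of]
      rw [dif_neg hi]
    | one => exact (ψ.map_one).trans (Monoid.Coprod.inr.map_one).symm
    | mul x y hx hy h h' =>
      rw [ψ.map_mul, h, h', ← MonoidHom.map_mul]
      rfl
    | inv x hx h =>
      rw [ψ.map_inv, h, ← MonoidHom.map_inv]
      rfl
  have h2 : ψ.comp (Monoid.Coprod.lift A.subtype B.subtype) = MonoidHom.id _ := by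
    apply Monoid.Coprod.hom_ext
    · ext ⟨a, ha⟩
      simpa using hA a ha
    · ext ⟨a, ha⟩
      simpa using hB a ha
  exact Function.bijective_iff_has_inverse.2 ⟨ψ, DFunLike.congr_fun h2, DFunLike.congr_fun h1⟩

theorem map_pow_mk {G : Type*} [Group G] (f : MulAut G) (n : ℕ) (g : G) :
    ConjClasses.map ((f ^ n : MulAut G) : G →* G) (ConjClasses.mk g) =
      ConjClasses.mk ((f ^ n) g) := rfl

theorem map_pow_eq_iterate {G : Type*} [Group G] (f : MulAut G) (n : ℕ) (α : ConjClasses G) :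
    ConjClasses.map ((f ^ n : MulAut G) : G →* G) α = (ConjClasses.map (f : G →* G))^[n] α := by
  induction n with
  | zero =>
    obtain ⟨g, rfl⟩ := ConjClasses.mk_surjective α
    rfl
  | succ n ih =>
    rw [Function.iterate_succ_apply', ← ih]
    obtain ⟨g, rfl⟩ := ConjClasses.mk_surjective α
    rw [map_pow_mk, map_pow_mk, pow_succ']
    rfl

theorem IsPeriodicClass.of_inv {N : ℕ} {f : MulAut (FreeGroupN N)} {α : ConjClasses (FreeGroupN N)}
    (h : IsPeriodicClass f⁻¹ α) : IsPeriodicClass f α := by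
  obtain ⟨k, hk, h⟩ := h
  refine ⟨k, hk, ?_⟩
  conv_lhs => rw [← h]
  obtain ⟨g, rfl⟩ := ConjClasses.mk_surjective α
  rw [map_pow_mk, map_pow_mk]
  congr 1
  rw [← MulAut.mul_apply, inv_pow, mul_inv_cancel, MulAut.one_apply]

/-- Basis elements are not periodic under a fully irreducible automorphism. -/
theorem not_isPeriodicClass_of {N : ℕ} (hN : 2 ≤ N) {φ : Out (FreeGroupN N)}
    (hφ : FullyIrreducible φ) {f : MulAut (FreeGroupN N)}
    (hf : (QuotientGroup.mk f : Out (FreeGroupN N)) = φ) (i : Fin N) :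
    ¬ IsPeriodicClass f (ConjClasses.mk (of i)) := by
  rintro ⟨k, hk, h⟩
  rw [map_pow_mk] at h
  obtain ⟨g, hg⟩ := isConj_iff.1 (ConjClasses.mk_eq_mk_iff_isConj.1 h).symm
  have h1 : (QuotientGroup.mk (f ^ k) : Out (FreeGroupN N)) = φ ^ k := by
    rw [← hf]
    rfl
  refine hφ k hk (f ^ k) h1 (Subgroup.closure (of '' {i})) (isFreeFactor_closure _) ?_ ?_ g ?_
  · intro h2
    have : of i ∈ Subgroup.closure (of '' {i}) := Subgroup.subset_closure ⟨i, rfl, rfl⟩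
    rw [h2, Subgroup.mem_bot] at this
    exact of_ne_one i this
  · intro h2
    have : Nontrivial (Fin N) := Fin.nontrivial_iff_two_le.2 hN
    obtain ⟨j, hj⟩ := exists_ne i
    let χ : FreeGroupN N →* Multiplicative ℤ :=
      FreeGroup.lift fun m => if m = i then 1 else Multiplicative.ofAdd 1
    have h3 : Subgroup.closure (of '' {i}) ≤ χ.ker := by
      rw [Subgroup.closure_le]
      rintro _ ⟨m, rfl, rfl⟩
      simp [χ, MonoidHom.mem_ker]
    rw [h2] at h3
    have h4 := h3 (Subgroup.mem_top (of j))
    simp [χ, MonoidHom.mem_ker, hj] at h4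
  · rw [MonoidHom.map_closure, MonoidHom.map_closure, Set.image_singleton, Set.image_singleton,
      Set.image_singleton]
    congr 2
    exact hg.symm

theorem stdCycLength_pos {N : ℕ} {g : FreeGroupN N} (hg : g ≠ 1) :
    1 ≤ stdCycLength (ConjClasses.mk g) := by
  obtain ⟨w, hw, hn⟩ := exists_cycLength_eq (MulEquiv.refl (FreeGroupN N)) (ConjClasses.mk g)
  rw [stdCycLength, ← hn, Nat.one_le_iff_ne_zero]
  intro h0
  have h1 : w = 1 := norm_eq_zero.1 h0
  rw [h1, ConjClasses.mk_eq_mk_iff_isConj] at hw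
  exact hg ((isConj_one_right).1 hw)

/-- Above the stretch factor, lengths are eventually dominated by the exponential. -/
theorem eventually_stdCycLength_le {N : ℕ} {f : MulAut (FreeGroupN N)} {l r : ℝ}
    (hf : HasStretchFactor (QuotientGroup.mk f : Out (FreeGroupN N)) l) (hl : 1 ≤ l) (hr : l < r)
    (α : ConjClasses (FreeGroupN N)) :
    ∀ᶠ n : ℕ in Filter.atTop,
      (stdCycLength (ConjClasses.map ((f ^ n : MulAut (FreeGroupN N)) : FreeGroupN N →* FreeGroupN N) α) : ℝ)
        ≤ r ^ n := by
  by_cases hα : IsPeriodicClass f α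
  · obtain ⟨k, hk, h⟩ := hα
    rw [map_pow_eq_iterate] at h
    have h1 : ∀ n, (ConjClasses.map (f : FreeGroupN N →* FreeGroupN N))^[n % k] α =
        (ConjClasses.map (f : FreeGroupN N →* FreeGroupN N))^[n] α := fun n =>
      Function.IsPeriodicPt.iterate_mod_apply h n
    have h2 : ∃ B : ℕ, ∀ n, stdCycLength
        ((ConjClasses.map (f : FreeGroupN N →* FreeGroupN N))^[n] α) ≤ B := by
      refine ⟨(Finset.range k).sup fun n => stdCycLength
        ((ConjClasses.map (f : FreeGroupN N →* FreeGroupN N))^[n] α), fun n => ?_⟩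
      rw [← h1]
      exact Finset.le_sup (f := fun n => stdCycLength
        ((ConjClasses.map (f : FreeGroupN N →* FreeGroupN N))^[n] α))
        (Finset.mem_range.2 (Nat.mod_lt _ hk))
    obtain ⟨B, hB⟩ := h2
    have h3 := (tendsto_pow_atTop_atTop_of_one_lt (hl.trans_lt hr)).eventually_ge_atTop (B : ℝ)
    filter_upwards [h3] with n hn
    rw [map_pow_eq_iterate]
    exact le_trans (by exact_mod_cast hB n) hn
  · have h1 := hf f rfl (MulEquiv.refl _) α hα
    filter_upwards [h1.eventually_lt_const hr, Filter.eventually_ge_atTop 1] with n hn hn1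
    have hn0 : (n : ℝ) ≠ 0 := by
      have : n ≠ 0 := by omega
      exact_mod_cast this
    have h0 : (0 : ℝ) ≤ (stdCycLength (ConjClasses.map
      ((f ^ n : MulAut (FreeGroupN N)) : FreeGroupN N →* FreeGroupN N) α) : ℝ) := Nat.cast_nonneg _
    have h2 := pow_le_pow_left₀ (Real.rpow_nonneg h0 _) hn.le n
    rwa [← Real.rpow_natCast, ← Real.rpow_mul h0, one_div, inv_mul_cancel₀ hn0,
      Real.rpow_one] at h2

theorem one_le_of_hasStretchFactor {N : ℕ} {f : MulAut (FreeGroupN N)} {l : ℝ}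
    (hf : HasStretchFactor (QuotientGroup.mk f : Out (FreeGroupN N)) l) {g : FreeGroupN N}
    (hg : g ≠ 1) (hp : ¬ IsPeriodicClass f (ConjClasses.mk g)) : 1 ≤ l := by
  refine ge_of_tendsto (hf f rfl (MulEquiv.refl _) _ hp) (Filter.Eventually.of_forall fun n => ?_)
  apply Real.one_le_rpow
  · have : 1 ≤ stdCycLength (ConjClasses.mk ((f ^ n) g)) :=
      stdCycLength_pos fun h => hg ((f ^ n).injective (h.trans (_root_.map_one _).symm))
    exact_mod_cast this
  · positivity

/-- A stretch factor is polynomially bounded in the stretch factor of the inverse. -/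
theorem stretchFactor_le_pow {N : ℕ} (i₀ : Fin N) {f : MulAut (FreeGroupN N)} {l li r : ℝ}
    (hf : HasStretchFactor (QuotientGroup.mk f : Out (FreeGroupN N)) l)
    (hfi : HasStretchFactor (QuotientGroup.mk f⁻¹ : Out (FreeGroupN N)) li)
    (hp : ¬ IsPeriodicClass f (ConjClasses.mk (of i₀))) (hli : 1 ≤ li) (hr : li < r) :
    l ≤ r ^ (4 * N) := by
  have h1 : ∀ᶠ n : ℕ in Filter.atTop, ∀ i, (stdCycLength (ConjClasses.map
      ((f⁻¹ ^ n : MulAut (FreeGroupN N)) : FreeGroupN N →* FreeGroupN N) (ConjClasses.mk (of i))) : ℝ)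
        ≤ r ^ n := Filter.eventually_all.2 fun i => eventually_stdCycLength_le hfi hli hr _
  have h2 : ∀ᶠ n : ℕ in Filter.atTop, ∀ i j, (stdCycLength (ConjClasses.map
      ((f⁻¹ ^ n : MulAut (FreeGroupN N)) : FreeGroupN N →* FreeGroupN N)
        (ConjClasses.mk (of i * of j))) : ℝ) ≤ r ^ n :=
    Filter.eventually_all.2 fun i => Filter.eventually_all.2 fun j =>
      eventually_stdCycLength_le hfi hli hr _
  have hr1 : 1 < r := hli.trans_lt hr
  have hN1 : (1 : ℝ) ≤ N := by
    have := i₀.2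
    exact_mod_cast (by omega : 1 ≤ N)
  set K : ℝ := 8 * N * (26 * N) ^ (4 * N) with hK
  have hK1 : 0 < K := by positivity
  have h3 : ∀ᶠ n : ℕ in Filter.atTop, ((stdCycLength (ConjClasses.map
      ((f ^ n : MulAut (FreeGroupN N)) : FreeGroupN N →* FreeGroupN N) (ConjClasses.mk (of i₀))) : ℝ) ^
        (1 / (n : ℝ))) ≤ K ^ (1 / (n : ℝ)) * r ^ (4 * N) := by
    filter_upwards [h1, h2, Filter.eventually_ge_atTop 1] with n ha hb hn
    have hrn : 1 ≤ r ^ n := one_le_pow₀ hr1.le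
    obtain ⟨c, hc⟩ := exists_conj_norm_le (fun i => (f⁻¹ ^ n) (of i)) ⌊r ^ n⌋₊
      (fun i => Nat.le_floor (ha i)) (fun i j => by
        have := Nat.le_floor (hb i j)
        rwa [map_pow_mk, _root_.map_mul] at this)
    have h4 := norm_inv_apply_of_le (MulAut.conj c * f⁻¹ ^ n) (L := ⌊r ^ n⌋₊ + 2) hc i₀
    have h5 : (MulAut.conj c * f⁻¹ ^ n)⁻¹ (of i₀) = (f ^ n) (c⁻¹ * of i₀ * c) := by
      rw [mul_inv_rev, inv_pow, inv_inv, MulAut.mul_apply, ← _root_.map_inv, MulAut.conj_apply, inv_inv]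
    have h6 : ConjClasses.mk ((f ^ n) (c⁻¹ * of i₀ * c)) = ConjClasses.mk ((f ^ n) (of i₀)) := by
      rw [ConjClasses.mk_eq_mk_iff_isConj, isConj_iff]
      refine ⟨(f ^ n) c, ?_⟩
      simp only [← _root_.map_mul, ← _root_.map_inv]
      congr 1
      group
    have h7 : stdCycLength (ConjClasses.mk ((f ^ n) (of i₀))) ≤
        8 * N * (8 * N * (⌊r ^ n⌋₊ + 2) + 2) ^ (4 * N) := by
      rw [← h6, ← h5]
      exact (cycLength_le (MulEquiv.refl _) _).trans h4
    have h8 : (stdCycLength (ConjClasses.mk ((f ^ n) (of i₀))) : ℝ) ≤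
        K * (r ^ n) ^ (4 * N) := by
      calc (stdCycLength (ConjClasses.mk ((f ^ n) (of i₀))) : ℝ)
          ≤ 8 * N * (8 * N * ((⌊r ^ n⌋₊ : ℝ) + 2) + 2) ^ (4 * N) := by exact_mod_cast h7
        _ ≤ 8 * N * (26 * N * r ^ n) ^ (4 * N) := by
          have := Nat.floor_le (a := r ^ n) (by linarith)
          gcongr
          nlinarith
        _ = K * (r ^ n) ^ (4 * N) := by
          rw [hK, mul_pow]
          ring
    have hn0 : (n : ℝ) ≠ 0 := by
      have : n ≠ 0 := by omega
      exact_mod_cast this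
    calc _ ≤ (K * (r ^ n) ^ (4 * N)) ^ (1 / (n : ℝ)) := by
          rw [map_pow_mk]
          exact Real.rpow_le_rpow (Nat.cast_nonneg _) h8 (by positivity)
      _ = K ^ (1 / (n : ℝ)) * r ^ (4 * N) := by
          rw [Real.mul_rpow hK1.le (by positivity), ← pow_mul, mul_comm n, pow_mul, one_div,
            Real.pow_rpow_inv_natCast (by positivity) (by omega)]
  have h4 : Filter.Tendsto (fun n : ℕ => K ^ (1 / (n : ℝ)) * r ^ (4 * N)) Filter.atTop
      (nhds (K ^ (0 : ℝ) * r ^ (4 * N))) := by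
    refine Filter.Tendsto.mul_const _ ?_
    exact (Real.continuousAt_const_rpow hK1.ne').tendsto.comp tendsto_one_div_atTop_nhds_zero_nat
  rw [Real.rpow_zero, one_mul] at h4
  exact le_of_tendsto_of_tendsto (hf f rfl (MulEquiv.refl _) _ hp) h4 h3

theorem bddAbove_stretchRatioSet {N : ℕ} (hN : 2 ≤ N) : BddAbove (stretchRatioSet N) := by
  refine ⟨4 * N, ?_⟩
  rintro _ ⟨φ, hφ, l, li, hl, hli, rfl⟩
  obtain ⟨f, rfl⟩ : ∃ f : MulAut (FreeGroupN N), (QuotientGroup.mk f : Out (FreeGroupN N)) = φ :=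
    QuotientGroup.mk_surjective φ
  let i₀ : Fin N := ⟨0, by omega⟩
  have hp := not_isPeriodicClass_of hN hφ rfl i₀
  have hli' : HasStretchFactor (QuotientGroup.mk f⁻¹ : Out (FreeGroupN N)) li := hli
  have h1 : 1 ≤ l := one_le_of_hasStretchFactor hl (of_ne_one i₀) hp
  have h2 : 1 ≤ li :=
    one_le_of_hasStretchFactor hli' (of_ne_one i₀) fun h => hp (IsPeriodicClass.of_inv h)
  have h3 : l ≤ li ^ (4 * N) := by
    have h4 : Filter.Tendsto (fun r : ℝ => r ^ (4 * N)) (nhdsWithin li (Set.Ioi li))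
        (nhds (li ^ (4 * N))) := ((continuous_pow (4 * N)).tendsto li).mono_left nhdsWithin_le_nhds
    refine ge_of_tendsto h4 ?_
    filter_upwards [self_mem_nhdsWithin] with r hr
    exact stretchFactor_le_pow i₀ hl hli' hp h2 hr
  have h5 : Real.log l ≤ 4 * N * Real.log li := by
    have := Real.log_le_log (by linarith) h3
    rw [Real.log_pow] at this
    exact_mod_cast this
  rcases (Real.log_nonneg h2).eq_or_lt with h6 | h6
  · rw [← h6, div_zero]
    positivity
  · rwa [div_le_iff₀ h6]

theorem exists_norm_le {N : ℕ} (f : FreeGroupN N →* FreeGroupN N) :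
    ∃ K, ∀ i, (f (of i)).norm ≤ K :=
  ⟨Finset.univ.sup fun i => (f (of i)).norm, fun i =>
    Finset.le_sup (f := fun i => (f (of i)).norm) (Finset.mem_univ i)⟩

/-- Prefixes of the image of a word are close to images of prefixes. -/
theorem exists_prefix_norm_le {N K : ℕ} (f : FreeGroupN N →* FreeGroupN N)
    (h : ∀ i, (f (of i)).norm ≤ K) (L : List (Fin N × Bool)) :
    ∀ x y, (f (mk L)).toWord = x ++ y →
      ∃ L₁ L₂, L = L₁ ++ L₂ ∧ ((mk x)⁻¹ * f (mk L₁)).norm ≤ K := by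
  induction L using List.reverseRecOn with
  | nil =>
    intro x y hxy
    refine ⟨[], [], rfl, ?_⟩
    rw [← one_eq_mk, MonoidHom.map_one, toWord_one] at hxy
    obtain ⟨rfl, rfl⟩ := List.append_eq_nil_iff.1 hxy.symm
    simp [← one_eq_mk]
  | append_singleton L l ih =>
    intro x y hxy
    obtain ⟨p, c, q, h1, h2, h3⟩ := exists_toWord_mul (f (mk L)) (f (mk [l]))
    rw [← mul_mk, MonoidHom.map_mul, h3] at hxy
    rcases List.append_eq_append_iff.1 hxy with ⟨t, rfl, rfl⟩ | ⟨t, rfl, rfl⟩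
    · refine ⟨L ++ [l], [], by simp, ?_⟩
      have h4 : f (mk (L ++ [l])) = mk p * mk t * mk y := by
        rw [← mul_mk, MonoidHom.map_mul, ← mk_toWord (x := f (mk L) * f (mk [l])), h3, mul_mk,
          mul_mk, List.append_assoc]
      rw [h4, ← mul_mk, inv_mul_cancel_left]
      have h5 := norm_apply_le f h (mk [l])
      have h6 : (mk [l]).norm ≤ 1 := norm_mk_le
      have h7 : (mk y).norm ≤ y.length := norm_mk_le
      have h8 : (f (mk [l])).norm = (invRev c).length + (t.length + y.length) := by
        rw [norm, h2, List.length_append, List.length_append]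
      have := Nat.mul_le_mul_left K h6
      omega
    · obtain ⟨L₁, L₂, rfl, h4⟩ := ih x (t ++ c) (by rw [h1, List.append_assoc])
      exact ⟨L₁, L₂ ++ [l], by simp, h4⟩

/-- Bounded cancellation. -/
theorem exists_cancel_bound {N : ℕ} (f : MulAut (FreeGroupN N)) :
    ∃ B : ℕ, ∀ a b : FreeGroupN N, IsReduced (a.toWord ++ b.toWord) → ∀ p c q,
      (f a).toWord = p ++ c → (f b).toWord = invRev c ++ q → c.length ≤ B := by
  obtain ⟨K, hK⟩ := exists_norm_le (f : FreeGroupN N →* FreeGroupN N)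
  obtain ⟨K', hK'⟩ := exists_norm_le ((f⁻¹ : MulAut (FreeGroupN N)) : FreeGroupN N →* FreeGroupN N)
  refine ⟨K + K * (K' * (2 * K)), fun a b hab p c q ha hb => ?_⟩
  obtain ⟨L₁, L₂, hL, h1⟩ := exists_prefix_norm_le (f : FreeGroupN N →* FreeGroupN N) hK a.toWord
    p c (by rw [mk_toWord]; exact ha)
  obtain ⟨M₁, M₂, hM, h2⟩ := exists_prefix_norm_le (f : FreeGroupN N →* FreeGroupN N) hK b.toWord
    (invRev c) q (by rw [mk_toWord]; exact hb)
  rw [inv_mk, invRev_invRev] at h2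
  have hred : IsReduced (L₂ ++ M₁) := hab.of_isInfix ⟨L₁, M₂, by rw [hL, hM]; simp⟩
  have h3 : f (mk (L₂ ++ M₁)) = ((mk p)⁻¹ * f (mk L₁))⁻¹ * (mk c * f (mk M₁)) := by
    have h4 : f (mk L₁) * f (mk L₂) = mk p * mk c := by
      rw [← _root_.map_mul, mul_mk, ← hL, mk_toWord, mul_mk, ← ha, mk_toWord]
    rw [← mul_mk, _root_.map_mul, mul_inv_rev, inv_inv, mul_assoc, ← mul_assoc (mk p), ← h4]
    group
  have h4 : (f (mk (L₂ ++ M₁))).norm ≤ 2 * K := by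
    rw [h3]
    refine (norm_mul_le _ _).trans ?_
    rw [norm_inv_eq, two_mul]
    exact Nat.add_le_add h1 h2
  have h5 : (mk (L₂ ++ M₁)).norm ≤ K' * (2 * K) := by
    have := norm_apply_le _ hK' (f (mk (L₂ ++ M₁)))
    refine le_trans (le_of_eq ?_) (this.trans (Nat.mul_le_mul_left _ h4))
    congr 1
    exact (MulAut.inv_apply_self _ f _).symm
  rw [norm, toWord_mk_of_isReduced hred, List.length_append] at h5
  have h6 : (f (mk M₁)).norm ≤ K * (K' * (2 * K)) := by
    refine (norm_apply_le (f : FreeGroupN N →* FreeGroupN N) hK (mk M₁)).trans ?_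
    have : (mk M₁).norm ≤ M₁.length := norm_mk_le
    exact Nat.mul_le_mul_left _ (by omega)
  have hc : IsReduced c := isReduced_toWord.of_isInfix ⟨p, [], by rw [List.append_nil]; exact ha.symm⟩
  have h7 : c.length = (mk c).norm := by rw [norm, toWord_mk_of_isReduced hc]
  have h8 : mk c = (mk c * f (mk M₁)) * (f (mk M₁))⁻¹ := by group
  rw [h7, h8]
  refine (norm_mul_le _ _).trans ?_
  rw [norm_inv_eq]
  exact Nat.add_le_add h2 h6

/-- The weighted length of a word. -/
def wt {N : ℕ} (w : Fin N → ℝ) (L : List (Fin N × Bool)) : ℝ := (L.map fun p => w p.1).sum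

theorem wt_append {N : ℕ} (w : Fin N → ℝ) (L₁ L₂ : List (Fin N × Bool)) :
    wt w (L₁ ++ L₂) = wt w L₁ + wt w L₂ := by
  simp [wt]

theorem wt_invRev {N : ℕ} (w : Fin N → ℝ) (L : List (Fin N × Bool)) :
    wt w (invRev L) = wt w L := by
  simp [wt, invRev, List.sum_reverse, Function.comp_def]

theorem wt_le_of_sublist {N : ℕ} {w : Fin N → ℝ} (hw : ∀ i, 0 ≤ w i) {L₁ L₂ : List (Fin N × Bool)}
    (h : L₁.Sublist L₂) : wt w L₁ ≤ wt w L₂ := by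
  induction h with
  | slnil => rfl
  | cons a _ ih => simp only [wt, List.map_cons, List.sum_cons] at *; linarith [hw a.1]
  | cons_cons a _ ih => simp only [wt, List.map_cons, List.sum_cons] at *; linarith

theorem wt_le {N : ℕ} {w : Fin N → ℝ} {M : ℝ} (hw : ∀ i, w i ≤ M) (L : List (Fin N × Bool)) :
    wt w L ≤ M * L.length := by
  induction L with
  | nil => simp [wt]
  | cons p L ih =>
    simp only [wt, List.map_cons, List.sum_cons, List.length_cons] at *
    push_cast
    linarith [hw p.1]

theorem le_wt {N : ℕ} {w : Fin N → ℝ} {m : ℝ} (hw : ∀ i, m ≤ w i) (L : List (Fin N × Bool)) :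
    m * L.length ≤ wt w L := by
  induction L with
  | nil => simp [wt]
  | cons p L ih =>
    simp only [wt, List.map_cons, List.sum_cons, List.length_cons] at *
    push_cast
    linarith [hw p.1]

/-- An automorphism which is positive up to changing the signs of basis elements, with positive
eigenvector for its transition matrix. -/
structure SignedPositive {N : ℕ} (f : MulAut (FreeGroupN N)) (lam : ℝ) where
  intro ::
  /-- The signs of the basis elements. -/
  sign : Fin N → Bool
  /-- Whether positive words are sent to negative words. -/
  flip : Bool
  /-- The weights of the basis elements. -/
  w : Fin N → ℝ
  w_pos : ∀ i, 0 < w i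
  one_lt : 1 < lam
  sgn_eq : ∀ i, ∀ p ∈ (f (of i)).toWord, xor p.2 (sign p.1) = xor flip (!(sign i))
  wt_eq : ∀ i, wt w (f (of i)).toWord = lam * w i

/-- All letters of a word have sign `b`. -/
def HasSign {N : ℕ} (s : Fin N → Bool) (b : Bool) (L : List (Fin N × Bool)) : Prop :=
  ∀ p ∈ L, xor p.2 (s p.1) = b

theorem HasSign.isReduced {N : ℕ} {s : Fin N → Bool} {b : Bool} {L : List (Fin N × Bool)}
    (h : HasSign s b L) : IsReduced L := by
  induction L with
  | nil => simp
  | cons p L ih =>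
    have h1 := ih fun q hq => h q (List.mem_cons_of_mem _ hq)
    rcases L with _ | ⟨q, L⟩
    · simp
    · rw [isReduced_cons_cons]
      refine ⟨fun hpq => ?_, h1⟩
      have h2 := h p (by simp)
      have h3 := h q (by simp)
      rw [← h3, hpq] at h2
      simpa using h2

theorem HasSign.append {N : ℕ} {s : Fin N → Bool} {b : Bool} {L₁ L₂ : List (Fin N × Bool)}
    (h₁ : HasSign s b L₁) (h₂ : HasSign s b L₂) : HasSign s b (L₁ ++ L₂) := fun p hp =>
  (List.mem_append.1 hp).elim (h₁ p) (h₂ p)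

theorem HasSign.of_sublist {N : ℕ} {s : Fin N → Bool} {b : Bool} {L₁ L₂ : List (Fin N × Bool)}
    (h : HasSign s b L₂) (hs : L₁.Sublist L₂) : HasSign s b L₁ := fun p hp => h p (hs.subset hp)

theorem HasSign.invRev {N : ℕ} {s : Fin N → Bool} {b : Bool} {L : List (Fin N × Bool)}
    (h : HasSign s b L) : HasSign s (!b) (FreeGroup.invRev L) := by
  intro p hp
  simp only [FreeGroup.invRev, List.mem_reverse, List.mem_map] at hp
  obtain ⟨q, hq, rfl⟩ := hp
  have := h q hq
  simp [← this]

namespace SignedPositive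

variable {N : ℕ} {f : MulAut (FreeGroupN N)} {lam : ℝ}

theorem apply_letter (T : SignedPositive f lam) (p : Fin N × Bool) :
    HasSign T.sign (xor T.flip (xor p.2 (T.sign p.1))) (f (mk [p])).toWord ∧
      wt T.w (f (mk [p])).toWord = lam * T.w p.1 := by
  rcases p with ⟨i, b⟩
  cases b
  · have : mk [(i, false)] = (of i)⁻¹ := by simp [of, inv_mk, FreeGroup.invRev]
    rw [this, _root_.map_inv, toWord_inv, wt_invRev]
    have h1 : HasSign T.sign (xor T.flip (!(T.sign i))) (f (of i)).toWord := T.sgn_eq i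
    have h2 := h1.invRev
    simp only [Bool.xor_not, Bool.not_not] at h2
    simp only [Bool.false_xor]
    exact ⟨h2, T.wt_eq i⟩
  · have h1 : HasSign T.sign (xor T.flip (!(T.sign i))) (f (of i)).toWord := T.sgn_eq i
    simp only [Bool.true_xor]
    exact ⟨h1, T.wt_eq i⟩

/-- Words of constant sign are mapped to words of constant sign, without cancellation. -/
theorem apply_hasSign (T : SignedPositive f lam) {b : Bool} (L : List (Fin N × Bool))
    (hL : HasSign T.sign b L) :
    HasSign T.sign (xor T.flip b) (f (mk L)).toWord ∧
      wt T.w (f (mk L)).toWord = lam * wt T.w L := by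
  induction L with
  | nil => simp [← one_eq_mk, HasSign, wt]
  | cons p L ih =>
    obtain ⟨h1, h2⟩ := ih fun q hq => hL q (List.mem_cons_of_mem _ hq)
    obtain ⟨h3, h4⟩ := T.apply_letter p
    rw [hL p (by simp)] at h3
    have h5 := h3.append h1
    have h6 : (f (mk (p :: L))).toWord = (f (mk [p])).toWord ++ (f (mk L)).toWord := by
      rw [← toWord_mk_of_isReduced h5.isReduced, ← mul_mk, mk_toWord, mk_toWord,
        ← _root_.map_mul, mul_mk]
      rfl
    rw [h6]
    refine ⟨h5, ?_⟩
    rw [wt_append, h2, h4]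
    simp only [wt, List.map_cons, List.sum_cons]
    ring

theorem wt_apply_le (T : SignedPositive f lam) (L : List (Fin N × Bool)) :
    wt T.w (f (mk L)).toWord ≤ lam * wt T.w L := by
  induction L with
  | nil => simp [← one_eq_mk, wt]
  | cons p L ih =>
    have h4 := (T.apply_letter p).2
    have h6 : f (mk (p :: L)) = f (mk [p]) * f (mk L) := by
      rw [← _root_.map_mul, mul_mk]
      rfl
    have h7 := wt_le_of_sublist (fun i => (T.w_pos i).le)
      (toWord_mul_sublist (f (mk [p])) (f (mk L)))
    rw [wt_append, ← h6, h4] at h7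
    simp only [wt, List.map_cons, List.sum_cons] at *
    linarith

theorem wt_pow_apply_le (T : SignedPositive f lam) (g : FreeGroupN N) (n : ℕ) :
    wt T.w ((f ^ n) g).toWord ≤ lam ^ n * wt T.w g.toWord := by
  induction n with
  | zero => simp
  | succ n ih =>
    have h1 := T.wt_apply_le ((f ^ n) g).toWord
    rw [mk_toWord] at h1
    rw [pow_succ', MulAut.mul_apply, pow_succ', mul_assoc]
    exact h1.trans (mul_le_mul_of_nonneg_left ih (by linarith [T.one_lt]))

/-- The reduced word of `g` starts and ends with subwords of sign `b` and weight at least `W`. -/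
def LongEnds (T : SignedPositive f lam) (g : FreeGroupN N) (W : ℝ) : Prop :=
  ∃ b s₁ t₁ s₂ t₂, g.toWord = s₁ ++ t₁ ∧ g.toWord = t₂ ++ s₂ ∧ HasSign T.sign b s₁ ∧
    HasSign T.sign b s₂ ∧ W ≤ wt T.w s₁ ∧ W ≤ wt T.w s₂

theorem LongEnds.isCyclicallyReduced {T : SignedPositive f lam} {g : FreeGroupN N} {W : ℝ}
    (h : T.LongEnds g W) (hW : 0 < W) : IsCyclicallyReduced g.toWord := by
  obtain ⟨b, s₁, t₁, s₂, t₂, h1, h2, h3, h4, h5, h6⟩ := h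
  refine ⟨isReduced_toWord, fun x hx y hy hxy => ?_⟩
  have hx' : x ∈ s₂ := by
    rw [h2, List.getLast?_append] at hx
    rcases hs : s₂.getLast? with _ | z
    · rw [List.getLast?_eq_none_iff.1 hs] at h6
      simp [wt] at h6
      linarith
    · rw [hs] at hx
      simp at hx
      subst hx
      exact List.mem_of_getLast? hs
  have hy' : y ∈ s₁ := by
    rcases s₁ with _ | ⟨z, s₁⟩
    · simp [wt] at h5
      linarith
    · rw [h1] at hy
      simp at hy
      simp [hy]
  have e1 := h4 x hx'
  rw [← h3 y hy', hxy] at e1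
  simpa using e1

theorem LongEnds.apply {T : SignedPositive f lam} {g : FreeGroupN N} {W M : ℝ} {B : ℕ}
    (h : T.LongEnds g W) (hM : ∀ i, T.w i ≤ M) (hM0 : 0 ≤ M)
    (hB : ∀ a b : FreeGroupN N, IsReduced (a.toWord ++ b.toWord) → ∀ p c q,
      (f a).toWord = p ++ c → (f b).toWord = FreeGroup.invRev c ++ q → c.length ≤ B) :
    T.LongEnds (f g) (lam * W - M * B) := by
  obtain ⟨b, s₁, t₁, s₂, t₂, h1, h2, h3, h4, h5, h6⟩ := h
  have hlam : 0 ≤ lam := by linarith [T.one_lt]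
  have key : ∀ x y : List (Fin N × Bool), g.toWord = x ++ y → g = mk x * mk y ∧
      IsReduced ((mk x).toWord ++ (mk y).toWord) := by
    intro x y hxy
    have hr := isReduced_toWord (x := g)
    rw [hxy] at hr
    rw [toWord_mk_of_isReduced (hr.of_isInfix ⟨[], y, by simp⟩),
      toWord_mk_of_isReduced (hr.of_isInfix ⟨x, [], by simp⟩)]
    exact ⟨by rw [mul_mk, ← hxy, mk_toWord], hr⟩
  have hcw : ∀ c : List (Fin N × Bool), c.length ≤ B → wt T.w c ≤ M * B := fun c hc =>
    (wt_le hM c).trans (mul_le_mul_of_nonneg_left (by exact_mod_cast hc) hM0)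
  obtain ⟨e1, r1⟩ := key _ _ h1
  obtain ⟨e2, r2⟩ := key _ _ h2
  obtain ⟨p, c, q, a1, a2, a3⟩ := exists_toWord_mul (f (mk s₁)) (f (mk t₁))
  obtain ⟨p', c', q', b1, b2, b3⟩ := exists_toWord_mul (f (mk t₂)) (f (mk s₂))
  rw [← _root_.map_mul, ← e1] at a3
  rw [← _root_.map_mul, ← e2] at b3
  obtain ⟨g1, g2⟩ := T.apply_hasSign s₁ h3
  obtain ⟨g3, g4⟩ := T.apply_hasSign s₂ h4
  have k1 := hcw c (hB _ _ r1 p c q a1 a2)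
  have k2 := hcw c' (hB _ _ r2 p' c' q' b1 b2)
  rw [a1] at g1 g2
  rw [b2] at g3 g4
  rw [wt_append] at g2 g4
  rw [wt_invRev] at g4
  refine ⟨xor T.flip b, p, q, q', p', a3, b3, g1.of_sublist (List.sublist_append_left _ _),
    g3.of_sublist (List.sublist_append_right _ _), ?_, ?_⟩
  · have := mul_le_mul_of_nonneg_left h5 hlam
    linarith
  · have := mul_le_mul_of_nonneg_left h6 hlam
    linarith

end SignedPositive

theorem map_mulAut_injective {G : Type*} [Group G] (f : MulAut G) :
    Function.Injective (ConjClasses.map (f : G →* G)) := by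
  intro a b h
  obtain ⟨x, rfl⟩ := ConjClasses.mk_surjective a
  obtain ⟨y, rfl⟩ := ConjClasses.mk_surjective b
  obtain ⟨c, hc⟩ := isConj_iff.1 (ConjClasses.mk_eq_mk_iff_isConj.1 h)
  refine ConjClasses.mk_eq_mk_iff_isConj.2 (isConj_iff.2 ⟨f⁻¹ c, f.injective ?_⟩)
  rw [_root_.map_mul, _root_.map_mul, _root_.map_inv, MulAut.apply_inv_self]
  exact hc

theorem finite_setOf_norm_le {α : Type*} [DecidableEq α] [Finite α] (R : ℕ) :
    {g : FreeGroup α | g.norm ≤ R}.Finite :=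
  Set.Finite.of_finite_image ((List.finite_length_le (α × Bool) R).subset (by
    rintro _ ⟨g, hg, rfl⟩
    exact hg)) toWord_injective.injOn

/-- Lengths are unbounded along the orbit of a nonperiodic conjugacy class. -/
theorem exists_lt_stdCycLength {N : ℕ} {f : MulAut (FreeGroupN N)} {α : ConjClasses (FreeGroupN N)}
    (hα : ¬ IsPeriodicClass f α) (R : ℕ) : ∃ n : ℕ, R < stdCycLength
      (ConjClasses.map ((f ^ n : MulAut (FreeGroupN N)) : FreeGroupN N →* FreeGroupN N) α) := by
  by_contra! h
  set F := ConjClasses.map (f : FreeGroupN N →* FreeGroupN N) with hF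
  have hfin : (ConjClasses.mk '' {g : FreeGroupN N | g.norm ≤ R}).Finite :=
    (finite_setOf_norm_le R).image _
  have hmem : ∀ n : ℕ, F^[n] α ∈ ConjClasses.mk '' {g : FreeGroupN N | g.norm ≤ R} := by
    intro n
    have h1 := h n
    rw [map_pow_eq_iterate] at h1
    obtain ⟨g, hg, hn⟩ := exists_cycLength_eq (MulEquiv.refl (FreeGroupN N)) (F^[n] α)
    exact ⟨g, by
      change ((MulEquiv.refl (FreeGroupN N)) g).norm ≤ R
      rw [hn]
      exact h1, hg⟩
  have hper : ∀ a b : ℕ, a < b → F^[a] α = F^[b] α → False := by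
    intro a b hab he
    refine hα ⟨b - a, by omega, ?_⟩
    rw [map_pow_eq_iterate]
    apply (map_mulAut_injective f).iterate a
    rw [← hF, ← Function.iterate_add_apply, he]
    congr 1
    omega
  have := hfin.to_subtype
  obtain ⟨a, b, hab, he⟩ := Finite.exists_ne_map_eq_of_infinite
    (fun n : ℕ => (⟨F^[n] α, hmem n⟩ : ConjClasses.mk '' {g : FreeGroupN N | g.norm ≤ R}))
  have he' := congrArg Subtype.val he
  rcases lt_or_gt_of_ne hab with hlt | hlt
  · exact hper a b hlt he'
  · exact hper b a hlt he'.symm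

/-- A subword of a concatenation of few words of constant sign has a long segment of constant
sign. -/
theorem exists_long_segment {N : ℕ} (s : Fin N → Bool) (Ls : List (List (Fin N × Bool))) :
    ∀ r, (∀ l ∈ Ls, ∃ b, HasSign s b l) → r.Sublist Ls.flatten →
      ∃ a t a', r = a ++ t ++ a' ∧ (∃ b, HasSign s b t) ∧ r.length ≤ Ls.length * t.length := by
  induction Ls with
  | nil =>
    intro r _ h
    simp at h
    exact ⟨[], [], [], by simp [h], ⟨true, by simp [HasSign]⟩, by simp [h]⟩
  | cons l Ls ih =>
    intro r hs h
    rw [List.flatten_cons, List.sublist_append_iff] at h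
    obtain ⟨r₁, r₂, rfl, h1, h2⟩ := h
    obtain ⟨a, t, a', rfl, ht, hlen⟩ := ih r₂ (fun l hl => hs l (List.mem_cons_of_mem _ hl)) h2
    obtain ⟨b, hb⟩ := hs l (by simp)
    simp only [List.length_append, List.length_cons] at hlen ⊢
    rcases le_total t.length r₁.length with hle | hle
    · refine ⟨[], r₁, a ++ t ++ a', by simp, ⟨b, hb.of_sublist h1⟩, ?_⟩
      have := Nat.mul_le_mul_left Ls.length hle
      rw [add_mul]
      omega
    · refine ⟨r₁ ++ a, t, a', by simp, ht, ?_⟩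
      rw [add_mul]
      omega

theorem exists_pos_le {N : ℕ} {w : Fin N → ℝ} (hw : ∀ i, 0 < w i) : ∃ m, 0 < m ∧ ∀ i, m ≤ w i := by
  rcases isEmpty_or_nonempty (Fin N) with h | h
  · exact ⟨1, one_pos, fun i => h.elim i⟩
  · obtain ⟨i, hi⟩ := Finite.exists_min w
    exact ⟨w i, hw i, hi⟩

theorem apply_mk_eq_mk_flatten {N : ℕ} (f : MulAut (FreeGroupN N)) (L : List (Fin N × Bool)) :
    f (mk L) = mk (L.map fun l => (f (mk [l])).toWord).flatten := by
  induction L with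
  | nil => simp [← one_eq_mk]
  | cons l L ih =>
    rw [List.map_cons, List.flatten_cons, ← mul_mk, ← ih, mk_toWord, ← _root_.map_mul, mul_mk]
    rfl

namespace SignedPositive

variable {N : ℕ} {f : MulAut (FreeGroupN N)} {lam : ℝ}

theorem pow_apply_hasSign (T : SignedPositive f lam) {b : Bool} {L : List (Fin N × Bool)}
    (hL : HasSign T.sign b L) (n : ℕ) : ∃ b, HasSign T.sign b ((f ^ n) (mk L)).toWord := by
  induction n with
  | zero =>
    refine ⟨b, ?_⟩
    rw [pow_zero, MulAut.one_apply, toWord_mk_of_isReduced hL.isReduced]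
    exact hL
  | succ n ih =>
    obtain ⟨b', h⟩ := ih
    have := (T.apply_hasSign _ h).1
    rw [mk_toWord] at this
    rw [pow_succ', MulAut.mul_apply]
    exact ⟨_, this⟩

theorem exists_longEnds (T : SignedPositive f lam) {α : ConjClasses (FreeGroupN N)}
    (hα : ¬ IsPeriodicClass f α) (W : ℝ) : ∃ (n : ℕ) (g : FreeGroupN N), ConjClasses.mk g =
      ConjClasses.map ((f ^ n : MulAut (FreeGroupN N)) : FreeGroupN N →* FreeGroupN N) α ∧
        T.LongEnds g W := by
  obtain ⟨g₀, rfl⟩ := ConjClasses.mk_surjective α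
  obtain ⟨m, hm0, hm⟩ := exists_pos_le T.w_pos
  obtain ⟨R, hR⟩ := exists_nat_ge (W / m)
  rw [div_le_iff₀ hm0] at hR
  obtain ⟨n, hn⟩ := exists_lt_stdCycLength hα (g₀.norm * (2 * R))
  obtain ⟨p, r, h1, h2, h3⟩ := exists_conj_isCyclicallyReduced ((f ^ n) g₀)
  have h4 : ConjClasses.mk (mk r) = ConjClasses.mk ((f ^ n) g₀) := by
    rw [ConjClasses.mk_eq_mk_iff_isConj, isConj_iff]
    exact ⟨mk p, h3.symm⟩
  have h5 : stdCycLength (ConjClasses.mk (mk r)) = r.length := by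
    rw [stdCycLength_mk_eq (by rwa [toWord_mk_of_isReduced h2.isReduced]), norm,
      toWord_mk_of_isReduced h2.isReduced]
  rw [map_pow_mk, ← h4, h5] at hn
  have h6 : r.Sublist (g₀.toWord.map fun l => ((f ^ n) (mk [l])).toWord).flatten := by
    have h7 : ((f ^ n) g₀).toWord.Sublist
        (g₀.toWord.map fun l => ((f ^ n) (mk [l])).toWord).flatten := by
      have := apply_mk_eq_mk_flatten (f ^ n) g₀.toWord
      rw [mk_toWord] at this
      rw [this, toWord_mk]
      exact reduce.red.sublist
    refine List.Sublist.trans ?_ h7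
    rw [h1, List.append_assoc]
    exact (List.sublist_append_left _ _).trans (List.sublist_append_right _ _)
  obtain ⟨a, t, a', rfl, ⟨b, hb⟩, h8⟩ := exists_long_segment T.sign _ _ (by
    intro l hl
    obtain ⟨x, _, rfl⟩ := List.mem_map.1 hl
    exact T.pow_apply_hasSign (b := xor x.2 (T.sign x.1)) (by simp [HasSign]) n) h6
  rw [List.length_map] at h8
  have h9 : 2 * R < t.length := lt_of_mul_lt_mul_left (hn.trans_le h8) (Nat.zero_le _)
  have hlong : ∀ t' : List (Fin N × Bool), R ≤ t'.length → W ≤ wt T.w t' := by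
    intro t' ht'
    have h10 := le_wt hm t'
    have h11 : (R : ℝ) ≤ t'.length := by exact_mod_cast ht'
    nlinarith
  refine ⟨n, mk (t.drop R ++ a' ++ a ++ t.take R), ?_, b, t.drop R, a' ++ a ++ t.take R,
    t.take R, t.drop R ++ a' ++ a, ?_⟩
  · rw [map_pow_mk, ← h4, ConjClasses.mk_eq_mk_iff_isConj, isConj_iff]
    refine ⟨mk (a ++ t.take R), ?_⟩
    rw [mul_inv_eq_iff_eq_mul, mul_mk, mul_mk]
    congr 1
    simp only [List.append_assoc]
    rw [← List.append_assoc (t.take R), List.take_append_drop]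
  · have hred : IsReduced (t.drop R ++ a' ++ a ++ t.take R) := by
      have h12 := (h2.flatten_replicate 2).isReduced
      refine h12.of_isInfix ⟨a ++ t.take R, t.drop R ++ a', ?_⟩
      have h13 : ∀ L, t.take R ++ (t.drop R ++ L) = t ++ L := by
        intro L
        rw [← List.append_assoc, List.take_append_drop]
      simp [List.replicate_succ, h13, -List.take_append_drop]
    rw [toWord_mk_of_isReduced hred]
    refine ⟨by simp, rfl, hb.of_sublist (List.drop_sublist _ _),
      hb.of_sublist (List.take_sublist _ _), hlong _ ?_, hlong _ ?_⟩
    · rw [List.length_drop]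
      omega
    · rw [List.length_take]
      omega

/-- Lengths of nonperiodic classes grow at least like the powers of the dilatation. -/
theorem exists_le_stdCycLength (T : SignedPositive f lam) {α : ConjClasses (FreeGroupN N)}
    (hα : ¬ IsPeriodicClass f α) : ∃ c : ℝ, 0 < c ∧ ∀ᶠ n : ℕ in Filter.atTop, c * lam ^ n ≤
      (stdCycLength (ConjClasses.map
        ((f ^ n : MulAut (FreeGroupN N)) : FreeGroupN N →* FreeGroupN N) α) : ℝ) := by
  obtain ⟨B, hB⟩ := exists_cancel_bound f
  set M : ℝ := ∑ i, T.w i + 1 with hMdef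
  have hM0 : 0 < M := add_pos_of_nonneg_of_pos
    (Finset.sum_nonneg fun i _ => (T.w_pos i).le) one_pos
  have hM : ∀ i, T.w i ≤ M := by
    intro i
    have := Finset.single_le_sum (f := T.w) (fun j _ => (T.w_pos j).le) (Finset.mem_univ i)
    linarith
  have hlam := T.one_lt
  set γ := M * B / (lam - 1) with hγ
  have hγ0 : 0 ≤ γ := by
    have : 0 < lam - 1 := by linarith
    positivity
  have hγ1 : lam * γ - M * B = γ := by
    have : lam - 1 ≠ 0 := by linarith
    rw [hγ]
    field_simp
    ring
  obtain ⟨n₀, g, hg, hend⟩ := T.exists_longEnds hα (γ + 1)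
  have hiter : ∀ k : ℕ, T.LongEnds ((f ^ k) g) (γ + lam ^ k) := by
    intro k
    induction k with
    | zero => simpa using hend
    | succ k ih =>
      have := ih.apply hM hM0.le hB
      rw [pow_succ', MulAut.mul_apply]
      convert this using 1
      rw [mul_add, pow_succ']
      linarith
  refine ⟨1 / (M * lam ^ n₀), by positivity, ?_⟩
  filter_upwards [Filter.eventually_ge_atTop n₀] with n hn
  obtain ⟨k, rfl⟩ := Nat.exists_eq_add_of_le hn
  have h1 : ConjClasses.map ((f ^ (n₀ + k) : MulAut (FreeGroupN N)) :
      FreeGroupN N →* FreeGroupN N) α = ConjClasses.mk ((f ^ k) g) := by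
    rw [← map_pow_mk, hg, map_pow_eq_iterate, map_pow_eq_iterate, map_pow_eq_iterate,
      ← Function.iterate_add_apply, add_comm]
  have hpos : 0 < lam ^ k := by positivity
  rw [h1, stdCycLength_mk_eq ((hiter k).isCyclicallyReduced (by linarith))]
  obtain ⟨b, s₁, t₁, s₂, t₂, e1, -, -, -, e5, -⟩ := hiter k
  have h2 : wt T.w s₁ ≤ M * ((f ^ k) g).norm := by
    refine (wt_le_of_sublist (fun i => (T.w_pos i).le) ?_).trans (wt_le hM _)
    rw [e1]
    exact List.sublist_append_left _ _
  have h3 : lam ^ k ≤ M * ((f ^ k) g).norm := by linarith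
  rw [pow_add, one_div_mul_eq_div, div_le_iff₀ (by positivity)]
  calc lam ^ n₀ * lam ^ k ≤ lam ^ n₀ * (M * ((f ^ k) g).norm) := by gcongr
    _ = _ := by ring

end SignedPositive

theorem tendsto_rpow_one_div {a : ℕ → ℝ} {lam c C : ℝ} (hlam : 0 < lam) (hc : 0 < c) (hC : 0 < C)
    (h1 : ∀ᶠ n : ℕ in Filter.atTop, c * lam ^ n ≤ a n)
    (h2 : ∀ᶠ n : ℕ in Filter.atTop, a n ≤ C * lam ^ n) :
    Filter.Tendsto (fun n : ℕ => a n ^ (1 / (n : ℝ))) Filter.atTop (nhds lam) := by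
  have key : ∀ d : ℝ, 0 < d → Filter.Tendsto (fun n : ℕ => d ^ (1 / (n : ℝ)) * lam) Filter.atTop
      (nhds lam) := by
    intro d hd
    have h4 : Filter.Tendsto (fun n : ℕ => d ^ (1 / (n : ℝ)) * lam) Filter.atTop
        (nhds (d ^ (0 : ℝ) * lam)) := by
      refine Filter.Tendsto.mul_const _ ?_
      exact (Real.continuousAt_const_rpow hd.ne').tendsto.comp tendsto_one_div_atTop_nhds_zero_nat
    rwa [Real.rpow_zero, one_mul] at h4
  have e : ∀ d : ℝ, 0 < d → ∀ n : ℕ, 1 ≤ n → (d * lam ^ n) ^ (1 / (n : ℝ)) =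
      d ^ (1 / (n : ℝ)) * lam := by
    intro d hd n hn
    rw [Real.mul_rpow hd.le (by positivity), one_div,
      Real.pow_rpow_inv_natCast hlam.le (by omega)]
  refine tendsto_of_tendsto_of_tendsto_of_le_of_le' (key c hc) (key C hC) ?_ ?_
  · filter_upwards [h1, Filter.eventually_ge_atTop 1] with n hn hn1
    rw [← e c hc n hn1]
    exact Real.rpow_le_rpow (by positivity) hn (by positivity)
  · filter_upwards [h1, h2, Filter.eventually_ge_atTop 1] with n hn0 hn hn1
    rw [← e C hC n hn1]
    exact Real.rpow_le_rpow (le_trans (by positivity) hn0) hn (by positivity)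

theorem map_pow_eq_of_mk_eq {G : Type*} [Group G] {f f' : MulAut G}
    (h : (QuotientGroup.mk f' : MulAut G ⧸ Inn G) = QuotientGroup.mk f) (n : ℕ)
    (α : ConjClasses G) : ConjClasses.map ((f' ^ n : MulAut G) : G →* G) α =
      ConjClasses.map ((f ^ n : MulAut G) : G →* G) α := by
  have h1 : (QuotientGroup.mk (f' ^ n) : MulAut G ⧸ Inn G) = QuotientGroup.mk (f ^ n) := by
    rw [QuotientGroup.mk_pow, QuotientGroup.mk_pow, h]
  obtain ⟨c, hc⟩ := QuotientGroup.eq.1 h1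
  obtain ⟨g, rfl⟩ := ConjClasses.mk_surjective α
  rw [map_pow_mk, map_pow_mk, ConjClasses.mk_eq_mk_iff_isConj, isConj_iff]
  have h2 : f ^ n = f' ^ n * MulAut.conj c := by rw [hc, mul_inv_cancel_left]
  refine ⟨(f' ^ n) c, ?_⟩
  rw [h2, MulAut.mul_apply, MulAut.conj_apply, _root_.map_mul, _root_.map_mul, _root_.map_inv]

theorem exists_cycLength_le {N : ℕ} (β : FreeGroupN N ≃* FreeGroup (Fin N)) :
    ∃ K : ℕ, ∀ g, cycLength β (ConjClasses.mk g) ≤ K * g.norm := by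
  obtain ⟨K, hK⟩ := exists_norm_le (β : FreeGroupN N →* FreeGroupN N)
  exact ⟨K, fun g => (cycLength_le β g).trans (norm_apply_le _ hK g)⟩

theorem exists_stdCycLength_le {N : ℕ} (β : FreeGroupN N ≃* FreeGroup (Fin N)) :
    ∃ K : ℕ, ∀ α, stdCycLength α ≤ K * cycLength β α := by
  obtain ⟨K, hK⟩ := exists_norm_le (β.symm : FreeGroupN N →* FreeGroupN N)
  refine ⟨K, fun α => ?_⟩
  obtain ⟨g, rfl, hg⟩ := exists_cycLength_eq β α
  rw [← hg]
  refine (cycLength_le (MulEquiv.refl _) g).trans ?_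
  have := norm_apply_le _ hK (β g)
  refine le_trans (le_of_eq ?_) this
  congr 1
  exact (β.symm_apply_apply g).symm

/-- The stretch factor of an automorphism which is positive up to signs. -/
theorem SignedPositive.hasStretchFactor {N : ℕ} {f : MulAut (FreeGroupN N)} {lam : ℝ}
    (T : SignedPositive f lam) :
    HasStretchFactor (QuotientGroup.mk f : Out (FreeGroupN N)) lam := by
  intro f' hf' β α hα'
  have hmap := map_pow_eq_of_mk_eq (f := f) (f' := f') hf'
  simp only [hmap]
  have hα : ¬ IsPeriodicClass f α := by
    rintro ⟨k, hk, h⟩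
    exact hα' ⟨k, hk, (hmap k α).trans h⟩
  obtain ⟨c, hc0, hc⟩ := T.exists_le_stdCycLength hα
  obtain ⟨K₁, hK₁⟩ := exists_cycLength_le β
  obtain ⟨K₂, hK₂⟩ := exists_stdCycLength_le β
  obtain ⟨m, hm0, hm⟩ := exists_pos_le T.w_pos
  obtain ⟨g, rfl⟩ := ConjClasses.mk_surjective α
  have hlam := T.one_lt
  have hwg : 0 ≤ wt T.w g.toWord := le_trans (by positivity) (le_wt hm g.toWord)
  refine tendsto_rpow_one_div (c := c / (K₂ + 1)) (C := (K₁ + 1) * (wt T.w g.toWord + 1) / m)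
    (by linarith) (by positivity) (by positivity) ?_ (Filter.Eventually.of_forall fun n => ?_)
  · filter_upwards [hc] with n hn
    have h1 := hK₂ (ConjClasses.map
      ((f ^ n : MulAut (FreeGroupN N)) : FreeGroupN N →* FreeGroupN N) (ConjClasses.mk g))
    rw [div_mul_eq_mul_div, div_le_iff₀ (by positivity)]
    refine hn.trans ?_
    have h2 : stdCycLength (ConjClasses.map
        ((f ^ n : MulAut (FreeGroupN N)) : FreeGroupN N →* FreeGroupN N) (ConjClasses.mk g)) ≤
      cycLength β (ConjClasses.map
        ((f ^ n : MulAut (FreeGroupN N)) : FreeGroupN N →* FreeGroupN N) (ConjClasses.mk g)) *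
          (K₂ + 1) := by nlinarith
    exact_mod_cast h2
  · rw [map_pow_mk]
    have h1 : (cycLength β (ConjClasses.mk ((f ^ n) g)) : ℝ) ≤ K₁ * ((f ^ n) g).norm := by
      exact_mod_cast hK₁ ((f ^ n) g)
    have h2 : m * ((f ^ n) g).norm ≤ lam ^ n * wt T.w g.toWord :=
      (le_wt hm _).trans (T.wt_pow_apply_le g n)
    have hpos : 0 < lam ^ n := by positivity
    rw [div_mul_eq_mul_div, le_div_iff₀ hm0]
    calc (cycLength β (ConjClasses.mk ((f ^ n) g)) : ℝ) * m
        ≤ K₁ * ((f ^ n) g).norm * m := by gcongr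
      _ = K₁ * (m * ((f ^ n) g).norm) := by ring
      _ ≤ K₁ * (lam ^ n * wt T.w g.toWord) := by gcongr
      _ ≤ (K₁ + 1) * (lam ^ n * (wt T.w g.toWord + 1)) := by
        gcongr <;> linarith
      _ = _ := by ring

/-- A nontrivial free group has a nontrivial homomorphism to the integers. -/
theorem exists_hom_ne_one {G : Type*} [Group G] [IsFreeGroup G] [Nontrivial G] :
    ∃ χ : G →* Multiplicative ℤ, χ ≠ 1 := by
  have hne : Nonempty (IsFreeGroup.Generators G) := by
    by_contra h
    rw [not_nonempty_iff] at h
    exact not_subsingleton G (IsFreeGroup.toFreeGroup G).toEquiv.subsingleton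
  obtain ⟨x⟩ := hne
  refine ⟨IsFreeGroup.lift fun _ => Multiplicative.ofAdd 1, fun h => ?_⟩
  have h1 := DFunLike.congr_fun h (IsFreeGroup.of x)
  rw [IsFreeGroup.lift_of, MonoidHom.one_apply] at h1
  exact absurd h1 (by decide)

/-- A pair of homomorphisms on the factors of an internal free product extends. -/
theorem exists_hom_of_bijective {G H : Type*} [Group G] [Group H] {A B : Subgroup G}
    (h : Function.Bijective (Monoid.Coprod.lift A.subtype B.subtype))
    (α : A →* H) (β : B →* H) :
    ∃ χ : G →* H, (∀ a : A, χ a = α a) ∧ ∀ b : B, χ b = β b := by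
  let e := MulEquiv.ofBijective _ h
  refine ⟨(Monoid.Coprod.lift α β).comp e.symm.toMonoidHom, fun a => ?_, fun b => ?_⟩
  · have h1 : e.symm a = Monoid.Coprod.inl a := by
      rw [MulEquiv.symm_apply_eq]
      simp [e]
    simp [h1]
  · have h1 : e.symm b = Monoid.Coprod.inr b := by
      rw [MulEquiv.symm_apply_eq]
      simp [e]
    simp [h1]

theorem exists_hom_of_isFreeFactor {G : Type*} [Group G] [IsFreeGroup G] {A : Subgroup G}
    (hA : IsFreeFactor A) (h0 : A ≠ ⊥) (h1 : A ≠ ⊤) :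
    (∃ χ : G →* Multiplicative ℤ, χ ≠ 1 ∧ ∀ a ∈ A, χ a = 1) ∧
      ∃ a ∈ A, ∃ χ : G →* Multiplicative ℤ, χ a ≠ 1 := by
  obtain ⟨B, hB⟩ := hA
  constructor
  · have hB0 : B ≠ ⊥ := by
      rintro rfl
      refine h1 (eq_top_iff.2 fun g _ => ?_)
      obtain ⟨x, rfl⟩ := hB.2 g
      induction x using Monoid.Coprod.induction_on with
      | inl a => simp
      | inr b =>
        rw [Monoid.Coprod.lift_apply_inr, Subgroup.coe_subtype, Subgroup.mem_bot.1 b.2]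
        exact A.one_mem
      | mul x y hx hy =>
        rw [_root_.map_mul]
        exact A.mul_mem (hx trivial) (hy trivial)
    have := (Subgroup.nontrivial_iff_ne_bot B).2 hB0
    obtain ⟨β, hβ⟩ := exists_hom_ne_one (G := B)
    obtain ⟨χ, h2, h3⟩ := exists_hom_of_bijective hB 1 β
    refine ⟨χ, ?_, fun a ha => h2 ⟨a, ha⟩⟩
    rintro rfl
    exact hβ (MonoidHom.ext fun b => (h3 b).symm)
  · have := (Subgroup.nontrivial_iff_ne_bot A).2 h0
    obtain ⟨α, hα⟩ := exists_hom_ne_one (G := A)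
    obtain ⟨χ, h2, h3⟩ := exists_hom_of_bijective hB α 1
    obtain ⟨a, ha⟩ := DFunLike.ne_iff.1 hα
    exact ⟨a, a.2, χ, by rwa [h2]⟩

/-- A criterion for full irreducibility in terms of the action on homology. -/
theorem fullyIrreducible_of_hom {N : ℕ} {f : MulAut (FreeGroupN N)}
    (h : ∀ (k : ℕ) (χ χ' : FreeGroupN N →* Multiplicative ℤ) (a : FreeGroupN N), 0 < k →
      (∀ n, χ ((f ^ (k * n)) a) = 1) → χ' a ≠ 1 → χ = 1) :
    FullyIrreducible (QuotientGroup.mk f : Out (FreeGroupN N)) := by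
  intro k hk f' hf' A hA h0 h1 g hg
  obtain ⟨⟨χ, hχ, hχA⟩, a, ha, χ', hχ'⟩ := exists_hom_of_isFreeFactor hA h0 h1
  have hf'' : (QuotientGroup.mk (f ^ k) : Out (FreeGroupN N)) = QuotientGroup.mk f' := by
    rw [hf']
    rfl
  have hmap : ∀ α : ConjClasses (FreeGroupN N),
      ConjClasses.map ((f ^ k : MulAut (FreeGroupN N)) : FreeGroupN N →* FreeGroupN N) α =
        ConjClasses.map (f' : FreeGroupN N →* FreeGroupN N) α := by
    intro α
    simpa using map_pow_eq_of_mk_eq hf'' 1 α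
  have hstep : ∀ b ∈ A, ∃ b' ∈ A, IsConj ((f ^ k) b) b' := by
    intro b hb
    have h2 : f' b ∈ A.map (f' : FreeGroupN N →* FreeGroupN N) := ⟨b, hb, rfl⟩
    rw [hg] at h2
    obtain ⟨b', hb', h3⟩ := h2
    refine ⟨b', hb', ?_⟩
    have h4 : IsConj ((f ^ k) b) (f' b) := ConjClasses.mk_eq_mk_iff_isConj.1 (hmap (ConjClasses.mk b))
    refine h4.trans ?_
    rw [← h3]
    exact (isConj_iff.2 ⟨g, rfl⟩ : IsConj b' (g * b' * g⁻¹)).symm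
  have hall : ∀ n, ∃ b' ∈ A, IsConj ((f ^ (k * n)) a) b' := by
    intro n
    induction n with
    | zero => exact ⟨a, ha, IsConj.refl a⟩
    | succ n ih =>
      obtain ⟨b, hb, h2⟩ := ih
      obtain ⟨b', hb', h3⟩ := hstep b hb
      refine ⟨b', hb', IsConj.trans ?_ h3⟩
      rw [mul_add, mul_one, add_comm, pow_add, MulAut.mul_apply]
      exact MonoidHom.map_isConj ((f ^ k : MulAut (FreeGroupN N)) : FreeGroupN N →* FreeGroupN N) h2
  refine hχ (h k χ χ' a hk (fun n => ?_) hχ')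
  obtain ⟨b, hb, h2⟩ := hall n
  have h3 := χ.map_isConj h2
  rw [isConj_iff_eq] at h3
  rw [h3, hχA b hb]

theorem tendsto_zero_of_contracting {m : ℕ} (hm : 0 < m) {b : ℕ → ℝ} {θ : ℝ} (hθ : θ < 1)
    (hb : ∑ j ∈ Finset.range m, |b j| ≤ θ) {d : ℕ → ℝ}
    (hd : ∀ n, d (n + m) = ∑ j ∈ Finset.range m, b j * d (n + j)) :
    Filter.Tendsto d Filter.atTop (nhds 0) := by
  have hθ0 : 0 ≤ θ := (Finset.sum_nonneg fun j _ => abs_nonneg (b j)).trans hb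
  set C := ∑ j ∈ Finset.range m, |d j|
  have hC0 : 0 ≤ C := Finset.sum_nonneg fun j _ => abs_nonneg _
  have key : ∀ n, |d n| ≤ C * θ ^ (n / m) := by
    intro n
    induction n using Nat.strong_induction_on with
    | _ n ih =>
      rcases lt_or_ge n m with h | h
      · rw [Nat.div_eq_of_lt h, pow_zero, mul_one]
        exact Finset.single_le_sum (f := fun j => |d j|) (fun j _ => abs_nonneg _)
          (Finset.mem_range.2 h)
      · obtain ⟨k, rfl⟩ := Nat.exists_eq_add_of_le' h
        rw [hd, Nat.add_div_right _ hm, pow_succ]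
        calc |∑ j ∈ Finset.range m, b j * d (k + j)|
            ≤ ∑ j ∈ Finset.range m, |b j * d (k + j)| := Finset.abs_sum_le_sum_abs _ _
          _ ≤ ∑ j ∈ Finset.range m, |b j| * (C * θ ^ (k / m)) := by
            refine Finset.sum_le_sum fun j hj => ?_
            rw [abs_mul]
            have hj' := Finset.mem_range.1 hj
            refine mul_le_mul_of_nonneg_left ((ih _ (by omega)).trans ?_) (abs_nonneg _)
            refine mul_le_mul_of_nonneg_left ?_ hC0
            exact pow_le_pow_of_le_one hθ0 hθ.le (Nat.div_le_div_right (by omega))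
          _ = (∑ j ∈ Finset.range m, |b j|) * (C * θ ^ (k / m)) := by
            rw [← Finset.sum_mul]
          _ ≤ θ * (C * θ ^ (k / m)) := by gcongr
          _ = _ := by ring
  refine squeeze_zero_norm key ?_
  have h1 := ((tendsto_pow_atTop_nhds_zero_of_lt_one hθ0 hθ).comp
    (Nat.tendsto_div_const_atTop hm.ne')).const_mul C
  simpa using h1

/-- Solutions of the recurrence with characteristic polynomial `t ^ N + 2 * t ^ (N - 1) - 1`,
where `N = n + 2`. -/
def IsSol (n : ℕ) (a : ℕ → ℤ) : Prop :=
  ∀ k, a (k + (n + 2)) = -2 * a (k + (n + 1)) + a k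

namespace IsSol

variable {n : ℕ} {a : ℕ → ℤ} {t : ℝ}

theorem tendsto_sub (ha : IsSol n a) (ht : t ^ (n + 2) + 2 * t ^ (n + 1) = 1) (h2 : 2 < |t|) :
    Filter.Tendsto (fun k => (a (k + 1) : ℝ) - t * a k) Filter.atTop (nhds 0) := by
  have ht0 : t ≠ 0 := by
    rintro rfl
    norm_num at h2
  have hr : |t⁻¹| < 1 / 2 := by
    rw [abs_inv, inv_lt_comm₀ (by linarith) (by norm_num)]
    linarith
  refine tendsto_zero_of_contracting (m := n + 1) (Nat.succ_pos n)
    (b := fun j => -(t⁻¹) ^ (j + 1)) (θ := |t⁻¹| / (1 - |t⁻¹|)) ?_ ?_ fun k => ?_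
  · rw [div_lt_one (by linarith)]
    linarith
  · simp only [abs_neg, abs_pow]
    rw [le_div_iff₀ (by linarith)]
    simp only [pow_succ, ← Finset.sum_mul]
    have h3 := geom_sum_mul_neg |t⁻¹| (n + 1)
    have h4 : 0 ≤ |t⁻¹| ^ (n + 1) := by positivity
    nlinarith [abs_nonneg t⁻¹]
  · have h3 : ∀ m, ∑ j ∈ Finset.range m, -(t⁻¹) ^ (j + 1) *
        ((a (k + j + 1) : ℝ) - t * a (k + j)) = a k - (t⁻¹) ^ m * a (k + m) := by
      intro m
      induction m with
      | zero => simp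
      | succ m ih =>
        rw [Finset.sum_range_succ, ih, ← add_assoc, pow_succ]
        field_simp
        ring
    rw [h3]
    have h4 : ((a (k + (n + 1) + 1) : ℤ) : ℝ) = -2 * a (k + (n + 1)) + a k := by
      have := ha k
      rw [← add_assoc, ← add_assoc] at this
      exact_mod_cast this
    have h5 : (t⁻¹) ^ (n + 1) = t + 2 := by
      have h6 : (t + 2) * t ^ (n + 1) = 1 := by linear_combination ht
      rw [inv_pow]
      exact (eq_inv_of_mul_eq_one_left h6).symm
    rw [h4, h5]
    ring

theorem tendsto_sub_pow (ha : IsSol n a) (ht : t ^ (n + 2) + 2 * t ^ (n + 1) = 1) (h2 : 2 < |t|)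
    (i : ℕ) :
    Filter.Tendsto (fun k => (a (k + i) : ℝ) - t ^ i * a k) Filter.atTop (nhds 0) := by
  induction i with
  | zero => simp
  | succ i ih =>
    have h := (((ha.tendsto_sub ht h2).comp (Filter.tendsto_add_atTop_nat i)).add
      (ih.const_mul t))
    simp only [mul_zero, add_zero] at h
    refine h.congr fun k => ?_
    simp only [Function.comp_apply, add_assoc]
    ring

theorem tendsto_sum_sub (ha : IsSol n a) (ht : t ^ (n + 2) + 2 * t ^ (n + 1) = 1) (h2 : 2 < |t|)
    {N : ℕ} (c : Fin N → ℤ) :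
    Filter.Tendsto (fun k => ((∑ i, c i * a (k + i) : ℤ) : ℝ) - (∑ i, c i * t ^ (i : ℕ)) * a k)
      Filter.atTop (nhds 0) := by
  have h := tendsto_finsetSum Finset.univ fun (i : Fin N) _ =>
    (ha.tendsto_sub_pow ht h2 i).const_mul (c i : ℝ)
  simp only [mul_zero, Finset.sum_const_zero] at h
  refine h.congr fun k => ?_
  push_cast
  rw [Finset.sum_mul, ← Finset.sum_sub_distrib]
  exact Finset.sum_congr rfl fun i _ => by ring

theorem eq_zero_of_window (ha : IsSol n a) : ∀ k, (∀ i < n + 2, a (k + i) = 0) →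
    ∀ i < n + 2, a i = 0
  | 0, h => by simpa using h
  | k + 1, h => by
    refine ha.eq_zero_of_window k fun i hi => ?_
    rcases i with _ | i
    · have h1 := ha k
      have h3 := h (n + 1) (by omega)
      have h4 := h n (by omega)
      rw [show k + 1 + (n + 1) = k + (n + 2) by ring] at h3
      rw [show k + 1 + n = k + (n + 1) by ring] at h4
      rw [h3, h4] at h1
      simpa using h1.symm
    · have h1 := h i (by omega)
      rwa [show k + (i + 1) = k + 1 + i by ring]

theorem eventually_eq_zero {s : ℕ → ℤ}
    (h : Filter.Tendsto (fun k => (s k : ℝ)) Filter.atTop (nhds 0)) :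
    ∀ᶠ k in Filter.atTop, s k = 0 := by
  filter_upwards [h.eventually (Metric.ball_mem_nhds 0 one_pos)] with k hk
  rw [dist_zero_right, Real.norm_eq_abs] at hk
  exact Int.abs_lt_one_iff.1 (by exact_mod_cast hk)

theorem sum_eq_zero (ha : IsSol n a) (ht : t ^ (n + 2) + 2 * t ^ (n + 1) = 1) (h2 : 2 < |t|)
    {N : ℕ} (c : Fin N → ℤ) (hc : ∑ i, c i * t ^ (i : ℕ) = 0) : ∑ i, c i * a i = 0 := by
  have h := ha.tendsto_sum_sub ht h2 c
  simp only [hc, zero_mul, sub_zero] at h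
  obtain ⟨k, hk⟩ := Filter.eventually_atTop.1 (eventually_eq_zero h)
  have hs : IsSol n fun k => ∑ i, c i * a (k + i) := by
    intro k
    dsimp only
    rw [Finset.mul_sum, ← Finset.sum_add_distrib]
    refine Finset.sum_congr rfl fun i _ => ?_
    have := ha (k + i)
    rw [show k + (n + 2) + i = k + i + (n + 2) by ring, this,
      show k + (n + 1) + i = k + i + (n + 1) by ring]
    ring
  simpa using hs.eq_zero_of_window k (fun i _ => hk _ (by omega)) 0 (by omega)

theorem eq_zero_of_sum_eq_zero (ha : IsSol n a) (ht : t ^ (n + 2) + 2 * t ^ (n + 1) = 1)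
    (h2 : 2 < |t|) {N : ℕ} (c : Fin N → ℤ) (hc : ∑ i, c i * t ^ (i : ℕ) ≠ 0) {k : ℕ} (hk : 0 < k)
    (h : ∀ m, ∑ i, c i * a (k * m + i) = 0) : ∀ i < n + 2, a i = 0 := by
  have hk' : Filter.Tendsto (fun m => k * m) Filter.atTop Filter.atTop :=
    Filter.tendsto_id.const_mul_atTop' hk
  have h3 : Filter.Tendsto (fun m => (a (k * m) : ℝ)) Filter.atTop (nhds 0) := by
    have h4 := ((ha.tendsto_sum_sub ht h2 c).comp hk').const_mul (-(∑ i, c i * t ^ (i : ℕ))⁻¹)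
    rw [mul_zero] at h4
    refine h4.congr fun m => ?_
    simp only [Function.comp_apply, h]
    push_cast
    field_simp
    ring
  have h5 : ∀ i, ∀ᶠ m in Filter.atTop, a (k * m + i) = 0 := by
    intro i
    have h6 := ((ha.tendsto_sub_pow ht h2 i).comp hk').add (h3.const_mul (t ^ i))
    simp only [mul_zero, add_zero] at h6
    exact eventually_eq_zero (h6.congr fun m => by simp)
  have h7 : ∀ᶠ m in Filter.atTop, ∀ i ∈ Finset.range (n + 2), a (k * m + i) = 0 :=
    (Filter.eventually_all_finset _).2 fun i _ => h5 i
  obtain ⟨m, hm⟩ := h7.exists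
  exact ha.eq_zero_of_window (k * m) fun i hi => hm i (Finset.mem_range.2 hi)

end IsSol

/-- The endomorphism `x₀ ↦ x₁ ↦ ⋯ ↦ xₙ₊₁ ↦ xₙ₊₁⁻² x₀` of the free group. -/
def cyclicHom (n : ℕ) : FreeGroupN (n + 2) →* FreeGroupN (n + 2) :=
  FreeGroup.lift (Fin.lastCases ((of (Fin.last _))⁻¹ * (of (Fin.last _))⁻¹ * of 0)
    fun i => of i.succ)

/-- The inverse of `cyclicHom`. -/
def cyclicHomInv (n : ℕ) : FreeGroupN (n + 2) →* FreeGroupN (n + 2) :=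
  FreeGroup.lift (Fin.cases
    (of (Fin.last n).castSucc * of (Fin.last n).castSucc * of (Fin.last _)) fun i => of i.castSucc)

@[simp]
theorem cyclicHom_castSucc {n : ℕ} (i : Fin (n + 1)) : cyclicHom n (of i.castSucc) = of i.succ := by
  simp [cyclicHom]

@[simp]
theorem cyclicHom_last {n : ℕ} : cyclicHom n (of (Fin.last _)) =
    (of (Fin.last _))⁻¹ * (of (Fin.last _))⁻¹ * of 0 := by
  simp [cyclicHom]

@[simp]
theorem cyclicHomInv_succ {n : ℕ} (i : Fin (n + 1)) :
    cyclicHomInv n (of i.succ) = of i.castSucc := by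
  simp [cyclicHomInv]

@[simp]
theorem cyclicHomInv_zero {n : ℕ} : cyclicHomInv n (of 0) =
    of (Fin.last n).castSucc * of (Fin.last n).castSucc * of (Fin.last _) := by
  simp [cyclicHomInv]

/-- The automorphism `x₀ ↦ x₁ ↦ ⋯ ↦ xₙ₊₁ ↦ xₙ₊₁⁻² x₀` of the free group. -/
def cyclicAut (n : ℕ) : MulAut (FreeGroupN (n + 2)) :=
  MonoidHom.toMulEquiv (cyclicHom n) (cyclicHomInv n)
    (by
      ext i
      induction i using Fin.lastCases with
      | last =>
        have h := cyclicHomInv_succ (Fin.last n)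
        rw [Fin.succ_last] at h
        simp [h, mul_assoc]
      | cast i => simp)
    (by
      ext i
      induction i using Fin.cases with
      | zero => simp [mul_assoc, Fin.succ_last]
      | succ i => simp)

theorem cyclicAut_apply {n : ℕ} (g : FreeGroupN (n + 2)) : cyclicAut n g = cyclicHom n g := rfl

theorem cyclicAut_inv_apply {n : ℕ} (g : FreeGroupN (n + 2)) :
    (cyclicAut n)⁻¹ g = cyclicHomInv n g := rfl

theorem cyclicAut_pow_apply {n : ℕ} (i : Fin (n + 2)) :
    of i = (cyclicAut n ^ (i : ℕ)) (of 0) := by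
  induction i using Fin.induction with
  | zero => simp
  | succ i ih =>
    rw [Fin.val_succ, pow_succ', MulAut.mul_apply]
    rw [Fin.val_castSucc] at ih
    rw [← ih, cyclicAut_apply, cyclicHom_castSucc]

theorem toWord_cyclicHom_last {n : ℕ} : (cyclicHom n (of (Fin.last _))).toWord =
    [(Fin.last _, false), (Fin.last _, false), (0, true)] := by
  rw [cyclicHom_last]
  refine toWord_mk_of_isReduced ?_
  have h : Fin.last (n + 1) ≠ 0 := Fin.last_pos.ne'
  simp [IsReduced, invRev, h]

theorem toWord_cyclicHomInv_zero {n : ℕ} : (cyclicHomInv n (of 0)).toWord =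
    [((Fin.last n).castSucc, true), ((Fin.last n).castSucc, true), (Fin.last _, true)] := by
  rw [cyclicHomInv_zero]
  refine toWord_mk_of_isReduced ?_
  simp [IsReduced]

/-- The stretch factor data of `cyclicAut`, for even rank. -/
def cyclicAutPositive {n : ℕ} (hn : Even n) {μ : ℝ} (h1 : 1 < μ)
    (hμ : μ ^ (n + 2) = 2 * μ ^ (n + 1) + 1) : SignedPositive (cyclicAut n) μ where
  sign i := decide (Odd (i : ℕ))
  flip := true
  w i := μ ^ (i : ℕ)
  w_pos i := by positivity
  one_lt := h1
  sgn_eq i := by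
    rw [cyclicAut_apply]
    induction i using Fin.lastCases with
    | last =>
      rw [toWord_cyclicHom_last]
      simp [hn]
    | cast i => simp [Nat.odd_add_one, -Nat.not_odd_iff_even]
  wt_eq i := by
    rw [cyclicAut_apply]
    induction i using Fin.lastCases with
    | last =>
      simp only [toWord_cyclicHom_last, wt, List.map_cons, List.map_nil, List.sum_cons,
        List.sum_nil, Fin.val_last, Fin.val_zero]
      linear_combination -hμ
    | cast i => simp [wt, pow_succ']

/-- The stretch factor data of the inverse of `cyclicAut`. -/
def cyclicAutInvPositive {n : ℕ} {ν : ℝ} (h1 : 1 < ν)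
    (hν : ν ^ (n + 2) = 2 * ν + 1) : SignedPositive (cyclicAut n)⁻¹ ν where
  sign _ := false
  flip := false
  w i := ν ^ (n + 1 - (i : ℕ))
  w_pos i := by positivity
  one_lt := h1
  sgn_eq i := by
    rw [cyclicAut_inv_apply]
    induction i using Fin.cases with
    | zero =>
      rw [toWord_cyclicHomInv_zero]
      simp
    | succ i => simp
  wt_eq i := by
    rw [cyclicAut_inv_apply]
    induction i using Fin.cases with
    | zero =>
      simp only [toWord_cyclicHomInv_zero, wt, List.map_cons, List.map_nil, List.sum_cons,
        List.sum_nil, Fin.val_last, Fin.val_zero, Fin.val_castSucc]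
      rw [Nat.add_sub_cancel_left, Nat.sub_self, Nat.sub_zero]
      linear_combination -hν
    | succ i =>
      have h : n + 1 - (i : ℕ) = n + 1 - (i + 1 : ℕ) + 1 := by omega
      simp only [cyclicHomInv_succ, toWord_of, wt, List.map_cons, List.map_nil, List.sum_cons,
        List.sum_nil, Fin.val_succ, Fin.val_castSucc]
      rw [h, pow_succ', add_zero]

theorem toAdd_hom_eq_sum {N : ℕ} (χ : FreeGroupN N →* Multiplicative ℤ) (g : FreeGroupN N) :
    Multiplicative.toAdd (χ g) = ∑ i, Multiplicative.toAdd
      (FreeGroup.lift (Pi.mulSingle i (Multiplicative.ofAdd 1)) g) *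
        Multiplicative.toAdd (χ (of i)) := by
  induction g using FreeGroup.induction_on with
  | C1 => simp
  | of j =>
    simp [Pi.mulSingle_apply, apply_ite]
  | inv_of j h =>
    simp only [_root_.map_inv, toAdd_inv, neg_mul, Finset.sum_neg_distrib]
    rw [← h]
  | mul x y hx hy => simp only [_root_.map_mul, toAdd_mul, hx, hy, add_mul, Finset.sum_add_distrib]

theorem isSol_hom {n : ℕ} (χ : FreeGroupN (n + 2) →* Multiplicative ℤ) :
    IsSol n fun k => Multiplicative.toAdd (χ ((cyclicAut n ^ k) (of 0))) := by
  intro k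
  have h1 : (cyclicAut n ^ (n + 1)) (of 0) = of (Fin.last (n + 1)) := by
    simpa using (cyclicAut_pow_apply (Fin.last (n + 1))).symm
  have h2 : (cyclicAut n ^ (n + 2)) (of 0) =
      (of (Fin.last _))⁻¹ * (of (Fin.last _))⁻¹ * of 0 := by
    rw [pow_succ', MulAut.mul_apply, h1, cyclicAut_apply, cyclicHom_last]
  simp only [pow_add (cyclicAut n) k, MulAut.mul_apply, h1, h2, _root_.map_mul, _root_.map_inv,
    toAdd_mul, toAdd_inv]
  ring

theorem fullyIrreducible_cyclicAut {n : ℕ} {t : ℝ} (ht : t ^ (n + 2) + 2 * t ^ (n + 1) = 1)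
    (h2 : 2 < |t|) :
    FullyIrreducible (QuotientGroup.mk (cyclicAut n) : Out (FreeGroupN (n + 2))) := by
  refine fullyIrreducible_of_hom fun k χ χ' a hk hχ hχ' => ?_
  set c : Fin (n + 2) → ℤ := fun i => Multiplicative.toAdd
      (FreeGroup.lift (Pi.mulSingle i (Multiplicative.ofAdd 1)) a) with hc
  have hsum : ∀ (ψ : FreeGroupN (n + 2) →* Multiplicative ℤ) (m : ℕ),
      Multiplicative.toAdd (ψ ((cyclicAut n ^ m) a)) =
        ∑ i, c i * Multiplicative.toAdd (ψ ((cyclicAut n ^ (m + (i : ℕ))) (of 0))) := by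
    intro ψ m
    have h := toAdd_hom_eq_sum
      (ψ.comp ((cyclicAut n ^ m : MulAut _) : FreeGroupN (n + 2) →* FreeGroupN (n + 2))) a
    refine h.trans (Finset.sum_congr rfl fun i _ => ?_)
    rw [pow_add, MulAut.mul_apply, ← cyclicAut_pow_apply]
    rfl
  have h3 : ∑ i, c i * t ^ (i : ℕ) ≠ 0 := by
    intro h
    have h4 := (isSol_hom χ').sum_eq_zero ht h2 c h
    have h5 := hsum χ' 0
    simp only [zero_add] at h5
    rw [h4] at h5
    exact hχ' (by simpa using h5)
  have h4 := (isSol_hom χ).eq_zero_of_sum_eq_zero ht h2 c h3 hk fun m => by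
    rw [← hsum χ, hχ]
    rfl
  ext i
  have h5 := h4 i i.2
  rw [← cyclicAut_pow_apply] at h5
  simpa using h5

theorem exists_pow_eq_two_mul_pow_add_one (n : ℕ) :
    ∃ μ : ℝ, 2 < μ ∧ μ ^ (n + 2) = 2 * μ ^ (n + 1) + 1 := by
  obtain ⟨μ, ⟨h1, h2⟩, h3⟩ := intermediate_value_Icc (show (2 : ℝ) ≤ 3 by norm_num)
    (f := fun x : ℝ => x ^ (n + 2) - 2 * x ^ (n + 1)) (by fun_prop)
    (show (1 : ℝ) ∈ Set.Icc _ _ from ⟨by simp only [pow_succ]; linarith, by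
      have : (1 : ℝ) ≤ 3 ^ (n + 1) := one_le_pow₀ (by norm_num)
      simp only [pow_succ] at this ⊢
      linarith⟩)
  dsimp only at h3
  refine ⟨μ, lt_of_le_of_ne h1 ?_, by linarith⟩
  rintro rfl
  simp only [pow_succ] at h3
  linarith

theorem exists_pow_eq_two_mul_add_one (n : ℕ) :
    ∃ ν : ℝ, 1 < ν ∧ ν ^ (n + 2) = 2 * ν + 1 ∧ ν ^ (n + 1) ≤ 3 := by
  obtain ⟨ν, ⟨h1, h2⟩, h3⟩ := intermediate_value_Icc (show (1 : ℝ) ≤ 3 by norm_num)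
    (f := fun x : ℝ => x ^ (n + 2) - 2 * x) (by fun_prop)
    (show (1 : ℝ) ∈ Set.Icc _ _ from ⟨by norm_num, by
      have : (1 : ℝ) ≤ 3 ^ n := one_le_pow₀ (by norm_num)
      simp only [pow_succ] at this ⊢
      linarith⟩)
  dsimp only at h3
  refine ⟨ν, lt_of_le_of_ne h1 ?_, by linarith, ?_⟩
  · rintro rfl
    norm_num at h3
  · rw [pow_succ] at h3
    have h4 : ν * ν ^ (n + 1) ≤ ν * 3 := by linarith
    exact le_of_mul_le_mul_left h4 (by linarith)

/-- The ratio of the stretch factors of `cyclicAut` and of its inverse. -/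
theorem exists_mem_stretchRatioSet {n : ℕ} (hn : Even n) :
    ∃ r ∈ stretchRatioSet (n + 2), ((n + 1 : ℕ) : ℝ) / 2 ≤ r := by
  obtain ⟨μ, hμ, hμ'⟩ := exists_pow_eq_two_mul_pow_add_one n
  obtain ⟨ν, hν, hν', hν''⟩ := exists_pow_eq_two_mul_add_one n
  have ht : (-μ) ^ (n + 2) + 2 * (-μ) ^ (n + 1) = 1 := by
    rw [(hn.add even_two).neg_pow, hn.add_one.neg_pow]
    linarith
  refine ⟨_, ⟨_, fullyIrreducible_cyclicAut ht ?_, μ, ν,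
    (cyclicAutPositive hn (by linarith) hμ').hasStretchFactor,
    (cyclicAutInvPositive hν hν').hasStretchFactor, rfl⟩, ?_⟩
  · rwa [abs_neg, abs_of_pos (by linarith)]
  · have h1 : 0 < Real.log ν := Real.log_pos hν
    have h2 : ((n + 1 : ℕ) : ℝ) * Real.log ν ≤ Real.log 3 := by
      rw [← Real.log_pow]
      exact Real.log_le_log (by positivity) hν''
    have h3 : Real.log 3 ≤ 2 * Real.log 2 := by
      have : Real.log 3 ≤ Real.log (2 ^ 2) := Real.log_le_log (by norm_num) (by norm_num)
      rwa [Real.log_pow] at this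
    have h4 : Real.log 2 ≤ Real.log μ := Real.log_le_log (by norm_num) hμ.le
    rw [le_div_iff₀ h1]
    linarith

end FreeGroup

/-- `limsup_{N→∞} C_N = ∞`: the sequence `(C_N)_{N ≥ 2}` is not bounded above
by any real constant. -/
theorem limsup_CN_eq_infty : ∀ M : ℝ, ∃ N : ℕ, 2 ≤ N ∧ M < CN N := by
  intro M
  obtain ⟨k, hk⟩ := exists_nat_gt M
  obtain ⟨r, hr, hr'⟩ := FreeGroup.exists_mem_stretchRatioSet (even_two_mul k)
  refine ⟨2 * k + 2, by omega, ?_⟩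
  have h := le_csSup (FreeGroup.bddAbove_stretchRatioSet (by omega)) hr
  push_cast at hr'
  have : M < r := by linarith
  exact this.trans_le h
end
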